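/- arXiv:1710.09780 — 4 statements merged into one kernel-verified Lean document; each statement's English description precedes it below -/
import Mathlib

section
/- Let 𝔽 be a finite field with q elements and let n ≥ 1. If K ⊆ 𝔽ⁿ is a Kakeya set, then the cardinality of K is at least (q/2)ⁿ, i.e. |K| ≥ qⁿ / 2ⁿ. -/
namespace KakeyaAux
open MvPolynomial

noncomputable def shift {σ F : Type*} [Field F] (a : σ → F) :
    MvPolynomial σ F →ₐ[F] MvPolynomial σ F := aeval (fun i => C (a i) + X i)

def Van {σ F : Type*} [Field F] (P : MvPolynomial σ F) (a : σ → F) (m : ℕ) : Prop :=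
  ∀ i : σ →₀ ℕ, i.degree < m → coeff i (shift a P) = 0

lemma shift_ne_zero {σ F : Type*} [Field F] (a : σ → F) {P : MvPolynomial σ F} (h : P ≠ 0) :
    shift a P ≠ 0 := by
  intro h0
  apply h
  have : (shift (-a)).comp (shift a) = AlgHom.id F (MvPolynomial σ F) := by
    ext1 i; simp [shift]
  have h2 := congrArg (fun f => f P) this
  simpa [h0] using h2.symm

lemma Van.dvd {σ F : Type*} [Field F] {P : MvPolynomial σ F} {a : σ → F} {m : ℕ}
    (h : Van P a m) {B : Type*} [CommRing B] [Algebra F B] (s : B) (z w : σ → B)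
    (hz : ∀ i, z i = algebraMap F B (a i) + s * w i) : s ^ m ∣ aeval z P := by
  have h1 : aeval z P = aeval (fun i => s * w i) (shift a P) := by
    have : (aeval z : MvPolynomial σ F →ₐ[F] B)
        = (aeval (fun i => s * w i)).comp (shift a) := by
      ext1 i; simp [shift, hz]
    rw [this]; rfl
  rw [h1, aeval_def, eval₂_eq]
  refine Finset.dvd_sum fun i hi => Dvd.dvd.mul_left ?_ _
  have hm : m ≤ i.degree := by
    by_contra hlt
    exact (mem_support_iff.1 hi) (h i (by omega))
  simp_rw [mul_pow, Finset.prod_mul_distrib, Finset.prod_pow_eq_pow_sum]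
  refine Dvd.dvd.mul_right (pow_dvd_pow _ ?_) _
  exact hm

/-- the coefficient of a polynomial after scaling all the variables -/
lemma coeff_scale {σ R : Type*} [CommRing R] (s : R) (G : MvPolynomial σ R) (i : σ →₀ ℕ) :
    coeff i (aeval (fun j => C s * X j : σ → MvPolynomial σ R) G) = s ^ i.degree * coeff i G := by
  classical
  induction G using MvPolynomial.induction_on' with
  | monomial e c =>
    have : aeval (fun j => C s * X j : σ → MvPolynomial σ R) (monomial e c)
        = monomial e (s ^ e.degree * c) := by
      have hdeg : e.degree = ∑ j ∈ e.support, e j := rfl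
      rw [aeval_monomial, monomial_eq, hdeg]
      simp only [Finsupp.prod, mul_pow, Finset.prod_mul_distrib, Finset.prod_pow_eq_pow_sum,
        algebraMap_eq, C_mul, C_pow]
      ring
    rw [this, coeff_monomial, coeff_monomial]
    split_ifs with h
    · rw [h]
    · simp
  | add p q hp hq => rw [map_add, coeff_add, hp, hq, coeff_add, mul_add]

/-- Key vanishing lemma. -/
lemma key_dvd {σ τ F : Type*} [Field F] {P : MvPolynomial τ F} {p : τ → F} {m : ℕ}
    (h : Van P p m) (z w : τ → MvPolynomial σ (Polynomial F)) (s : Polynomial F) (hs : s ≠ 0)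
    (hz : ∀ j, aeval (fun j => C s * X j : σ → MvPolynomial σ (Polynomial F)) (z j)
      = C (Polynomial.C (p j)) + C s * w j) (i : σ →₀ ℕ) :
    s ^ (m - i.degree) ∣ coeff i (aeval z P) := by
  have h1 := h.dvd (C s) (fun j => aeval (fun j => C s * X j : σ → MvPolynomial σ (Polynomial F))
    (z j)) w (fun j => hz j)
  have h2 : aeval (fun j => aeval (fun j => C s * X j : σ → MvPolynomial σ (Polynomial F))
    (z j)) P = aeval (fun j => C s * X j : σ → MvPolynomial σ (Polynomial F)) (aeval z P) := by
    have : (aeval (fun j => aeval (fun j => C s * X j : σ → MvPolynomial σ (Polynomial F))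
        (z j)) : MvPolynomial τ F →ₐ[F] _) =
        ((aeval (fun j => C s * X j : σ → MvPolynomial σ (Polynomial F))).restrictScalars F).comp
          (aeval z) := by
      ext1 j; simp
    rw [this]; rfl
  rw [h2, ← C_pow, C_dvd_iff_dvd_coeff] at h1
  have h3 := h1 i
  rw [coeff_scale] at h3
  by_cases hm : m ≤ i.degree
  · simp [Nat.sub_eq_zero_of_le hm]
  · have : m = i.degree + (m - i.degree) := by omega
    rw [this, pow_add] at h3
    exact (mul_dvd_mul_iff_left (pow_ne_zero _ hs)).1 h3

lemma card_mul_le {F : Type*} [Field F] [Fintype F] {f : Polynomial F} (hf : f ≠ 0) (k : ℕ)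
    (h : ∀ c : F, (Polynomial.X - Polynomial.C c) ^ k ∣ f) :
    Fintype.card F * k ≤ f.natDegree := by
  have h1 : (∏ c : F, (Polynomial.X - Polynomial.C c) ^ k) ∣ f := by
    refine Finset.prod_dvd_of_coprime (fun a _ b _ hab => ?_) (fun c _ => h c)
    exact (Polynomial.pairwise_coprime_X_sub_C Function.injective_id hab).pow
  have h2 := Polynomial.natDegree_le_of_dvd h1 hf
  rw [Polynomial.natDegree_prod_of_monic _ _ (fun c _ => (Polynomial.monic_X_sub_C c).pow k)] at h2
  simpa using h2

/-- Schwartz–Zippel with multiplicities on the full space. -/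
lemma sz {F : Type*} [Field F] [Fintype F] (n : ℕ) : ∀ (l : ℕ) (Q : MvPolynomial (Fin n) F),
    Q ≠ 0 → (∀ b, Van Q b l) → l * Fintype.card F ≤ Q.totalDegree := by
  induction n with
  | zero =>
    intro l Q hQ hV
    rcases Nat.eq_zero_or_pos l with rfl | hl
    · simp
    · exfalso
      apply shift_ne_zero 0 hQ
      ext i
      have : i = 0 := Subsingleton.elim _ _
      simpa using hV 0 i (by simp [this, hl])
  | succ n ih =>
    intro l Q hQ hV
    set q := Fintype.card F with hq
    have hq0 : 0 < q := Fintype.card_pos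
    set p := finSuccEquiv F n Q with hp
    have hp0 : p ≠ 0 := by simpa [hp] using hQ
    set r := p.natDegree
    have hr0 : p.coeff r ≠ 0 := by simpa [r] using hp0
    have hdeg : (p.coeff r).totalDegree + r ≤ Q.totalDegree :=
      totalDegree_coeff_finSuccEquiv_add_le Q r hr0
    have hvan : ∀ b, Van (p.coeff r) b (l - r / q) := by
      intro b i hi
      by_contra hne
      let z : Fin (n+1) → MvPolynomial (Fin n) (Polynomial F) :=
        Fin.cons (C Polynomial.X) (fun j => C (Polynomial.C (b j)) + X j)
      have hG : aeval z Q = ∑ j ∈ Finset.range (r+1),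
          C (Polynomial.X ^ j) * map Polynomial.C (shift b (p.coeff j)) := by
        let φ : MvPolynomial (Fin n) F →ₐ[F] MvPolynomial (Fin n) (Polynomial F) :=
          aeval (fun j => C (Polynomial.C (b j)) + X j)
        have hφ : ∀ x, φ x = map Polynomial.C (shift b x) := by
          intro x
          induction x using MvPolynomial.induction_on with
          | C c => simp [φ, shift, MvPolynomial.algebraMap_apply]
          | add x y hx hy => simp [hx, hy]
          | mul_X x i hx => rw [map_mul, hx]; simp [φ, shift]
        have h1 : aeval z Q = Polynomial.eval₂ φ.toRingHom (C Polynomial.X) p := by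
          have h2 : (aeval z : MvPolynomial (Fin (n+1)) F →ₐ[F] _).toRingHom =
              (Polynomial.eval₂RingHom φ.toRingHom (C Polynomial.X)).comp
                (finSuccEquiv F n).toRingEquiv.toRingHom := by
            refine MvPolynomial.ringHom_ext (fun c => ?_) (fun j => ?_)
            · simp [finSuccEquiv_apply]
            · refine Fin.cases ?_ (fun j => ?_) j
              · simp [z, finSuccEquiv_X_zero]
              · simp [z, φ, finSuccEquiv_X_succ]
          exact congrArg (fun f => f Q) h2
        rw [h1, Polynomial.eval₂_eq_sum_range]
        refine Finset.sum_congr rfl fun j _ => ?_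
        rw [mul_comm, C_pow]
        congr 1
        exact hφ _
      have hc : coeff i (aeval z Q) = ∑ j ∈ Finset.range (r+1),
          Polynomial.monomial j (coeff i (shift b (p.coeff j))) := by
        rw [hG, coeff_sum]
        refine Finset.sum_congr rfl fun j _ => ?_
        rw [coeff_C_mul, coeff_map, mul_comm, Polynomial.C_mul_X_pow_eq_monomial]
      have hc0 : coeff i (aeval z Q) ≠ 0 := by
        intro h0
        apply hne
        have := congrArg (fun f => Polynomial.coeff f r) (hc.symm.trans h0)
        simpa [Polynomial.coeff_monomial] using this
      have hcd : (coeff i (aeval z Q)).natDegree ≤ r := by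
        rw [hc]
        refine Polynomial.natDegree_sum_le_of_forall_le _ _ fun j hj => ?_
        exact (Polynomial.natDegree_monomial_le _).trans (by simp at hj; omega)
      have := card_mul_le hc0 (l - i.degree) (fun c => by
        refine key_dvd (hV (Fin.cons c b)) z (Fin.cons 1 (fun j => X j)) _
          (Polynomial.X_sub_C_ne_zero c) ?_ i
        intro j
        refine Fin.cases ?_ (fun j => ?_) j
        · simp [z]
        · simp [z])
      have h3 : q * (l - i.degree) ≤ r := this.trans hcd
      have h4 : l - i.degree ≤ r / q := (Nat.le_div_iff_mul_le hq0).2 (by rwa [mul_comm])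
      omega
    have := ih _ _ hr0 hvan
    have h5 : r / q * q ≤ r := Nat.div_mul_le_self r q
    rw [Nat.sub_mul] at this
    omega

def Rel {σ F : Type*} [Field F] (k : ℕ) (H : MvPolynomial σ (Polynomial F))
    (T : MvPolynomial σ F) : Prop :=
  ∀ i, (coeff i H).natDegree ≤ k ∧ (coeff i H).coeff k = coeff i T

lemma Rel.mul {σ F : Type*} [Field F] {k k' : ℕ} {H H' : MvPolynomial σ (Polynomial F)}
    {T T' : MvPolynomial σ F} (h : Rel k H T) (h' : Rel k' H' T') :
    Rel (k + k') (H * H') (T * T') := by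
  classical
  intro i
  rw [coeff_mul, coeff_mul]
  constructor
  · refine Polynomial.natDegree_sum_le_of_forall_le _ _ fun j hj => ?_
    exact Polynomial.natDegree_mul_le_of_le (h _).1 (h' _).1
  · rw [Polynomial.finsetSum_coeff]
    refine Finset.sum_congr rfl fun j _ => ?_
    rw [Polynomial.coeff_mul_add_eq_of_natDegree_le (h _).1 (h' _).1, (h _).2, (h' _).2]

lemma Rel.add {σ F : Type*} [Field F] {k : ℕ} {H H' : MvPolynomial σ (Polynomial F)}
    {T T' : MvPolynomial σ F} (h : Rel k H T) (h' : Rel k H' T') :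
    Rel k (H + H') (T + T') := by
  intro i
  rw [coeff_add, coeff_add]
  exact ⟨Polynomial.natDegree_add_le_of_degree_le (h _).1 (h' _).1, by
    rw [Polynomial.coeff_add, (h _).2, (h' _).2]⟩

lemma Rel.zero {σ F : Type*} [Field F] (k : ℕ) : Rel k (0 : MvPolynomial σ (Polynomial F)) 0 := by
  intro i; simp

lemma Rel.sum {σ F ι : Type*} [Field F] {k : ℕ} (s : Finset ι)
    {H : ι → MvPolynomial σ (Polynomial F)}
    {T : ι → MvPolynomial σ F} (h : ∀ e ∈ s, Rel k (H e) (T e)) :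
    Rel k (∑ e ∈ s, H e) (∑ e ∈ s, T e) := by
  classical
  induction s using Finset.induction_on with
  | empty => simpa using Rel.zero k
  | insert a s ha ih =>
    rw [Finset.sum_insert ha, Finset.sum_insert ha]
    exact (h a (by simp)).add (ih fun e he => h e (by simp [he]))

lemma Rel.const {σ F : Type*} [Field F] (c : F) :
    Rel 0 (C (Polynomial.C c) : MvPolynomial σ (Polynomial F)) (C c) := by
  classical
  intro i
  rw [coeff_C, coeff_C]
  split_ifs <;> simp

lemma Rel.pow {σ F : Type*} [Field F] {k : ℕ} {H : MvPolynomial σ (Polynomial F)}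
    {T : MvPolynomial σ F} (h : Rel k H T) (e : ℕ) : Rel (e * k) (H ^ e) (T ^ e) := by
  induction e with
  | zero => simpa using Rel.const (σ := σ) (1 : F)
  | succ e ih => rw [pow_succ, pow_succ, Nat.succ_mul]; exact ih.mul h

lemma Rel.prod {σ F ι : Type*} [Field F] {k : ι → ℕ} (s : Finset ι)
    {H : ι → MvPolynomial σ (Polynomial F)}
    {T : ι → MvPolynomial σ F} (h : ∀ e ∈ s, Rel (k e) (H e) (T e)) :
    Rel (∑ e ∈ s, k e) (∏ e ∈ s, H e) (∏ e ∈ s, T e) := by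
  classical
  induction s using Finset.induction_on with
  | empty => simpa using Rel.const (σ := σ) (1 : F)
  | insert a s ha ih =>
    rw [Finset.sum_insert ha, Finset.prod_insert ha, Finset.prod_insert ha]
    exact (h a (by simp)).mul (ih fun e he => h e (by simp [he]))

lemma Rel.weaken {σ F : Type*} [Field F] {k k' : ℕ} {H : MvPolynomial σ (Polynomial F)}
    {T : MvPolynomial σ F} (h : Rel k H T) (hk : k < k') : Rel k' H 0 := by
  intro i
  exact ⟨(h i).1.trans hk.le, by
    rw [Polynomial.coeff_eq_zero_of_natDegree_lt ((h i).1.trans_lt hk), coeff_zero]⟩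

lemma rel_line {σ F : Type*} [Field F] (a b : σ → F) (P : MvPolynomial σ F) :
    Rel P.totalDegree (aeval (fun j => C (Polynomial.C (a j) + Polynomial.X * Polynomial.C (b j))
        + C Polynomial.X * X j : σ → MvPolynomial σ (Polynomial F)) P)
      (shift b (homogeneousComponent P.totalDegree P)) := by
  classical
  rw [homogeneousComponent_apply, Finset.sum_filter, map_sum]
  rw [aeval_def, eval₂_eq]
  refine Rel.sum _ fun e he => ?_
  have hlin : ∀ j, Rel 1 (C (Polynomial.C (a j) + Polynomial.X * Polynomial.C (b j))
        + C Polynomial.X * X j : MvPolynomial σ (Polynomial F)) (C (b j) + X j) := by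
    intro j i
    rw [coeff_add, coeff_add, coeff_C, coeff_C, coeff_C_mul, coeff_X, coeff_X]
    constructor
    · split_ifs <;> simp <;> compute_degree
    · split_ifs <;> simp [Polynomial.coeff_C]
  have hprod := Rel.prod e.support (fun j _ => (hlin j).pow (e j))
  have hmon := (Rel.const (σ := σ) (coeff e P)).mul hprod
  have hd : 0 + ∑ j ∈ e.support, e j * 1 = e.degree := by
    simp only [zero_add, mul_one]; rfl
  rw [hd] at hmon
  have hle : e.degree ≤ P.totalDegree := le_totalDegree he
  have heq : shift b (monomial e (coeff e P)) =
      C (coeff e P) * ∏ j ∈ e.support, (C (b j) + X j) ^ e j := by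
    rw [shift, aeval_monomial]; rfl
  split_ifs with h
  · rw [heq, ← h]; exact hmon
  · rw [map_zero]; exact hmon.weaken (lt_of_le_of_ne hle h)

lemma line_step {σ F : Type*} [Field F] [Fintype F] (l : ℕ) (a b : σ → F) (P : MvPolynomial σ F)
    (hd : P.totalDegree < Fintype.card F * (l + 1))
    (hV : ∀ t : F, Van P (a + t • b) (2 * l + 1)) :
    Van (homogeneousComponent P.totalDegree P) b (l + 1) := by
  intro i hi
  obtain ⟨h1, h2⟩ := rel_line a b P i
  rw [← h2]
  by_contra hne
  have hc0 : coeff i (aeval (fun j => C (Polynomial.C (a j) + Polynomial.X * Polynomial.C (b j))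
        + C Polynomial.X * X j : σ → MvPolynomial σ (Polynomial F)) P) ≠ 0 := by
    intro h; rw [h] at hne; simp at hne
  have := card_mul_le hc0 (2 * l + 1 - i.degree) (fun c => by
    refine key_dvd (hV c) _ (fun j => C (Polynomial.C (b j)) + C Polynomial.X * X j) _
      (Polynomial.X_sub_C_ne_zero c) ?_ i
    intro j
    simp [MvPolynomial.algebraMap_eq]
    ring)
  have h3 : Fintype.card F * (l + 1) ≤ Fintype.card F * (2 * l + 1 - i.degree) :=
    Nat.mul_le_mul_left _ (by omega)
  omega

def monos (n D : ℕ) : Finset (Fin n →₀ ℕ) :=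
  (Finset.range (D + 1)).biUnion fun d => (Finset.univ : Finset (Fin n)).finsuppAntidiag d

lemma mem_monos {n D : ℕ} {e : Fin n →₀ ℕ} : e ∈ monos n D ↔ e.degree ≤ D := by
  simp [monos, Finsupp.degree_eq_sum]

lemma card_monos (k D : ℕ) : (monos (k + 1) D).card = (D + k + 1).choose (k + 1) := by
  rw [monos, Finset.card_biUnion]
  · rw [← Nat.sum_range_add_choose]
    refine Finset.sum_congr rfl fun d _ => ?_
    rw [Finset.card_finsuppAntidiag_nat_eq_choose]
    simp only [Finset.card_univ, Fintype.card_fin]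
    rw [show k + 1 + d - 1 = d + k by omega, Nat.choose_symm_add]
  · intro x _ y _ hxy
    rw [Function.onFun, Finset.disjoint_left]
    intro e he he'
    simp at he he'
    omega

lemma exists_poly {F : Type*} [Field F] (n D m : ℕ) (K : Finset (Fin n → F))
    (h : K.card * (monos n m).card < (monos n D).card) :
    ∃ P : MvPolynomial (Fin n) F, P ≠ 0 ∧ P.totalDegree ≤ D ∧ ∀ a ∈ K, Van P a (m + 1) := by
  let V := restrictSupport F (↑(monos n D) : Set (Fin n →₀ ℕ))
  let bas := basisRestrictSupport F (↑(monos n D) : Set (Fin n →₀ ℕ))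
  have : FiniteDimensional F V := Module.Finite.of_basis bas
  let f : V →ₗ[F] (K × monos n m → F) := LinearMap.pi fun x =>
    (lcoeff F x.2.1) ∘ₗ (shift x.1.1).toLinearMap ∘ₗ V.subtype
  have hker : LinearMap.ker f ≠ ⊥ := by
    apply LinearMap.ker_ne_bot_of_finrank_lt
    rw [Module.finrank_eq_card_basis bas]
    simpa using h
  obtain ⟨P, hP, hP0⟩ := Submodule.exists_mem_ne_zero_of_ne_bot hker
  refine ⟨P.1, by simpa using hP0, ?_, ?_⟩
  · rw [totalDegree, Finset.sup_le_iff]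
    intro e he
    exact mem_monos.1 (P.2 he)
  · intro a ha i hi
    have := congrFun (LinearMap.mem_ker.1 hP) (⟨a, ha⟩, ⟨i, mem_monos.2 (by omega)⟩)
    simpa [f] using this

lemma main_count {F : Type*} [Field F] [Fintype F] (n l : ℕ) (K : Finset (Fin n → F))
    (hK : ∀ b : Fin n → F, ∃ a : Fin n → F, ∀ t : F, a + t • b ∈ K) :
    (monos n (Fintype.card F * (l + 1) - 1)).card ≤ K.card * (monos n (2 * l)).card := by
  by_contra! h
  obtain ⟨P, hP0, hPd, hV⟩ := exists_poly n _ _ K h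
  have hpos : 0 < Fintype.card F * (l + 1) := Nat.mul_pos Fintype.card_pos (by omega)
  have hQ0 : homogeneousComponent P.totalDegree P ≠ 0 := by
    obtain ⟨e, he, hed⟩ := Finset.exists_mem_eq_sup P.support (support_nonempty.2 hP0)
      (fun s => s.sum fun _ e => e)
    intro h0
    have := congrArg (coeff e) h0
    have hed' : e.degree = P.totalDegree := hed.symm
    rw [coeff_homogeneousComponent, if_pos hed', coeff_zero] at this
    exact mem_support_iff.1 he this
  have h1 := sz n (l + 1) _ hQ0 (fun b => by
    obtain ⟨a, ha⟩ := hK b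
    exact line_step l a b P (by omega) (fun t => hV _ (ha t)))
  have h2 := (homogeneousComponent_isHomogeneous P.totalDegree P).totalDegree_le
  rw [mul_comm] at h1
  omega

end KakeyaAux

/-- Dvir–Kopparty–Saraf–Sudan lower bound for Kakeya sets over finite fields:
any Kakeya set `K ⊆ 𝔽ⁿ` has size at least `(q/2)ⁿ`. -/
theorem kakeya_lower_bound {F : Type*} [Field F] [Fintype F] (q : ℕ)
    (hq : Fintype.card F = q) (n : ℕ) (hn : 1 ≤ n) (K : Finset (Fin n → F))
    (hK : ∀ b : Fin n → F, ∃ a : Fin n → F, ∀ t : F, a + t • b ∈ K) :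
    ((q : ℝ) / 2) ^ n ≤ (K.card : ℝ) := by
  obtain ⟨k, rfl⟩ : ∃ k, n = k + 1 := ⟨n - 1, by omega⟩
  have hq0 : 0 < q := hq ▸ Fintype.card_pos
  have hb : ∀ l : ℕ, ((q : ℝ) * (l + 1)) ^ (k + 1) ≤ K.card * (2 * (l : ℝ) + k + 1) ^ (k + 1) := by
    intro l
    have h := KakeyaAux.main_count (k + 1) l K hK
    rw [KakeyaAux.card_monos, KakeyaAux.card_monos, hq] at h
    have hpos : 0 < q * (l + 1) := Nat.mul_pos hq0 (by omega)
    have h1 := Nat.pow_le_choose (α := ℝ) (k + 1) (q * (l + 1) - 1 + k + 1)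
    have h2 := Nat.choose_le_pow_div (α := ℝ) (k + 1) (2 * l + k + 1)
    rw [show q * (l + 1) - 1 + k + 1 + 1 - (k + 1) = q * (l + 1) by omega] at h1
    have h' : (((q * (l + 1) - 1 + k + 1).choose (k + 1) : ℕ) : ℝ) ≤
      K.card * ((2 * l + k + 1).choose (k + 1) : ℕ) := by exact_mod_cast h
    have h3 := h1.trans (h'.trans (mul_le_mul_of_nonneg_left h2 (Nat.cast_nonneg _)))
    have hf : (0 : ℝ) < (k + 1).factorial := by exact_mod_cast Nat.factorial_pos _
    rw [← mul_div_assoc, div_le_div_iff_of_pos_right hf] at h3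
    push_cast at h3
    exact h3
  have hb' : ∀ l : ℕ, ((q : ℝ) * ((l + 1) / (2 * (l : ℝ) + k + 1))) ^ (k + 1) ≤ K.card := by
    intro l
    rw [← mul_div_assoc, div_pow, div_le_iff₀ (by positivity)]
    exact hb l
  have hlim : Filter.Tendsto (fun l : ℕ => ((l : ℝ) + 1) / (2 * (l : ℝ) + k + 1)) Filter.atTop
      (nhds (1 / 2)) := by
    have h := tendsto_add_mul_div_add_mul_atTop_nhds (𝕜 := ℝ) 1 (k + 1) 1 (d := 2) two_ne_zero
    refine h.congr fun l => ?_
    congr 1 <;> ring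
  have := le_of_tendsto' ((hlim.const_mul (q : ℝ)).pow (k + 1)) hb'
  simpa [div_eq_mul_inv] using this
end

section
/- For every ε > 0 there exists a positive integer k = k(ε) such that the following holds: for every n and every n×n complex matrix A with all diagonal entries equal to zero and spectral norm at most 1, there is a partition of {1, 2, …, n} into k subsets S₁, S₂, …, S_k such that for each i, the principal submatrix A_i of A obtained by restricting rows and columns to S_i has spectral norm at most ε. -/
/-- The spectral norm (ℓ² operator norm) of a square complex matrix. -/
noncomputable def specNorm {m : Type*} [Fintype m] [DecidableEq m]
    (A : Matrix m m ℂ) : ℝ :=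
  ‖Matrix.toEuclideanCLM (𝕜 := ℂ) A‖

section
open Polynomial ComplexConjugate

namespace KS
set_option linter.unusedSectionVars false
variable {ι K : Type*} [DecidableEq ι] [Fintype K] [DecidableEq K]

structure Good (d : Finset ι → (ι → ℂ) → ℂ) : Prop where
  aff : ∀ V i z τ, i ∉ V → d (insert i V) (z + Pi.single i τ) = d (insert i V) z + τ * d V z
  indep : ∀ V i z τ, i ∉ V → d V (z + Pi.single i τ) = d V z
  stab : ∀ V z, (∀ i, 0 < (z i).im) → d V z ≠ 0
  conjg : ∀ V z, d V (fun i => conj (z i)) = conj (d V z)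
  cont : ∀ V, Continuous (d V)

noncomputable def q (d : Finset ι → (ι → ℂ) → ℂ) : List ι → (K → Finset ι) → (K → ι → ℂ) → ℂ
  | [], V, z => ∏ j, d (V j) (z j)
  | i :: S, V, z => ∑ l, q d S (Function.update V l (insert i (V l))) z

def sh (i : ι) (σ : K → ℂ) : K → ι → ℂ := fun j => Pi.single i (σ j)

variable {d : Finset ι → (ι → ℂ) → ℂ}

lemma upd_swap (i m : ι) (V : K → Finset ι) (l l' : K) :
    Function.update (Function.update V l' (insert m (V l'))) l
      (insert i (Function.update V l' (insert m (V l')) l)) =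
    Function.update (Function.update V l (insert i (V l))) l'
      (insert m (Function.update V l (insert i (V l)) l')) := by
  by_cases h : l = l'
  · subst h
    simp [Finset.insert_comm]
  · rw [Function.update_of_ne h, Function.update_of_ne (Ne.symm h), Function.update_comm h]

lemma q_swap (i m : ι) (S : List ι) (V : K → Finset ι) (z : K → ι → ℂ) :
    q d (i :: m :: S) V z = q d (m :: i :: S) V z := by
  simp only [q]
  rw [Finset.sum_comm]
  refine Finset.sum_congr rfl fun l _ => Finset.sum_congr rfl fun l' _ => ?_
  rw [upd_swap]

lemma q_cont (hd : Good d) (S : List ι) (V : K → Finset ι) : Continuous (q d S V) := by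
  induction S generalizing V with
  | nil =>
    show Continuous (fun z : K → ι → ℂ => ∏ j, d (V j) (z j))
    exact continuous_finsetProd _ fun j _ => (hd.cont _).comp (continuous_apply j)
  | cons i S ih =>
    show Continuous (fun z : K → ι → ℂ => ∑ l, q d S (Function.update V l (insert i (V l))) z)
    exact continuous_finsetSum _ fun j _ => ih _

lemma q_conj (hd : Good d) (S : List ι) (V : K → Finset ι) (z : K → ι → ℂ) :
    q d S V (fun j i => conj (z j i)) = conj (q d S V z) := by
  induction S generalizing V with
  | nil => simp [q, hd.conjg]
  | cons i S ih => simp [q, ih]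

lemma not_mem_upd {i m : ι} (him : i ≠ m) {V : K → Finset ι} (hV : ∀ j, i ∉ V j) (l : K) :
    ∀ j, i ∉ Function.update V l (insert m (V l)) j := by
  intro j
  by_cases h : j = l
  · subst h; simp [him, hV]
  · rw [Function.update_of_ne h]; exact hV j

lemma q_indep (hd : Good d) (S : List ι) (V : K → Finset ι) (z : K → ι → ℂ) (i : ι) (σ : K → ℂ)
    (hi : i ∉ S) (hV : ∀ j, i ∉ V j) : q d S V (z + sh i σ) = q d S V z := by
  induction S generalizing V with
  | nil => simp [q, sh, hd.indep _ _ _ _ (hV _)]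
  | cons m S ih =>
    simp only [List.mem_cons, not_or] at hi
    simp only [q]
    exact Finset.sum_congr rfl fun l _ => ih _ hi.2 (not_mem_upd hi.1 hV l)

lemma q_aff (hd : Good d) (S : List ι) (V : K → Finset ι) (z : K → ι → ℂ) (i : ι) (σ : K → ℂ)
    (hi : i ∉ S) (hV : ∀ j, i ∉ V j) (l : K) :
    q d S (Function.update V l (insert i (V l))) (z + sh i σ) =
      q d S (Function.update V l (insert i (V l))) z + σ l * q d S V z := by
  induction S generalizing V with
  | nil =>
    simp only [q, sh, Pi.add_apply]
    rw [← Finset.mul_prod_erase _ _ (Finset.mem_univ l),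
      ← Finset.mul_prod_erase Finset.univ (fun j => d (Function.update V l (insert i (V l)) j) (z j))
        (Finset.mem_univ l),
      ← Finset.mul_prod_erase Finset.univ (fun j => d (V j) (z j)) (Finset.mem_univ l)]
    have h1 : ∀ x ∈ Finset.univ.erase l, d (Function.update V l (insert i (V l)) x)
        (z x + Pi.single i (σ x)) = d (V x) (z x) := by
      intro x hx
      rw [Function.update_of_ne (Finset.ne_of_mem_erase hx), hd.indep _ _ _ _ (hV _)]
    have h2 : ∀ x ∈ Finset.univ.erase l, d (Function.update V l (insert i (V l)) x)
        (z x) = d (V x) (z x) := by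
      intro x hx
      rw [Function.update_of_ne (Finset.ne_of_mem_erase hx)]
    rw [Finset.prod_congr rfl h1, Finset.prod_congr rfl h2]
    simp only [Function.update_self]
    rw [hd.aff _ _ _ _ (hV _)]
    ring
  | cons m S ih =>
    simp only [List.mem_cons, not_or] at hi
    simp only [q]
    rw [Finset.mul_sum, ← Finset.sum_add_distrib]
    refine Finset.sum_congr rfl fun l' _ => ?_
    have := ih (Function.update V l' (insert m (V l'))) hi.2 (not_mem_upd hi.1 hV l')
    rw [upd_swap] at this
    exact this

lemma q_aff_all (hd : Good d) (S : List ι) (V : K → Finset ι) (z : K → ι → ℂ) (i : ι) (τ : ℂ)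
    (hi : i ∉ S) (hV : ∀ j, i ∉ V j) :
    q d (i :: S) V (z + sh i (fun _ => τ)) =
      q d (i :: S) V z + Fintype.card K * τ * q d S V z := by
  simp only [q]
  rw [Finset.sum_congr rfl fun l _ => q_aff hd S V z i _ hi hV l, Finset.sum_add_distrib]
  simp
  ring

lemma prod_lin (s : Finset K) (a b : K → ℂ) :
    (∏ j ∈ s, (C (b j) + C (a j) * X)).natDegree ≤ s.card ∧
    (∏ j ∈ s, (C (b j) + C (a j) * X)).coeff s.card = ∏ j ∈ s, a j ∧
    (∀ m, s.card = m + 1 → (∏ j ∈ s, (C (b j) + C (a j) * X)).coeff m =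
      ∑ l ∈ s, b l * ∏ j ∈ s.erase l, a j) := by
  induction s using Finset.induction_on with
  | empty => simp
  | insert x s hx ih =>
    obtain ⟨h1, h2, h3⟩ := ih
    rw [Finset.prod_insert hx, Finset.card_insert_of_notMem hx]
    set P := ∏ j ∈ s, (C (b j) + C (a j) * X) with hP
    have hz : P.coeff (s.card + 1) = 0 := coeff_eq_zero_of_natDegree_lt (by omega)
    refine ⟨?_, ?_, ?_⟩
    · refine natDegree_mul_le.trans ?_
      have : (C (b x) + C (a x) * X).natDegree ≤ 1 := by
        rw [add_comm]; exact natDegree_linear_le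
      omega
    · rw [Finset.prod_insert hx, add_mul, coeff_add, coeff_C_mul, mul_assoc, coeff_C_mul,
        coeff_X_mul, hz, h2]
      simp
    · intro m hm
      have hm' : s.card = m := by omega
      rw [Finset.sum_insert hx, Finset.erase_insert hx, add_mul, coeff_add, coeff_C_mul, mul_assoc,
        coeff_C_mul, ← hm', h2]
      congr 1
      rcases Nat.eq_zero_or_pos s.card with h0 | h0
      · rw [h0]
        rw [Finset.card_eq_zero] at h0
        simp [h0]
      · obtain ⟨m', hm2⟩ : ∃ m', s.card = m' + 1 := ⟨s.card - 1, by omega⟩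
        rw [hm2, coeff_X_mul, h3 m' hm2, Finset.mul_sum]
        refine Finset.sum_congr rfl fun l hl => ?_
        have hlx : l ≠ x := fun h => hx (h ▸ hl)
        rw [Finset.erase_insert_of_ne hlx.symm, Finset.prod_insert (fun h => hx (Finset.mem_of_mem_erase h))]
        ring

lemma q_poly (hd : Good d) {k : ℕ} (hk : Fintype.card K = k + 1)
    (S : List ι) (V : K → Finset ι) (z : K → ι → ℂ) (i : ι)
    (hi : i ∉ S) (hV : ∀ j, i ∉ V j) :
    ∃ P : ℂ[X], P.natDegree ≤ k + 1 ∧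
      (∀ τ, P.eval τ = q d S (fun j => insert i (V j)) (z + sh i (fun _ => τ))) ∧
      P.coeff (k + 1) = q d S V z ∧ P.coeff k = q d (i :: S) V z := by
  induction S generalizing V with
  | nil =>
    obtain ⟨h1, h2, h3⟩ := prod_lin Finset.univ (fun j : K => d (V j) (z j))
      (fun j => d (insert i (V j)) (z j))
    rw [Finset.card_univ, hk] at h1 h2
    refine ⟨_, h1, ?_, h2.trans rfl, ?_⟩
    · intro τ
      simp only [eval_prod, q, sh, Pi.add_apply]
      refine Finset.prod_congr rfl fun j _ => ?_
      rw [hd.aff _ _ _ _ (hV j)]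
      simp only [eval_add, eval_mul, eval_C, eval_X]
      ring
    · rw [h3 k (by rw [Finset.card_univ, hk])]
      simp only [q]
      refine Finset.sum_congr rfl fun l _ => ?_
      rw [← Finset.mul_prod_erase _ _ (Finset.mem_univ l)]
      simp only [Function.update_self]
      congr 1
      refine Finset.prod_congr rfl fun x hx => ?_
      rw [Function.update_of_ne (Finset.ne_of_mem_erase hx)]
  | cons m S ih =>
    simp only [List.mem_cons, not_or] at hi
    choose P h1 h2 h3 h4 using fun l => ih (Function.update V l (insert m (V l))) hi.2
      (not_mem_upd hi.1 hV l)
    refine ⟨∑ l, P l, ?_, ?_, ?_, ?_⟩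
    · exact natDegree_sum_le_of_forall_le _ _ fun l _ => h1 l
    · intro τ
      simp only [eval_finsetSum, q]
      refine Finset.sum_congr rfl fun l _ => ?_
      rw [h2]
      congr 1
      funext j
      by_cases h : j = l
      · subst h; simp [Finset.insert_comm]
      · simp [Function.update_of_ne h]
    · simp [q, h3]
    · rw [q_swap, q]
      simp [h4]

end KS
end

section
open Polynomial ComplexConjugate

namespace KS
set_option linter.unusedSectionVars false
variable {ι K : Type*} [DecidableEq ι] [Fintype K] [DecidableEq K]
variable {d : Finset ι → (ι → ℂ) → ℂ}

lemma poly_norm_mono (P : ℂ[X]) (h : ∀ τ : ℂ, 0 ≤ τ.im → P.eval τ ≠ 0) (η : ℝ) (hη : 0 ≤ η) :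
    ‖P.eval 0‖ ≤ ‖P.eval (Complex.I * η)‖ := by
  have hs := IsAlgClosed.splits P
  rw [hs.eval_eq_prod_roots, hs.eval_eq_prod_roots, norm_mul, norm_mul]
  refine mul_le_mul_of_nonneg_left ?_ (norm_nonneg _)
  have hr : ∀ r ∈ P.roots, r.im ≤ 0 := by
    intro r hr
    by_contra hc
    exact h r (not_le.mp hc).le (isRoot_of_mem_roots hr)
  generalize P.roots = M at hr
  induction M using Multiset.induction_on with
  | empty => simp
  | cons a M ih =>
    simp only [Multiset.map_cons, Multiset.prod_cons, norm_mul]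
    refine mul_le_mul ?_ (ih fun r hr' => hr r (Multiset.mem_cons_of_mem hr')) (norm_nonneg _) (norm_nonneg _)
    have ha := hr a (Multiset.mem_cons_self a M)
    rw [← sq_le_sq₀ (norm_nonneg _) (norm_nonneg _), ← Complex.normSq_eq_norm_sq,
      ← Complex.normSq_eq_norm_sq, Complex.normSq_apply, Complex.normSq_apply]
    simp
    nlinarith

lemma poly_next_ne (P : ℂ[X]) (k : ℕ) (hk : P.natDegree ≤ k + 1) (hc : P.coeff (k + 1) ≠ 0)
    (h : ∀ τ : ℂ, 0 ≤ τ.im → P.eval τ ≠ 0) : P.coeff k ≠ 0 := by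
  have hs := IsAlgClosed.splits P
  have hdeg : P.natDegree = k + 1 := le_antisymm hk (le_natDegree_of_ne_zero hc)
  have h1 := hs.nextCoeff_eq_neg_sum_roots_mul_leadingCoeff
  rw [nextCoeff_of_natDegree_pos (by omega), hdeg, Nat.add_sub_cancel] at h1
  rw [h1, leadingCoeff, hdeg]
  have hr : ∀ r ∈ P.roots, r.im < 0 := by
    intro r hr
    by_contra hc
    exact h r (not_lt.mp hc) (isRoot_of_mem_roots hr)
  have hcard : 0 < P.roots.card := by rw [← hs.natDegree_eq_card_roots, hdeg]; omega
  have : P.roots.sum.im < 0 := by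
    generalize P.roots = M at hr hcard
    have hle : ∀ M : Multiset ℂ, (∀ r ∈ M, r.im < 0) → M.sum.im ≤ 0 := by
      intro M
      induction M using Multiset.induction_on with
      | empty => simp
      | cons a M ih =>
        intro h
        simp only [Multiset.sum_cons, Complex.add_im]
        have := ih fun r hr' => h r (Multiset.mem_cons_of_mem hr')
        have := h a (Multiset.mem_cons_self a M)
        linarith
    obtain ⟨a, ha⟩ := Multiset.card_pos_iff_exists_mem.mp hcard
    obtain ⟨M', rfl⟩ := Multiset.exists_cons_of_mem ha
    simp only [Multiset.sum_cons, Complex.add_im]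
    have := hle M' fun r hr' => hr r (Multiset.mem_cons_of_mem hr')
    have := hr a (Multiset.mem_cons_self a M')
    linarith
  have hne : P.roots.sum ≠ 0 := by
    intro h0; rw [h0] at this; simp at this
  simp [hc, hne]

lemma sh_im (i : ι) (τ : ℂ) (hτ : 0 ≤ τ.im) (z : K → ι → ℂ) (hz : ∀ j a, 0 < (z j a).im) :
    ∀ j a, 0 < ((z + sh i (fun _ => τ) : K → ι → ℂ) j a).im := by
  intro j a
  simp only [sh, Pi.add_apply, Complex.add_im]
  by_cases h : a = i
  · subst h; simp; have := hz j a; linarith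
  · simp [Pi.single_eq_of_ne h, hz]

lemma q_stab (hd : Good d) {k : ℕ} (hk : Fintype.card K = k + 1) (S : List ι) (hS : S.Nodup)
    (V : K → Finset ι) (hV : ∀ i ∈ S, ∀ j, i ∉ V j)
    (z : K → ι → ℂ) (hz : ∀ j a, 0 < (z j a).im) : q d S V z ≠ 0 := by
  induction S generalizing V z with
  | nil =>
    simp only [q]
    exact Finset.prod_ne_zero_iff.mpr fun j _ => hd.stab _ _ (hz j)
  | cons i S ih =>
    rw [List.nodup_cons] at hS
    have hiV := hV i List.mem_cons_self
    obtain ⟨P, h1, h2, h3, h4⟩ := q_poly hd hk S V z i hS.1 hiV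
    rw [← h4]
    refine poly_next_ne P k h1 ?_ ?_
    · rw [h3]
      exact ih hS.2 V (fun a ha => hV a (List.mem_cons_of_mem _ ha)) z hz
    · intro τ hτ
      rw [h2]
      refine ih hS.2 _ ?_ _ (sh_im i τ hτ z hz)
      intro a ha j
      have : a ≠ i := fun h => hS.1 (h ▸ ha)
      simp [this, hV a (List.mem_cons_of_mem _ ha) j]

lemma q_norm_mono (hd : Good d) {k : ℕ} (hk : Fintype.card K = k + 1) (S : List ι) (hS : S.Nodup)
    (V : K → Finset ι) (hV : ∀ i ∈ S, ∀ j, i ∉ V j) (i : ι) (hi : i ∉ S) (hiV : ∀ j, i ∉ V j)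
    (z : K → ι → ℂ) (hz : ∀ j a, 0 ≤ (z j a).im) (η : ℝ) (hη : 0 ≤ η) :
    ‖q d S (fun j => insert i (V j)) z‖ ≤
      ‖q d S (fun j => insert i (V j)) (z + sh i (fun _ => Complex.I * η))‖ := by
  have key : ∀ z : K → ι → ℂ, (∀ j a, 0 < (z j a).im) → ‖q d S (fun j => insert i (V j)) z‖ ≤
      ‖q d S (fun j => insert i (V j)) (z + sh i (fun _ => Complex.I * η))‖ := by
    intro z hz
    obtain ⟨P, h1, h2, h3, h4⟩ := q_poly hd hk S V z i hi hiV
    have h0 := h2 0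
    have : sh i (fun _ : K => (0 : ℂ)) = 0 := by
      funext j a; simp [sh]
    rw [this, add_zero] at h0
    rw [← h0, ← h2]
    refine poly_norm_mono P ?_ η hη
    intro τ hτ
    rw [h2]
    refine q_stab hd hk S hS _ ?_ _ (sh_im i τ hτ z hz)
    intro a ha j
    have : a ≠ i := fun h => hi (h ▸ ha)
    simp [this, hV a ha j]
  have hc := q_cont hd S (fun j => insert i (V j))
  let w : ℝ → K → ι → ℂ := fun t => z + fun _ _ => Complex.I * t
  have hw : Continuous w := by
    refine continuous_pi fun j => continuous_pi fun a => ?_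
    simp only [w, Pi.add_apply]
    fun_prop
  have hw0 : w 0 = z := by funext j a; simp [w]
  have h1 : Filter.Tendsto (fun t => ‖q d S (fun j => insert i (V j)) (w t)‖)
      (nhdsWithin 0 (Set.Ioi 0)) (nhds ‖q d S (fun j => insert i (V j)) z‖) := by
    have := (hc.comp hw).norm.tendsto 0
    simp only [Function.comp_apply, hw0] at this
    exact this.mono_left nhdsWithin_le_nhds
  have h2 : Filter.Tendsto (fun t => ‖q d S (fun j => insert i (V j))
        (w t + sh i (fun _ => Complex.I * η))‖)
      (nhdsWithin 0 (Set.Ioi 0)) (nhds ‖q d S (fun j => insert i (V j))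
        (z + sh i (fun _ => Complex.I * η))‖) := by
    have hw2 : Continuous (fun t => w t + sh i (fun _ => Complex.I * η)) := hw.add continuous_const
    have := (hc.comp hw2).norm.tendsto 0
    simp only [Function.comp_apply, hw0] at this
    exact this.mono_left nhdsWithin_le_nhds
  refine le_of_tendsto_of_tendsto h1 h2 ?_
  filter_upwards [self_mem_nhdsWithin] with t ht
  refine key _ fun j a => ?_
  simp only [w, Pi.add_apply]
  have := hz j a
  have ht' : 0 < t := ht
  simp
  linarith

noncomputable def Dq (d : Finset ι → (ι → ℂ) → ℂ) (S : List ι) (j : ι) (V : K → Finset ι)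
    (z : K → ι → ℂ) : ℂ :=
  ∑ l, q d S (Function.update (fun m => insert j (V m)) l (V l)) z

lemma q_hasDeriv0 (hd : Good d) (S : List ι) (V : K → Finset ι) (z : K → ι → ℂ) (i : ι)
    (hi : i ∉ S) (hV : ∀ j, i ∉ V j) :
    HasDerivAt (fun t : ℂ => q d S (fun m => insert i (V m)) (z + sh i (fun _ => t)))
      (Dq d S i V z) 0 := by
  induction S generalizing V with
  | nil =>
    simp only [q, sh, Pi.add_apply, Dq]
    simp_rw [hd.aff _ _ _ _ (hV _)]
    have := HasDerivAt.fun_finsetProd (u := Finset.univ) (x := (0 : ℂ))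
      (f := fun (j : K) (t : ℂ) => d (insert i (V j)) (z j) + t * d (V j) (z j))
      (f' := fun j => d (V j) (z j)) (fun j _ => by
        have := ((hasDerivAt_id (0 : ℂ)).mul_const (d (V j) (z j))).const_add (d (insert i (V j)) (z j))
        rw [one_mul] at this
        exact this)
    refine this.congr_deriv ?_
    refine Finset.sum_congr rfl fun l _ => ?_
    symm
    rw [← Finset.prod_erase_mul _ _ (Finset.mem_univ l)]
    simp only [Function.update_self, smul_eq_mul, zero_mul, add_zero]
    congr 1
    refine Finset.prod_congr rfl fun x hx => ?_
    rw [Function.update_of_ne (Finset.ne_of_mem_erase hx)]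
  | cons m S ih =>
    simp only [List.mem_cons, not_or] at hi
    have := HasDerivAt.fun_sum (u := Finset.univ) fun (l : K) _ =>
      ih (Function.update V l (insert m (V l))) hi.2 (not_mem_upd hi.1 hV l)
    have e1 : ∀ l : K, (fun m_1 => insert i (Function.update V l (insert m (V l)) m_1)) =
        Function.update (fun m => insert i (V m)) l (insert m (insert i (V l))) := by
      intro l
      funext x
      by_cases h : x = l
      · subst h; simp [Finset.insert_comm]
      · simp [Function.update_of_ne h]
    simp only [e1] at this
    simp only [q]
    refine this.congr_deriv ?_
    simp only [Dq, q, e1]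
    rw [Finset.sum_comm]
    refine Finset.sum_congr rfl fun l _ => Finset.sum_congr rfl fun l' _ => ?_
    congr 1
    by_cases h : l' = l
    · subst h; simp
    · rw [Function.update_of_ne (Ne.symm h), Function.update_of_ne h, Function.update_comm h]

lemma sh_add (i : ι) (s t : ℂ) : sh i (fun _ : K => s + t) = sh i (fun _ => s) + sh i (fun _ => t) := by
  funext j a
  simp [sh, Pi.single_add]

lemma q_hasDeriv (hd : Good d) (S : List ι) (V : K → Finset ι) (z : K → ι → ℂ) (i : ι)
    (hi : i ∉ S) (hV : ∀ j, i ∉ V j) (t : ℂ) :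
    HasDerivAt (fun t : ℂ => q d S (fun m => insert i (V m)) (z + sh i (fun _ => t)))
      (Dq d S i V (z + sh i (fun _ => t))) t := by
  have h := q_hasDeriv0 hd S V (z + sh i (fun _ => t)) i hi hV
  have h2 : HasDerivAt (fun s : ℂ => s - t) 1 t := by simpa using (hasDerivAt_id t).sub_const t
  have h0 : (0 : ℂ) = (fun s : ℂ => s - t) t := by simp
  rw [h0] at h
  have := HasDerivAt.comp (h := fun s : ℂ => s - t) t h h2
  rw [mul_one] at this
  refine this.congr_of_eventuallyEq (Filter.Eventually.of_forall fun s => ?_)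
  simp only [Function.comp_apply]
  rw [add_assoc, ← sh_add]
  congr 2
  ring_nf

lemma deriv_nonneg_right {g : ℝ → ℝ} {g' x : ℝ} (h : HasDerivAt g g' x)
    (hg : ∀ y, x < y → g x ≤ g y) : 0 ≤ g' := by
  have h1 := (hasDerivAt_iff_tendsto_slope.mp h).mono_left
    (nhdsWithin_mono x (show Set.Ioi x ⊆ {x}ᶜ from fun y hy => ne_of_gt hy))
  refine ge_of_tendsto h1 ?_
  filter_upwards [self_mem_nhdsWithin] with y hy
  rw [slope_def_field]
  exact div_nonneg (sub_nonneg.mpr (hg y hy)) (sub_nonneg.mpr (le_of_lt hy))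

lemma im_le_of_norm {T : ℂ → ℂ} {T' : ℂ} (h : HasDerivAt T T' 0)
    (hn : ∀ η : ℝ, 0 ≤ η → ‖T 0‖ ≤ ‖T (Complex.I * η)‖) : (T' * conj (T 0)).im ≤ 0 := by
  have h1 : HasDerivAt (fun η : ℝ => T (Complex.I * η)) (T' * Complex.I) 0 := by
    have h2 : HasDerivAt (fun s : ℂ => Complex.I * s) Complex.I ((0 : ℝ) : ℂ) := by
      simpa using (hasDerivAt_id ((0 : ℝ) : ℂ)).const_mul Complex.I
    have h3 : HasDerivAt T T' ((fun s : ℂ => Complex.I * s) ((0 : ℝ) : ℂ)) := by simpa using h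
    exact (HasDerivAt.comp _ h3 h2).comp_ofReal
  have h4 := h1.norm_sq
  have h5 := deriv_nonneg_right h4 (fun y hy => by
    have := hn y hy.le
    simp only [Complex.ofReal_zero, mul_zero]
    gcongr)
  simp only [Complex.ofReal_zero, mul_zero, Complex.inner] at h5
  simp at h5 ⊢
  linarith

lemma Dq_im (hd : Good d) {k : ℕ} (hk : Fintype.card K = k + 1) (S : List ι) (hS : S.Nodup)
    (V : K → Finset ι) (hV : ∀ i ∈ S, ∀ j, i ∉ V j) (i : ι) (hi : i ∉ S) (hiV : ∀ j, i ∉ V j)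
    (z : K → ι → ℂ) (hz : ∀ j a, 0 ≤ (z j a).im) :
    (Dq d S i V z * conj (q d S (fun j => insert i (V j)) z)).im ≤ 0 := by
  have h0 : sh i (fun _ : K => (0 : ℂ)) = 0 := by
    funext j a; simp [sh]
  have := im_le_of_norm (q_hasDeriv0 hd S V z i hi hiV) (fun η hη => by
    simp only [h0, add_zero]
    exact q_norm_mono hd hk S hS V hV i hi hiV z hz η hη)
  simpa only [h0, add_zero] using this

end KS
end

section
open Polynomial ComplexConjugate

namespace KS

lemma local_root (r : ℝ) (m : ℕ) (N Q : ℂ → ℂ) (hN : Continuous N) (hQ : Continuous Q)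
    (n₀ q₀ : ℝ) (hn : N r = n₀) (hq : Q r = q₀)
    (H : ∀ τ : ℂ, 0 < τ.im → (N τ * conj ((τ - r) ^ m * Q τ)).im ≤ 0) (θ : ℝ)
    (h0 : 0 < θ) (hπ : θ < Real.pi) : 0 ≤ Real.sin (m * θ) * (n₀ * q₀) := by
  let τ : ℝ → ℂ := fun η => r + η * Complex.exp (θ * Complex.I)
  have hτ : Continuous τ := by simp only [τ]; fun_prop
  let φ : ℝ → ℂ := fun η => N (τ η) * conj (Complex.exp (m * (θ * Complex.I)) * Q (τ η))
  have hφ : Continuous φ := by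
    simp only [φ]
    exact (hN.comp hτ).mul (Complex.continuous_conj.comp (continuous_const.mul (hQ.comp hτ)))
  have h1 : Filter.Tendsto (fun η => (φ η).im) (nhdsWithin 0 (Set.Ioi 0)) (nhds (φ 0).im) :=
    ((Complex.continuous_im.comp hφ).tendsto 0).mono_left nhdsWithin_le_nhds
  have h2 : (φ 0).im ≤ 0 := by
    refine le_of_tendsto h1 ?_
    filter_upwards [self_mem_nhdsWithin] with η hη
    have hη' : 0 < η := hη
    have him : 0 < (τ η).im := by
      simp only [τ, Complex.exp_mul_I]
      simp
      rw [← Complex.ofReal_sin, Complex.ofReal_re]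
      exact mul_pos hη' (Real.sin_pos_of_pos_of_lt_pi h0 hπ)
    have h3 := H _ him
    have h4 : N (τ η) * conj ((τ η - r) ^ m * Q (τ η)) = ((η ^ m : ℝ) : ℂ) * φ η := by
      simp only [φ]
      have : τ η - r = η * Complex.exp (θ * Complex.I) := by simp [τ]
      rw [this, mul_pow, ← Complex.exp_nat_mul]
      simp
      ring
    rw [h4, Complex.im_ofReal_mul] at h3
    have := pow_pos hη' m
    nlinarith
  have h5 : φ 0 = n₀ * q₀ * conj (Complex.exp (m * (θ * Complex.I))) := by
    have : τ 0 = r := by simp [τ]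
    simp only [φ, this, hn, hq]
    simp
    ring
  rw [h5] at h2
  have h6 : Complex.exp (m * (θ * Complex.I)) =
      ((Real.cos (m * θ) : ℝ) : ℂ) + ((Real.sin (m * θ) : ℝ) : ℂ) * Complex.I := by
    rw [← mul_assoc, Complex.exp_mul_I]; push_cast; rfl
  rw [h6] at h2
  simp only [map_add, map_mul, Complex.conj_ofReal, Complex.conj_I] at h2
  have h7 : ((n₀ : ℂ) * q₀ * (((Real.cos (m * θ) : ℝ) : ℂ) + ((Real.sin (m * θ) : ℝ) : ℂ) * -Complex.I)).im
      = - (Real.sin (m * θ) * (n₀ * q₀)) := by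
    rw [← Complex.ofReal_mul, Complex.im_ofReal_mul]
    rw [Complex.add_im, Complex.im_ofReal_mul]
    rw [Complex.ofReal_im]
    simp only [Complex.neg_im, Complex.I_im]
    ring
  rw [h7] at h2
  linarith

lemma evalc (N : ℝ[X]) (r : ℝ) : (N.map Complex.ofRealHom).eval (r : ℂ) = ((N.eval r : ℝ) : ℂ) := by
  have := eval_map_apply (p := N) (f := Complex.ofRealHom) r
  simpa using this

lemma multProdc (M : Multiset ℝ) (s : ℝ) :
    (M.map fun r : ℝ => ((s : ℂ) - r)).prod = (((M.map fun r => s - r).prod : ℝ) : ℂ) := by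
  induction M using Multiset.induction_on with
  | empty => simp
  | cons a M ih => simp [ih]

lemma multCont (M : Multiset ℝ) : Continuous (fun τ : ℂ => (M.map fun r : ℝ => (τ - r)).prod) := by
  induction M using Multiset.induction_on with
  | empty => simp; exact continuous_const
  | cons a M ih =>
    simp only [Multiset.map_cons, Multiset.prod_cons]
    exact (continuous_id.sub continuous_const).mul ih

lemma PF (n : ℕ) (M : Multiset ℝ) (hn : M.card = n) (N : ℝ[X]) (hN : N.degree < n)
    (H : ∀ τ : ℂ, 0 < τ.im →
      ((N.map Complex.ofRealHom).eval τ * conj ((M.map fun r : ℝ => (τ - r)).prod)).im ≤ 0) :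
    0 ≤ N.coeff (n - 1) ∧ ∀ s a : ℝ, (∀ r ∈ M, r < s) → (∀ r ∈ M, a ≤ r) →
      0 ≤ N.eval s ∧ N.coeff (n - 1) * (M.map fun r => s - r).prod ≤ N.eval s * (s - a) := by
  induction n generalizing M N with
  | zero =>
    have : N = 0 := by
      rw [← degree_eq_bot]
      simpa using hN
    subst this
    simp
  | succ n ih =>
    by_cases hnd : M.Nodup
    · obtain ⟨s, rfl⟩ : ∃ s : Finset ℝ, s.val = M := ⟨⟨M, hnd⟩, rfl⟩
      have hcard : s.card = n + 1 := hn
      have hinj : Set.InjOn (fun x : ℝ => x) (s : Set ℝ) := fun _ _ _ _ h => h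
      have hdeg : N.degree < s.card := by rw [hcard]; exact hN
      have hw : ∀ r ∈ s, 0 ≤ Lagrange.nodalWeight s (fun x : ℝ => x) r * N.eval r := by
        intro r hr
        have := local_root r 1 (fun τ => (N.map Complex.ofRealHom).eval τ)
          (fun τ => ((s.erase r).val.map fun r : ℝ => (τ - r)).prod)
          (Polynomial.continuous _) (multCont _) (N.eval r) _ (evalc N r) (multProdc _ r)
          (fun τ hτ => by
            have h := H τ hτ
            rw [← Finset.insert_erase hr, Finset.insert_val_of_notMem (Finset.notMem_erase r s),
              Multiset.map_cons, Multiset.prod_cons] at h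
            simpa using h) (Real.pi / 2) (by positivity) (by linarith [Real.pi_pos])
        simp only [Nat.cast_one, one_mul, Real.sin_pi_div_two] at this
        have h2 : Lagrange.nodalWeight s (fun x : ℝ => x) r =
            (((s.erase r).val.map fun x : ℝ => (r - x)).prod)⁻¹ := by
          rw [Lagrange.nodalWeight, Finset.prod_inv_distrib]; rfl
        rw [h2]
        set y := ((s.erase r).val.map fun x : ℝ => (r - x)).prod
        rcases eq_or_ne y 0 with h0 | h0
        · simp [h0]
        · have : y⁻¹ * N.eval r = (N.eval r * y) * (y⁻¹)^2 := by field_simp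
          rw [this]; positivity
      have hco : N.coeff (n + 1 - 1) = ∑ r ∈ s, Lagrange.nodalWeight s (fun x : ℝ => x) r * N.eval r := by
        have := Lagrange.coeff_eq_sum (s := s) (v := fun x : ℝ => x) hinj hdeg
        rw [hcard] at this
        rw [this]
        refine Finset.sum_congr rfl fun r _ => ?_
        rw [Lagrange.nodalWeight, Finset.prod_inv_distrib]; field_simp
      refine ⟨?_, ?_⟩
      · rw [hco]; exact Finset.sum_nonneg hw
      · intro t a ht ha
        have hev : N.eval t = (s.val.map fun r => t - r).prod *
            ∑ r ∈ s, Lagrange.nodalWeight s (fun x : ℝ => x) r * N.eval r * (t - r)⁻¹ := by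
          conv_lhs => rw [Lagrange.eq_interpolate hinj hdeg]
          rw [Lagrange.eval_interpolate_not_at_node _ (fun i hi => (ht i hi).ne'), Lagrange.eval_nodal]
          congr 1
          refine Finset.sum_congr rfl fun r _ => ?_
          ring
        have hp : 0 ≤ (s.val.map fun r => t - r).prod := by
          show 0 ≤ ∏ r ∈ s, (t - r)
          exact Finset.prod_nonneg fun r hr => by linarith [ht r hr]
        rw [hev]
        have hs : ∀ r ∈ s, 0 < t - r := fun r hr => by linarith [ht r hr]
        refine ⟨mul_nonneg hp (Finset.sum_nonneg fun r hr => mul_nonneg (hw r hr)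
          (inv_nonneg.mpr (hs r hr).le)), ?_⟩
        rw [hco, mul_comm, mul_assoc]
        refine mul_le_mul_of_nonneg_left ?_ hp
        rw [Finset.sum_mul]
        refine Finset.sum_le_sum fun r hr => ?_
        have h1 := hs r hr
        have h2 : 1 ≤ (t - r)⁻¹ * (t - a) := by
          rw [inv_mul_eq_div, le_div_iff₀ h1]; linarith [ha r hr]
        calc _ = Lagrange.nodalWeight s (fun x : ℝ => x) r * N.eval r * 1 := by ring
          _ ≤ Lagrange.nodalWeight s (fun x : ℝ => x) r * N.eval r * ((t - r)⁻¹ * (t - a)) :=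
            mul_le_mul_of_nonneg_left h2 (hw r hr)
          _ = _ := by ring
    · rw [Multiset.nodup_iff_count_le_one] at hnd
      push Not at hnd
      obtain ⟨r, hr⟩ := hnd
      -- N r = 0
      have hNr : N.eval r = 0 := by
        set m := M.count r with hm
        obtain ⟨M2, hM2⟩ := Multiset.le_iff_exists_add.mp (Multiset.le_count_iff_replicate_le.mp hm.le)
        have hr2 : r ∉ M2 := by
          intro hmem
          have := Multiset.count_pos.mpr hmem
          have h3 : M.count r = m + M2.count r := by rw [hM2]; simp
          omega
        have key := local_root r m (fun τ => (N.map Complex.ofRealHom).eval τ)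
          (fun τ => (M2.map fun r : ℝ => (τ - r)).prod)
          (Polynomial.continuous _) (multCont _) (N.eval r) _ (evalc N r) (multProdc _ r)
          (fun τ hτ => by
            have h := H τ hτ
            rw [hM2] at h
            simpa using h)
        have hm0 : (2 : ℝ) ≤ m := by exact_mod_cast hr
        have hpi := Real.pi_pos
        have k1 := key (Real.pi / 2 / m) (by positivity) (by
          rw [div_lt_iff₀ (by linarith)]; nlinarith)
        have k2 := key ((Real.pi / 2 + Real.pi) / m) (by positivity) (by
          rw [div_lt_iff₀ (by linarith)]; nlinarith)
        rw [mul_div_cancel₀ _ (by linarith), Real.sin_pi_div_two] at k1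
        rw [mul_div_cancel₀ _ (by linarith), Real.sin_add_pi, Real.sin_pi_div_two] at k2
        have h0 : N.eval r * (M2.map fun x => r - x).prod = 0 := by linarith
        rcases mul_eq_zero.mp h0 with h | h
        · exact h
        · exfalso
          rw [Multiset.prod_eq_zero_iff, Multiset.mem_map] at h
          obtain ⟨x, hx, hx0⟩ := h
          have : x = r := by linarith
          exact hr2 (this ▸ hx)
      obtain ⟨N1, rfl⟩ := dvd_iff_isRoot.mpr hNr
      have hmem : r ∈ M := Multiset.count_pos.mp (by omega)
      obtain ⟨M1, rfl⟩ := Multiset.exists_cons_of_mem hmem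
      have hr1 : r ∈ M1 := by
        rw [Multiset.count_cons_self] at hr
        exact Multiset.count_pos.mp (by omega)
      rw [Multiset.card_cons] at hn
      have hn1 : M1.card = n := by omega
      have hnpos : 0 < n := by rw [← hn1]; exact Multiset.card_pos_iff_exists_mem.mpr ⟨r, hr1⟩
      have hN1 : N1.degree < n := by
        rw [degree_mul, degree_X_sub_C, add_comm, Nat.cast_add, Nat.cast_one] at hN
        exact lt_of_add_lt_add_right hN
      have IH := ih M1 hn1 N1 hN1 (fun τ hτ => by
        have h := H τ hτ
        rw [Multiset.map_cons, Multiset.prod_cons, Polynomial.map_mul, eval_mul, map_mul] at h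
        have h0 : (N1.map Complex.ofRealHom).eval τ *
            conj ((M1.map fun r : ℝ => (τ - r)).prod) * (Complex.normSq (τ - r) : ℂ) =
            eval τ (Polynomial.map Complex.ofRealHom (X - C r)) * eval τ (Polynomial.map Complex.ofRealHom N1) *
              (conj (τ - r) * conj ((M1.map fun r : ℝ => (τ - r)).prod)) := by
          rw [← Complex.mul_conj]
          simp
          ring
        rw [← h0, Complex.im_mul_ofReal] at h
        have hpos : 0 < Complex.normSq (τ - r) := by
          rw [Complex.normSq_pos]
          intro h
          have := congrArg Complex.im h
          simp at this
          linarith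
        nlinarith)
      have hco : ((X - C r) * N1).coeff (n + 1 - 1) = N1.coeff (n - 1) := by
        obtain ⟨n', rfl⟩ : ∃ n', n = n' + 1 := ⟨n - 1, by omega⟩
        rw [sub_mul, coeff_sub, coeff_C_mul, Nat.add_sub_cancel, Nat.add_sub_cancel, coeff_X_mul,
          coeff_eq_zero_of_degree_lt hN1]
        ring
      rw [hco]
      refine ⟨IH.1, fun s a hs ha => ?_⟩
      obtain ⟨i1, i2⟩ := IH.2 s a (fun x hx => hs x (Multiset.mem_cons_of_mem hx))
        (fun x hx => ha x (Multiset.mem_cons_of_mem hx))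
      have hsr : 0 < s - r := by linarith [hs r (Multiset.mem_cons_self _ _)]
      rw [eval_mul, Multiset.map_cons, Multiset.prod_cons]
      simp only [eval_sub, eval_X, eval_C]
      refine ⟨mul_nonneg hsr.le i1, ?_⟩
      calc _ = (s - r) * (N1.coeff (n - 1) * (M1.map fun r => s - r).prod) := by ring
        _ ≤ (s - r) * (N1.eval s * (s - a)) := mul_le_mul_of_nonneg_left i2 hsr.le
        _ = _ := by ring

end KS
end

section
open Polynomial ComplexConjugate

namespace KS
set_option linter.unusedSectionVars false
variable {ι K : Type*} [DecidableEq ι] [Fintype K] [DecidableEq K]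
variable {d : Finset ι → (ι → ℂ) → ℂ}

lemma lift_real (P : ℂ[X]) (h : ∀ τ : ℝ, (P.eval (τ : ℂ)).im = 0) :
    ∃ R : ℝ[X], R.map Complex.ofRealHom = P := by
  have hc : P.map (starRingEnd ℂ) = P := by
    refine Polynomial.eq_of_infinite_eval_eq _ _ ?_
    refine Set.Infinite.mono (s := Set.range (fun x : ℝ => (x : ℂ))) ?_
      (Set.infinite_range_of_injective Complex.ofReal_injective)
    rintro _ ⟨x, rfl⟩
    show (P.map (starRingEnd ℂ)).eval (x : ℂ) = P.eval (x : ℂ)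
    have h1 := eval_map_apply (p := P) (f := starRingEnd ℂ) (x : ℂ)
    rw [Complex.conj_ofReal] at h1
    rw [h1, Complex.conj_eq_iff_im]
    exact h x
  have : P ∈ lifts Complex.ofRealHom := by
    rw [lifts_iff_coeff_lifts]
    intro n
    have h2 : (P.map (starRingEnd ℂ)).coeff n = P.coeff n := by rw [hc]
    rw [coeff_map] at h2
    obtain ⟨r, hr⟩ := Complex.conj_eq_iff_real.mp h2
    exact ⟨r, hr.symm⟩
  exact (mem_lifts _).mp this

def rz (K : Type*) {ι : Type*} (z : ι → ℝ) : K → ι → ℂ := fun _ a => (z a : ℂ)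

lemma rz_add (z : ι → ℝ) (i : ι) (t : ℝ) :
    rz K (z + Pi.single i t) = rz K z + sh i (fun _ => (t : ℂ)) := by
  funext j a
  simp only [rz, sh, Pi.add_apply]
  by_cases h : a = i
  · subst h; simp
  · simp [Pi.single_eq_of_ne h]

lemma q_real (hd : Good d) (S : List ι) (V : K → Finset ι) (z : ι → ℝ) :
    (q d S V (rz K z)).im = 0 := by
  have := q_conj hd S V (rz K z)
  simp only [rz, Complex.conj_ofReal] at this
  exact Complex.conj_eq_iff_im.mp this.symm

lemma Dq_real (hd : Good d) (S : List ι) (j : ι) (V : K → Finset ι) (z : ι → ℝ) :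
    (Dq d S j V (rz K z)).im = 0 := by
  rw [Dq, Complex.im_sum]
  exact Finset.sum_eq_zero fun l _ => q_real hd _ _ _

lemma rz_sh_im (i : ι) (τ : ℂ) (hτ : 0 ≤ τ.im) (z : ι → ℝ) :
    ∀ j a, 0 ≤ ((rz K z + sh i (fun _ => τ) : K → ι → ℂ) j a).im := by
  intro j a
  simp only [rz, sh, Pi.add_apply, Complex.add_im, Complex.ofReal_im, zero_add]
  by_cases h : a = i
  · subst h; simpa
  · simp [Pi.single_eq_of_ne h]

noncomputable def Qr (K : Type*) [Fintype K] [DecidableEq K] (d : Finset ι → (ι → ℂ) → ℂ)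
    (S : List ι) (U : Finset ι) (z : ι → ℝ) : ℝ :=
  (q d S (fun _ : K => U) (rz K z)).re

noncomputable def DQr (K : Type*) [Fintype K] [DecidableEq K] (d : Finset ι → (ι → ℂ) → ℂ)
    (S : List ι) (j : ι) (U : Finset ι) (z : ι → ℝ) : ℝ :=
  (Dq d S j (fun _ : K => U) (rz K z)).re

lemma Qr_eq (hd : Good d) (S : List ι) (U : Finset ι) (z : ι → ℝ) :
    q d S (fun _ : K => U) (rz K z) = (Qr K d S U z : ℂ) := by
  apply Complex.ext <;> simp [Qr, q_real hd]

lemma DQr_eq (hd : Good d) (S : List ι) (j : ι) (U : Finset ι) (z : ι → ℝ) :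
    Dq d S j (fun _ : K => U) (rz K z) = (DQr K d S j U z : ℂ) := by
  apply Complex.ext <;> simp [DQr, Dq_real hd]

lemma roots_real (hd : Good d) {k : ℕ} (hk : Fintype.card K = k + 1) (S : List ι) (hS : S.Nodup)
    (U : Finset ι) (hU : ∀ i ∈ S, i ∉ U) (i : ι) (hi : i ∉ S) (hiU : i ∉ U) (z : ι → ℝ)
    (P : ℂ[X]) (h1 : P.natDegree ≤ k + 1)
    (h2 : ∀ τ, P.eval τ = q d S (fun _ : K => insert i U) (rz K z + sh i (fun _ => τ)))
    (h3 : P.coeff (k + 1) ≠ 0) :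
    ∃ M : Multiset ℝ, M.card = k + 1 ∧
      (∀ τ, P.eval τ = P.coeff (k + 1) * (M.map fun r : ℝ => τ - (r : ℂ)).prod) ∧
      P.coeff k = -(P.coeff (k + 1) * (M.sum : ℝ)) := by
  have hP0 : P ≠ 0 := by rintro rfl; simp at h3
  have hup : ∀ ρ : ℂ, 0 < ρ.im → P.eval ρ ≠ 0 := by
    intro ρ hρ h0
    apply hP0
    refine Polynomial.eq_zero_of_infinite_isRoot P ?_
    refine Set.Infinite.mono (s := (fun η : ℝ => (ρ.re : ℂ) + Complex.I * η) '' Set.Icc 0 ρ.im) ?_ ?_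
    · rintro _ ⟨η, ⟨hη0, hη1⟩, rfl⟩
      show P.eval _ = 0
      have := q_norm_mono hd hk S hS (fun _ : K => U) (fun a ha _ => hU a ha) i hi (fun _ => hiU)
        (rz K z + sh i (fun _ => (ρ.re : ℂ) + Complex.I * η)) (rz_sh_im i _ (by simpa using hη0) z)
        (ρ.im - η) (by linarith)
      rw [add_assoc, ← sh_add, ← h2, ← h2] at this
      have e : (ρ.re : ℂ) + Complex.I * η + Complex.I * ((ρ.im - η : ℝ) : ℂ) = ρ := by
        apply Complex.ext <;> simp
      rw [e, h0, norm_zero] at this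
      exact norm_le_zero_iff.mp this
    · refine Set.Infinite.image ?_ (Set.Icc_infinite hρ)
      intro x _ y _ hxy
      have := congrArg Complex.im hxy
      simpa using this
  have hreal : ∀ ρ ∈ P.roots, ρ.im = 0 := by
    intro ρ hρ
    have hr : P.eval ρ = 0 := isRoot_of_mem_roots hρ
    rcases lt_trichotomy ρ.im 0 with h | h | h
    · exfalso
      refine hup (conj ρ) (by simpa using h) ?_
      have := q_conj hd S (fun _ : K => insert i U) (rz K z + sh i (fun _ => ρ))
      rw [← h2, hr, map_zero] at this
      rw [h2, ← this]
      congr 1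
      funext j a
      simp only [rz, sh, Pi.add_apply]
      by_cases h : a = i
      · subst h; simp
      · simp [Pi.single_eq_of_ne h]
    · exact h
    · exact absurd hr (hup ρ h)
  have hdeg : P.natDegree = k + 1 := le_antisymm h1 (le_natDegree_of_ne_zero h3)
  have hs := IsAlgClosed.splits P
  have hM : P.roots = (P.roots.map Complex.re).map (fun r : ℝ => (r : ℂ)) := by
    rw [Multiset.map_map]
    conv_lhs => rw [← Multiset.map_id P.roots]
    refine Multiset.map_congr rfl fun ρ hρ => ?_
    apply Complex.ext <;> simp [hreal ρ hρ]
  refine ⟨P.roots.map Complex.re, ?_, ?_, ?_⟩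
  · rw [Multiset.card_map, ← hs.natDegree_eq_card_roots, hdeg]
  · intro τ
    rw [hs.eval_eq_prod_roots, leadingCoeff, hdeg]
    conv_lhs => rw [hM]
    rw [Multiset.map_map]
    rfl
  · have h5 := hs.nextCoeff_eq_neg_sum_roots_mul_leadingCoeff
    rw [nextCoeff_of_natDegree_pos (by omega), hdeg, Nat.add_sub_cancel] at h5
    rw [h5, leadingCoeff, hdeg]
    conv_lhs => rw [hM]
    have : ((P.roots.map Complex.re).map (fun r : ℝ => (r : ℂ))).sum =
        (((P.roots.map Complex.re).sum : ℝ) : ℂ) :=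
      (map_multiset_sum Complex.ofRealHom _).symm
    rw [this]
    ring

lemma Dq_poly (hd : Good d) {k : ℕ} (hk : Fintype.card K = k + 1)
    (S : List ι) (V : K → Finset ι) (z : K → ι → ℂ) (i j : ι) (hij : i ≠ j)
    (hi : i ∉ S) (hV : ∀ j, i ∉ V j) :
    ∃ P : ℂ[X], P.natDegree ≤ k + 1 ∧
      (∀ τ, P.eval τ = Dq d S j (fun l => insert i (V l)) (z + sh i (fun _ => τ))) ∧
      P.coeff (k + 1) = Dq d S j V z ∧ P.coeff k = Dq d (i :: S) j V z := by
  choose P h1 h2 h3 h4 using fun l : K => q_poly hd hk S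
    (Function.update (fun m => insert j (V m)) l (V l)) z i hi (by
      intro m
      by_cases h : m = l
      · subst h; simp [hV]
      · simp [Function.update_of_ne h, hij, hV])
  refine ⟨∑ l, P l, ?_, ?_, ?_, ?_⟩
  · exact natDegree_sum_le_of_forall_le _ _ fun l _ => h1 l
  · intro τ
    simp only [eval_finsetSum, Dq]
    refine Finset.sum_congr rfl fun l _ => ?_
    rw [h2]
    congr 1
    funext m
    by_cases h : m = l
    · subst h; simp
    · simp [Function.update_of_ne h, Finset.insert_comm]
  · simp [Dq, h3]
  · simp [Dq, h4]

lemma core (hd : Good d) {k : ℕ} (hk : Fintype.card K = k + 1) (S : List ι) (hS : S.Nodup)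
    (U : Finset ι) (hU : ∀ i ∈ S, i ∉ U) (i : ι) (hi : i ∉ S) (hiU : i ∉ U) (z : ι → ℝ)
    (hc : 0 < Qr K d S U z) :
    ∃ M : Multiset ℝ, M.card = k + 1 ∧
      (∀ τ : ℝ, Qr K d S (insert i U) (z + Pi.single i τ) =
        Qr K d S U z * (M.map fun r => τ - r).prod) ∧
      Qr K d (i :: S) U z = -(Qr K d S U z * M.sum) ∧
      ∀ j U', j ∉ S → j ∉ U' → U = insert j U' →
        0 ≤ Qr K d S U z * DQr K d (i :: S) j U' z - DQr K d S j U' z * Qr K d (i :: S) U z ∧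
        ∀ a, (∀ r ∈ M, r < 0) → (∀ r ∈ M, a ≤ r) →
          0 ≤ Qr K d S U z * DQr K d S j (insert i U') z
            - DQr K d S j U' z * Qr K d S (insert i U) z ∧
          (Qr K d S U z * DQr K d (i :: S) j U' z - DQr K d S j U' z * Qr K d (i :: S) U z)
            * (M.map fun r => 0 - r).prod ≤
          (Qr K d S U z * DQr K d S j (insert i U') z
            - DQr K d S j U' z * Qr K d S (insert i U) z) * (0 - a) := by
  obtain ⟨P, h1, h2, h3, h4⟩ := q_poly hd hk S (fun _ : K => U) (rz K z) i hi (fun _ => hiU)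
  have h3' := h3
  rw [Qr_eq hd] at h3 h4
  obtain ⟨M, hM1, hM2, hM3⟩ := roots_real hd hk S hS U hU i hi hiU z P h1 h2 (by
    rw [h3]; exact_mod_cast hc.ne')
  rw [h3] at hM2 hM3
  have hev : ∀ τ : ℝ, P.eval (τ : ℂ) = (Qr K d S (insert i U) (z + Pi.single i τ) : ℂ) := by
    intro τ
    rw [h2, ← rz_add, Qr_eq hd]
  refine ⟨M, hM1, ?_, ?_, ?_⟩
  · intro τ
    have := hM2 τ
    rw [hev, multProdc] at this
    exact_mod_cast this
  · rw [h4] at hM3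
    exact_mod_cast hM3
  · intro j U' hj hjU' hUj
    have hij : i ≠ j := by rintro rfl; exact hiU (by rw [hUj]; simp)
    have hiU' : i ∉ U' := fun h => hiU (by rw [hUj]; exact Finset.mem_insert_of_mem h)
    obtain ⟨R, r1, r2, r3, r4⟩ := Dq_poly hd hk S (fun _ : K => U') (rz K z) i j hij hi (fun _ => hiU')
    rw [DQr_eq hd] at r3 r4
    have hRev : ∀ τ : ℝ, R.eval (τ : ℂ) = (DQr K d S j (insert i U') (z + Pi.single i τ) : ℂ) := by
      intro τ
      rw [r2, ← rz_add, DQr_eq hd]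
    set c := Qr K d S U z with hcdef
    set c' := DQr K d S j U' z
    set e := Qr K d (i :: S) U z
    set e' := DQr K d (i :: S) j U' z
    obtain ⟨N, hN⟩ := lift_real (C (c : ℂ) * R - C (c' : ℂ) * P) (by
      intro τ
      rw [eval_sub, eval_mul, eval_mul, eval_C, eval_C, hev, hRev]
      simp)
    have hcoN : ∀ m, ((N.coeff m : ℝ) : ℂ) = c * R.coeff m - c' * P.coeff m := by
      intro m
      have := congrArg (fun p => coeff p m) hN
      simpa using this
    have hNk : N.coeff k = c * e' - c' * e := by
      have := hcoN k
      rw [r4, h4] at this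
      exact_mod_cast this
    have hNk1 : N.coeff (k + 1) = 0 := by
      have := hcoN (k + 1)
      rw [r3, h3] at this
      have h : N.coeff (k + 1) = c * c' - c' * c := by exact_mod_cast this
      rw [h]; ring
    have hNdeg : N.degree < ((k + 1 : ℕ) : WithBot ℕ) := by
      rw [degree_lt_iff_coeff_zero]
      intro m hm
      rcases eq_or_lt_of_le hm with h | h
      · rw [← h]; exact hNk1
      · have := hcoN m
        rw [coeff_eq_zero_of_natDegree_lt (lt_of_le_of_lt r1 h),
          coeff_eq_zero_of_natDegree_lt (lt_of_le_of_lt h1 h)] at this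
        simpa using this
    have hN0 : N.eval 0 = c * DQr K d S j (insert i U') z - c' * Qr K d S (insert i U) z := by
      have h5 := evalc N 0
      have h6 := hev 0
      have h7 := hRev 0
      rw [hN, eval_sub, eval_mul, eval_mul, eval_C, eval_C, h6, h7, Pi.single_zero, add_zero] at h5
      exact_mod_cast h5.symm
    have key := PF (k + 1) M hM1 N hNdeg (by
      intro τ hτ
      have hD := Dq_im hd hk S hS (fun _ : K => insert i U') (by
          intro a ha l
          have h1 : a ≠ i := fun h => hi (h ▸ ha)
          have h2 : a ∉ U' := fun h => hU a ha (by rw [hUj]; exact Finset.mem_insert_of_mem h)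
          simp [h1, h2]) j hj (by intro l; simp [hij.symm, hjU'])
        (rz K z + sh i (fun _ => τ)) (rz_sh_im i τ hτ.le z)
      have e1 : (fun _ : K => insert j (insert i U')) = fun _ : K => insert i U := by
        funext l; rw [hUj, Finset.insert_comm]
      rw [e1, ← r2, ← h2, hM2] at hD
      rw [hN, eval_sub, eval_mul, eval_mul, eval_C, eval_C, hM2]
      set w := (M.map fun r : ℝ => τ - (r : ℂ)).prod
      have e2 : (c : ℂ) * R.eval τ - c' * (c * w) = c * R.eval τ - ((c' * c : ℝ) : ℂ) * w := by
        push_cast; ring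
      have e3 : (c * R.eval τ - ((c' * c : ℝ) : ℂ) * w) * conj w =
          R.eval τ * conj ((c : ℂ) * w) - ((c' * c * Complex.normSq w : ℝ) : ℂ) := by
        rw [map_mul, Complex.conj_ofReal]
        push_cast
        rw [← Complex.mul_conj]
        ring
      rw [e2, e3, Complex.sub_im, Complex.ofReal_im, sub_zero]
      exact hD)
    rw [Nat.add_sub_cancel, hNk] at key
    refine ⟨key.1, fun a h5 h6 => ?_⟩
    have := key.2 0 a h5 h6
    rw [hN0] at this
    exact this

end KS
end

section
open Polynomial ComplexConjugate

namespace KS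
set_option linter.unusedSectionVars false
variable {ι K : Type*} [DecidableEq ι] [Fintype K] [DecidableEq K]
variable {d : Finset ι → (ι → ℂ) → ℂ}

lemma prod_deriv (M : Multiset ℝ) (h : ∀ r ∈ M, r < 0) :
    HasDerivAt (fun τ : ℝ => (M.map fun r => τ - r).prod)
      ((M.map fun r => 0 - r).prod * (M.map fun r => (0 - r)⁻¹).sum) 0 := by
  induction M using Multiset.induction_on with
  | empty => simpa using hasDerivAt_const (0 : ℝ) (1 : ℝ)
  | cons a M ih =>
    have ha := h a (Multiset.mem_cons_self _ _)
    have := ((hasDerivAt_id (0 : ℝ)).sub_const a).mul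
      (ih fun r hr => h r (Multiset.mem_cons_of_mem hr))
    simp only [Multiset.map_cons, Multiset.prod_cons, Multiset.sum_cons]
    refine this.congr_deriv ?_
    have h0 : (0 - a) ≠ 0 := by linarith
    simp only [one_mul, id]
    rw [mul_add, mul_assoc, mul_comm _ ((0 - a)⁻¹), mul_inv_cancel_left₀ h0]
    ring

lemma tangent (M : Multiset ℝ) (h : ∀ r ∈ M, r < 0) (l : ℝ) :
    2 * l * M.card + l ^ 2 * M.sum ≤ (M.map fun r => (0 - r)⁻¹).sum := by
  induction M using Multiset.induction_on with
  | empty => simp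
  | cons a M ih =>
    have ha := h a (Multiset.mem_cons_self _ _)
    have := ih fun r hr => h r (Multiset.mem_cons_of_mem hr)
    simp only [Multiset.map_cons, Multiset.sum_cons, Multiset.card_cons]
    push_cast
    have h2 : 2 * l + l ^ 2 * a ≤ (0 - a)⁻¹ := by
      rw [← sub_nonneg]
      have h3 : (0 - a)⁻¹ - (2 * l + l ^ 2 * a) = (1 + l * a) ^ 2 / (0 - a) := by
        have : (0 - a) ≠ 0 := by linarith
        field_simp; ring
      rw [h3]; apply div_nonneg (sq_nonneg _); linarith
    linarith

lemma Qr_deriv (hd : Good d) (S : List ι) (U : Finset ι) (z : ι → ℝ) (i : ι)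
    (hi : i ∉ S) (hU : i ∉ U) (t : ℝ) :
    HasDerivAt (fun t : ℝ => Qr K d S (insert i U) (z + Pi.single i t))
      (DQr K d S i U (z + Pi.single i t)) t := by
  have := (q_hasDeriv hd S (fun _ : K => U) (rz K z) i hi (fun _ => hU) (t : ℂ)).real_of_complex
  simp only [← rz_add] at this
  exact this

lemma Qr_cons (hd : Good d) {k : ℕ} (hk : Fintype.card K = k + 1) (S : List ι) (U : Finset ι)
    (z : ι → ℝ) (i : ι) (hi : i ∉ S) (hU : i ∉ U) (t : ℝ) :
    Qr K d (i :: S) U (z + Pi.single i t) = Qr K d (i :: S) U z + (k + 1) * t * Qr K d S U z := by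
  have := q_aff_all hd S (fun _ : K => U) (rz K z) i t hi (fun _ => hU)
  rw [← rz_add, Qr_eq hd, Qr_eq hd, Qr_eq hd, hk] at this
  exact_mod_cast this

lemma DQr_cons (hd : Good d) {k : ℕ} (hk : Fintype.card K = k + 1) (S : List ι) (U : Finset ι)
    (z : ι → ℝ) (i j : ι) (hij : i ≠ j) (hi : i ∉ S) (hU : i ∉ U) (t : ℝ) :
    DQr K d (i :: S) j U (z + Pi.single i t)
      = DQr K d (i :: S) j U z + (k + 1) * t * DQr K d S j U z := by
  have : Dq d (i :: S) j (fun _ : K => U) (rz K (z + Pi.single i t)) =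
      Dq d (i :: S) j (fun _ : K => U) (rz K z) + (k + 1) * t * Dq d S j (fun _ : K => U) (rz K z) := by
    rw [rz_add, Dq, Dq, Dq, Finset.mul_sum, ← Finset.sum_add_distrib]
    refine Finset.sum_congr rfl fun l _ => ?_
    rw [q_aff_all hd S _ (rz K z) i t hi, hk]
    · push_cast; ring
    · intro m
      by_cases hm : m = l
      · subst hm; simpa using hU
      · simp [Function.update_of_ne hm, hU, hij]
  rw [DQr_eq hd, DQr_eq hd, DQr_eq hd] at this
  exact_mod_cast this

def Inv (K : Type*) [Fintype K] [DecidableEq K] (d : Finset ι → (ι → ℂ) → ℂ) (κ : ℝ)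
    (S : List ι) (U : Finset ι) (z : ι → ℝ) : Prop :=
  0 < Qr K d S U z ∧ (∀ j ∈ U, ∀ t : ℝ, 0 ≤ t → 0 < Qr K d S U (z + Pi.single j t)) ∧
  (∀ j U', j ∉ U' → U = insert j U' → DQr K d S j U' z ≤ κ * Qr K d S U z)

lemma step (hd : Good d) {k : ℕ} (hk : Fintype.card K = k + 1) (hk1 : 1 ≤ k) (κ δ : ℝ) (hκ : 0 < κ)
    (hδ : (k + 1) * δ * κ ≤ k ^ 2) (S : List ι) (hS : S.Nodup)
    (U : Finset ι) (hU : ∀ i ∈ S, i ∉ U) (i : ι) (hi : i ∉ S) (hiU : i ∉ U) (z : ι → ℝ)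
    (h1 : Inv K d κ S U z) (h2 : Inv K d κ S (insert i U) z) :
    Inv K d κ (i :: S) U (z + Pi.single i (-δ)) := by
  obtain ⟨c0, ct, cb⟩ := h1
  obtain ⟨p0, pt, pb⟩ := h2
  obtain ⟨M, M1, M2, M3, M4⟩ := core hd hk S hS U hU i hi hiU z c0
  have Mneg : ∀ r ∈ M, r < 0 := by
    intro r hr
    by_contra hcon
    push Not at hcon
    have h3 := pt i (Finset.mem_insert_self _ _) r hcon
    rw [M2 r] at h3
    have : (M.map fun r' => r - r').prod = 0 :=
      Multiset.prod_eq_zero (Multiset.mem_map.2 ⟨r, hr, by simp⟩)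
    rw [this] at h3; simp at h3
  have hp : Qr K d S (insert i U) z = Qr K d S U z * (M.map fun r => 0 - r).prod := by
    have := M2 0
    simpa only [Pi.single_zero, add_zero] using this
  have hpp : 0 < (M.map fun r => 0 - r).prod := by
    rw [hp] at p0; exact (mul_pos_iff_of_pos_left c0).1 p0
  have hsum : (M.map fun r => (0 - r)⁻¹).sum ≤ κ := by
    have hD := Qr_deriv (K := K) hd S U z i hi hiU 0
    simp only [M2, Pi.single_zero, add_zero] at hD
    have hD2 := (prod_deriv M Mneg).const_mul (Qr K d S U z)
    have := hD.unique hD2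
    have h3 := pb i U hiU rfl
    rw [this, hp, ← mul_assoc, mul_comm κ] at h3
    exact le_of_mul_le_mul_left h3 (mul_pos c0 hpp)
  obtain ⟨a, haM, ha⟩ : ∃ a ∈ M, ∀ r ∈ M, a ≤ r := by
    have hne : M.toFinset.Nonempty := by
      rw [Multiset.toFinset_nonempty]; rintro rfl; simp at M1
    obtain ⟨a, h3, h4⟩ := M.toFinset.exists_min_image id hne
    exact ⟨a, by simpa using h3, fun r hr => h4 r (by simpa using hr)⟩
  have ha0 := Mneg a haM
  obtain ⟨M', rfl⟩ := Multiset.exists_cons_of_mem haM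
  have hM'n : ∀ r ∈ M', r < 0 := fun r hr => Mneg r (Multiset.mem_cons_of_mem hr)
  have hM'k : M'.card = k := by simpa using M1
  have hkp : (0 : ℝ) < k := by exact_mod_cast hk1
  have hM's : (k + 1) * δ ≤ - M'.sum := by
    have ht := tangent M' hM'n (κ / k)
    rw [hM'k] at ht
    have h3 : (M'.map fun r => (0 - r)⁻¹).sum ≤ κ := by
      rw [Multiset.map_cons, Multiset.sum_cons] at hsum
      have : 0 < (0 - a)⁻¹ := by rw [inv_pos]; linarith
      linarith
    have h4 : 2 * (κ / k) * k = 2 * κ := by field_simp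
    rw [h4] at ht
    have h5 : κ ≤ (κ / k) ^ 2 * (-M'.sum) := by linarith
    have h6 : k ^ 2 ≤ κ * (-M'.sum) := by
      have h7 := mul_le_mul_of_nonneg_left h5 (show 0 ≤ (k : ℝ) ^ 2 / κ by positivity)
      have h8 : (k : ℝ) ^ 2 / κ * κ = k ^ 2 := by field_simp
      have h9 : (k : ℝ) ^ 2 / κ * ((κ / k) ^ 2 * (-M'.sum)) = κ * (-M'.sum) := by field_simp
      rwa [h8, h9] at h7
    have h10 : (k + 1) * δ * κ ≤ (-M'.sum) * κ := by linarith
    exact le_of_mul_le_mul_right h10 hκ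
  set c := Qr K d S U z with hcdef
  set e := Qr K d (i :: S) U z with hedef
  have hmain : c * (-a) ≤ e - (k + 1) * δ * c := by
    rw [M3, Multiset.sum_cons]
    nlinarith [mul_le_mul_of_nonneg_left hM's c0.le]
  have hca : 0 < c * (-a) := mul_pos c0 (by linarith)
  have hval : ∀ y : ι → ℝ, Qr K d (i :: S) U (y + Pi.single i (-δ)) =
      Qr K d (i :: S) U y - (k + 1) * δ * Qr K d S U y := by
    intro y; rw [Qr_cons hd hk S U y i hi hiU]; ring
  refine ⟨?_, ?_, ?_⟩
  · rw [hval]; linarith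
  · intro j hj t ht
    have hjU : U = insert j (U.erase j) := (Finset.insert_erase hj).symm
    have hjn : j ∉ U.erase j := Finset.notMem_erase _ _
    have hjS : j ∉ S := fun h => hU j h hj
    have hji : j ≠ i := fun h => hiU (h ▸ hj)
    have hswap : z + Pi.single i (-δ) + Pi.single j t = z + Pi.single j t + Pi.single i (-δ) := by
      abel
    rw [hswap, hval]
    have dc : ∀ s, HasDerivAt (fun t : ℝ => Qr K d S U (z + Pi.single j t))
        (DQr K d S j (U.erase j) (z + Pi.single j s)) s := fun s => by
      have := Qr_deriv (K := K) hd S (U.erase j) z j hjS hjn s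
      rwa [← hjU] at this
    have de : ∀ s, HasDerivAt (fun t : ℝ => Qr K d (i :: S) U (z + Pi.single j t))
        (DQr K d (i :: S) j (U.erase j) (z + Pi.single j s)) s := fun s => by
      have := Qr_deriv (K := K) hd (i :: S) (U.erase j) z j (by simp [hji, hjS]) hjn s
      rwa [← hjU] at this
    have hdiv : ∀ s, 0 ≤ s → HasDerivAt (fun t : ℝ => Qr K d (i :: S) U (z + Pi.single j t) /
        Qr K d S U (z + Pi.single j t)) _ s := fun s hs => (de s).div (dc s) (ct j hj s hs).ne'
    have hmono : MonotoneOn (fun t : ℝ => Qr K d (i :: S) U (z + Pi.single j t) /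
        Qr K d S U (z + Pi.single j t)) (Set.Ici 0) := by
      refine monotoneOn_of_deriv_nonneg (convex_Ici 0) ?_ ?_ ?_
      · exact fun s hs => (hdiv s hs).continuousAt.continuousWithinAt
      · intro s hs
        rw [interior_Ici] at hs
        exact (hdiv s (le_of_lt hs)).differentiableAt.differentiableWithinAt
      · intro s hs
        rw [interior_Ici] at hs
        rw [(hdiv s (le_of_lt hs)).deriv]
        have hcs := ct j hj s (le_of_lt hs)
        obtain ⟨N, -, -, -, N4⟩ := core hd hk S hS U hU i hi hiU (z + Pi.single j s) hcs
        have := (N4 j (U.erase j) hjS hjn hjU).1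
        apply div_nonneg _ (sq_nonneg _)
        linarith
    have h3 := hmono (Set.mem_Ici.2 le_rfl) (Set.mem_Ici.2 ht) ht
    simp only [Pi.single_zero, add_zero] at h3
    have hcs := ct j hj t ht
    rw [← hcdef, ← hedef, div_le_div_iff₀ c0 hcs] at h3
    have h4 : 0 < c * (Qr K d (i :: S) U (z + Pi.single j t)
        - (k + 1) * δ * Qr K d S U (z + Pi.single j t)) := by
      have : 0 < (e - (k + 1) * δ * c) * Qr K d S U (z + Pi.single j t) :=
        mul_pos (by linarith) hcs
      nlinarith
    exact (mul_pos_iff_of_pos_left c0).1 h4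
  · intro j U' hjU' hUj
    have hj : j ∈ U := by rw [hUj]; exact Finset.mem_insert_self _ _
    have hjS : j ∉ S := fun h => hU j h hj
    have hji : j ≠ i := fun h => hiU (h ▸ hj)
    have hiU' : i ∉ U' := fun h => hiU (by rw [hUj]; exact Finset.mem_insert_of_mem h)
    obtain ⟨-, N2⟩ := M4 j U' hjS hjU' hUj
    obtain ⟨N3, N4⟩ := N2 a Mneg ha
    have hpj := pb j (insert i U') (by simp [hji, hjU']) (by rw [hUj, Finset.insert_comm])
    rw [hval, DQr_cons hd hk S U' z i j hji.symm hi hiU']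
    rw [hp] at hpj N3 N4
    set W := (Multiset.map (fun r => 0 - r) (a ::ₘ M')).prod with hPdef
    set c' := DQr K d S j U' z
    set e' := DQr K d (i :: S) j U' z
    set p' := DQr K d S j (insert i U') z
    rw [← hcdef, ← hedef]
    -- first divide by the product
    have g1 : p' ≤ κ * c * W := by linarith
    have g2 : (c * e' - c' * e) * W ≤ (c * (κ * c * W) - c' * (c * W)) * (0 - a) := by
      refine N4.trans (mul_le_mul_of_nonneg_right ?_ (by linarith))
      have := mul_le_mul_of_nonneg_left g1 c0.le
      linarith
    have g3 : c * e' - c' * e ≤ (κ * c - c') * (c * (-a)) := by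
      refine le_of_mul_le_mul_right ?_ hpp
      refine g2.trans (le_of_eq ?_); ring
    have g4 : 0 ≤ κ * c - c' := by
      have : 0 ≤ (κ * c - c') * (c * W) := by
        have := mul_le_mul_of_nonneg_left g1 c0.le
        nlinarith
      exact nonneg_of_mul_nonneg_left this (mul_pos c0 hpp)
    have g5 : c * e' - c' * e ≤ (κ * c - c') * (e - (k + 1) * δ * c) :=
      g3.trans (mul_le_mul_of_nonneg_left hmain g4)
    refine le_of_mul_le_mul_left ?_ c0
    nlinarith
noncomputable def dr (d : Finset ι → (ι → ℂ) → ℂ) (U : Finset ι) (y : ι → ℝ) : ℝ :=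
  (d U (fun a => (y a : ℂ))).re

lemma dr_eq (hd : Good d) (U : Finset ι) (y : ι → ℝ) : d U (fun a => (y a : ℂ)) = (dr d U y : ℂ) := by
  have := hd.conjg U (fun a => (y a : ℂ))
  simp only [Complex.conj_ofReal] at this
  have := Complex.conj_eq_iff_im.mp this.symm
  apply Complex.ext <;> simp [dr, this]

lemma dr_eq' (hd : Good d) (U : Finset ι) (y : ι → ℝ) (l : K) : d U (rz K y l) = (dr d U y : ℂ) :=
  dr_eq hd U y

lemma Qr_nil (hd : Good d) {k : ℕ} (hk : Fintype.card K = k + 1) (U : Finset ι) (y : ι → ℝ) :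
    Qr K d [] U y = dr d U y ^ (k + 1) := by
  have : q d [] (fun _ : K => U) (rz K y) = (dr d U y ^ (k + 1) : ℝ) := by
    simp only [q, dr_eq' hd]
    rw [Finset.prod_const, Finset.card_univ, hk]; push_cast; rfl
  rw [Qr, this, Complex.ofReal_re]

lemma DQr_nil (hd : Good d) {k : ℕ} (hk : Fintype.card K = k + 1) (j : ι) (U : Finset ι) (y : ι → ℝ) :
    DQr K d [] j U y = (k + 1) * (dr d U y * dr d (insert j U) y ^ k) := by
  have : Dq d [] j (fun _ : K => U) (rz K y) =
      ((k + 1) * (dr d U y * dr d (insert j U) y ^ k) : ℝ) := by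
    rw [Dq]
    have : ∀ l : K, q d [] (Function.update (fun _ : K => insert j U) l U) (rz K y) =
        ((dr d U y * dr d (insert j U) y ^ k : ℝ) : ℂ) := by
      intro l
      simp only [q, dr_eq' hd]
      rw [← Finset.mul_prod_erase Finset.univ _ (Finset.mem_univ l)]
      rw [Finset.prod_congr rfl (g := fun _ => ((dr d (insert j U) y : ℝ) : ℂ))]
      · rw [Finset.prod_const, Finset.card_erase_of_mem (Finset.mem_univ l), Finset.card_univ, hk]
        simp
      · intro m hm
        rw [Function.update_of_ne (Finset.ne_of_mem_erase hm)]
    rw [Finset.sum_congr rfl (fun l _ => this l), Finset.sum_const, Finset.card_univ, hk]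
    simp
  rw [DQr, this, Complex.ofReal_re]

lemma barrier (hd : Good d) {k : ℕ} (hk : Fintype.card K = k + 1) (hk1 : 1 ≤ k) (B b x : ℝ)
    (hB : 0 < B) (hδ : (k + 1) * (b - x) * ((k + 1) * B) ≤ k ^ 2)
    (hP : ∀ U (y : ι → ℝ), (∀ a, b ≤ y a) → 0 < dr d U y)
    (hPB : ∀ j U, j ∉ U → dr d U (fun _ => b) ≤ B * dr d (insert j U) (fun _ => b))
    (S : List ι) (hS : S.Nodup) (U : Finset ι) (hU : ∀ i ∈ S, i ∉ U) :
    Inv K d ((k + 1) * B) S U (fun a => if a ∈ S then x else b) := by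
  induction S generalizing U with
  | nil =>
    have hz : (fun a : ι => if a ∈ ([] : List ι) then x else b) = fun _ => b := by
      funext a; simp
    rw [hz]
    refine ⟨?_, ?_, ?_⟩
    · rw [Qr_nil hd hk]; exact pow_pos (hP _ _ fun _ => le_rfl) _
    · intro j _ t ht
      rw [Qr_nil hd hk]
      refine pow_pos (hP _ _ fun a => ?_) _
      by_cases h : a = j
      · subst h; simpa using ht
      · simp [Pi.single_eq_of_ne h]
    · intro j U' hj hUj
      rw [Qr_nil hd hk, DQr_nil hd hk, hUj]
      have h1 := hPB j U' hj
      have h2 := hP (insert j U') (fun _ => b) fun _ => le_rfl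
      have h3 := mul_le_mul_of_nonneg_right h1 (pow_pos h2 k).le
      have h4 := mul_le_mul_of_nonneg_left h3 (show (0 : ℝ) ≤ k + 1 by positivity)
      refine h4.trans (le_of_eq ?_)
      ring
  | cons i S ih =>
    have hi := (List.nodup_cons.1 hS).1
    have hS' := (List.nodup_cons.1 hS).2
    have hiU := hU i List.mem_cons_self
    have hU' : ∀ m ∈ S, m ∉ U := fun m hm => hU m (List.mem_cons_of_mem _ hm)
    have := step hd hk hk1 ((k + 1) * B) (b - x) (by positivity) hδ S hS' U hU' i hi hiU _
      (ih hS' U hU') (ih hS' (insert i U) (by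
        intro m hm
        rw [Finset.mem_insert]; push Not
        exact ⟨fun h => hi (h ▸ hm), hU' m hm⟩))
    convert this using 1
    funext a
    by_cases h : a = i
    · subst h; simp [hi]
    · simp [h]

lemma barrier_end [Fintype ι] (hd : Good d) {k : ℕ} (hk : Fintype.card K = k + 1) (hk1 : 1 ≤ k)
    (B b x : ℝ)
    (hB : 0 < B) (hδ : (k + 1) * (b - x) * ((k + 1) * B) ≤ k ^ 2)
    (hP : ∀ U (y : ι → ℝ), (∀ a, b ≤ y a) → 0 < dr d U y)
    (hPB : ∀ j U, j ∉ U → dr d U (fun _ => b) ≤ B * dr d (insert j U) (fun _ => b)) :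
    0 < Qr K d (Finset.univ : Finset ι).toList ∅ (fun _ => x) := by
  have := (barrier hd hk hk1 B b x hB hδ hP hPB (Finset.univ : Finset ι).toList
    (Finset.nodup_toList _) ∅ (by simp)).1
  simpa using this
end KS
end

section
open Polynomial ComplexConjugate

namespace KS
set_option linter.unusedSectionVars false
variable {ι K : Type*} [DecidableEq ι] [Fintype K] [DecidableEq K]
variable {d : Finset ι → (ι → ℂ) → ℂ}

noncomputable def qx (d : Finset ι → (ι → ℂ) → ℂ) (S : List ι) (V : K → Finset ι) (x : ℂ) : ℂ :=
  q d S V (fun _ _ => x)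

lemma qx_diff (hdf : ∀ V, Differentiable ℂ (fun x : ℂ => d V (fun _ => x))) (S : List ι)
    (V : K → Finset ι) : Differentiable ℂ (qx d S V) := by
  induction S generalizing V with
  | nil =>
    show Differentiable ℂ (fun x => ∏ j, d (V j) (fun _ => x))
    exact Differentiable.fun_finsetProd fun j _ => hdf (V j)
  | cons i S ih =>
    show Differentiable ℂ (fun x => ∑ l, qx d S (Function.update V l (insert i (V l))) x)
    exact Differentiable.fun_sum fun l _ => ih _

lemma qx_im (hd : Good d) (S : List ι) (V : K → Finset ι) (x : ℝ) : (qx d S V (x : ℂ)).im = 0 :=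
  q_real hd S V (fun _ => x)

lemma qx_pos (hd : Good d) [Nonempty K] (x : ℝ) (hp : ∀ V, 0 < dr d V (fun _ => x)) (S : List ι)
    (V : K → Finset ι) : 0 < (qx d S V (x : ℂ)).re := by
  induction S generalizing V with
  | nil =>
    have : qx d [] V (x : ℂ) = ((∏ j, dr d (V j) (fun _ => x) : ℝ) : ℂ) := by
      show ∏ j, d (V j) (fun _ => (x : ℂ)) = _
      push_cast
      exact Finset.prod_congr rfl fun j _ => dr_eq hd (V j) (fun _ => x)
    rw [this, Complex.ofReal_re]
    exact Finset.prod_pos fun j _ => hp _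
  | cons i S ih =>
    have : qx d (i :: S) V x = ∑ l, qx d S (Function.update V l (insert i (V l))) x := rfl
    rw [this, Complex.re_sum]
    exact Finset.sum_pos (fun l _ => ih _) Finset.univ_nonempty

lemma qx_herm (hd : Good d) {k : ℕ} (hk : Fintype.card K = k + 1) (i : ι) (S : List ι)
    (hS : (i :: S).Nodup) (V : K → Finset ι) (hV : ∀ m ∈ i :: S, ∀ j, m ∉ V j) (l : K)
    (x : ℂ) (hx : 0 < x.im) :
    0 ≤ (qx d S (Function.update V l (insert i (V l))) x * conj (qx d S V x)).im := by
  by_contra hcon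
  push Not at hcon
  have hi := (List.nodup_cons.1 hS).1
  have hS' := (List.nodup_cons.1 hS).2
  have hV' : ∀ m ∈ S, ∀ j, m ∉ V j := fun m hm => hV m (List.mem_cons_of_mem _ hm)
  have hiV := hV i List.mem_cons_self
  set G := qx d S V x with hG
  set f := qx d S (Function.update V l (insert i (V l))) x with hf
  have hG0 : G ≠ 0 := q_stab hd hk S hS' V hV' _ (fun _ _ => hx)
  have hN : 0 < Complex.normSq G := Complex.normSq_pos.2 hG0
  have hy : 0 < (-(f / G)).im := by
    have : f / G = f * conj G * ((Complex.normSq G)⁻¹ : ℝ) := by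
      rw [div_eq_mul_inv, Complex.inv_def]; push_cast; ring
    rw [this, Complex.neg_im, Complex.im_mul_ofReal]
    have := mul_neg_of_neg_of_pos hcon (inv_pos.2 hN)
    linarith
  have h1 := q_aff hd S V (fun _ _ => x) i (Pi.single l (-(f / G))) hi hiV l
  rw [Pi.single_eq_same] at h1
  have h2 : q d S (Function.update V l (insert i (V l))) (fun _ _ => x) = f := rfl
  have h3 : q d S V (fun _ _ => x) = G := rfl
  rw [h2, h3, neg_mul, div_mul_cancel₀ _ hG0, add_neg_cancel] at h1
  refine q_stab hd hk S hS' _ ?_ _ ?_ h1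
  · intro m hm j
    have hmi : m ≠ i := fun h => hi (h ▸ hm)
    exact not_mem_upd hmi (hV' m hm) l j
  · intro j a
    simp only [Pi.add_apply, sh, Complex.add_im]
    by_cases hja : a = i
    · subst hja
      rw [Pi.single_eq_same]
      by_cases hj : j = l
      · subst hj; rw [Pi.single_eq_same]; linarith
      · rw [Pi.single_eq_of_ne hj]; simpa using hx
    · rw [Pi.single_eq_of_ne hja]; simpa using hx

lemma lemR (f G : ℂ → ℂ) (f' G' : ℂ) (x : ℝ) (hf : HasDerivAt f f' x) (hG : HasDerivAt G G' x)
    (hfr : (f x).im = 0) (hGr : (G x).im = 0)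
    (h : ∀ y : ℂ, 0 < y.im → 0 ≤ (f y * conj (G y)).im) :
    0 ≤ f'.re * (G x).re - (f x).re * G'.re := by
  have key : ∀ (f : ℂ → ℂ) (f' : ℂ), HasDerivAt f f' x →
      HasDerivAt (fun η : ℝ => f (x + η * Complex.I)) (f' * Complex.I) 0 := by
    intro f f' hf
    have h1 : HasDerivAt (fun η : ℂ => (x : ℂ) + η * Complex.I) Complex.I ((0 : ℝ) : ℂ) := by
      simpa using ((hasDerivAt_id ((0 : ℝ) : ℂ)).mul_const Complex.I).const_add (x : ℂ)
    have h2 : HasDerivAt f f' ((fun η : ℂ => (x : ℂ) + η * Complex.I) ((0 : ℝ) : ℂ)) := by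
      simpa using hf
    exact (HasDerivAt.comp (h := fun η : ℂ => (x : ℂ) + η * Complex.I) _ h2 h1).comp_ofReal
  have re : ∀ (u : ℝ → ℂ) (u' : ℂ), HasDerivAt u u' 0 → HasDerivAt (fun t => (u t).re) u'.re 0 :=
    fun u u' hu => (Complex.reCLM.hasFDerivAt.comp_hasDerivAt (0 : ℝ) hu)
  have im : ∀ (u : ℝ → ℂ) (u' : ℂ), HasDerivAt u u' 0 → HasDerivAt (fun t => (u t).im) u'.im 0 :=
    fun u u' hu => (Complex.imCLM.hasFDerivAt.comp_hasDerivAt (0 : ℝ) hu)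
  have kf := key f f' hf
  have kG := key G G' hG
  have hd := ((im _ _ kf).mul (re _ _ kG)).sub ((re _ _ kf).mul (im _ _ kG))
  have := deriv_nonneg_right hd (by
    intro η hη
    have h1 := h (x + η * Complex.I) (by simpa using hη)
    simp only [Pi.sub_apply, Pi.mul_apply, Complex.ofReal_zero, zero_mul, add_zero, hfr, hGr, mul_zero,
      sub_zero]
    simp only [Complex.mul_im, Complex.conj_re, Complex.conj_im] at h1
    linarith)
  simp only [Complex.ofReal_zero, zero_mul, add_zero, hfr, hGr, mul_zero, Complex.mul_I_re,
    Complex.mul_I_im, zero_add] at this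
  linarith

lemma ratio_mono (f g f' g' : ℝ → ℝ) (ε : ℝ) (hf : ∀ x, HasDerivAt f (f' x) x)
    (hg : ∀ x, HasDerivAt g (g' x) x) (hpos : ∀ x, ε ≤ x → 0 < g x)
    (h : ∀ x, ε ≤ x → 0 ≤ f' x * g x - f x * g' x) : MonotoneOn (fun x => f x / g x) (Set.Ici ε) := by
  have hdiv : ∀ s, ε ≤ s → HasDerivAt (fun t : ℝ => f t / g t) _ s :=
    fun s hs => (hf s).div (hg s) (hpos s hs).ne'
  refine monotoneOn_of_deriv_nonneg (convex_Ici ε) ?_ ?_ ?_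
  · exact fun s hs => (hdiv s hs).continuousAt.continuousWithinAt
  · intro s hs
    rw [interior_Ici] at hs
    exact (hdiv s (le_of_lt hs)).differentiableAt.differentiableWithinAt
  · intro s hs
    rw [interior_Ici] at hs
    rw [(hdiv s (le_of_lt hs)).deriv]
    exact div_nonneg (h s (le_of_lt hs)) (sq_nonneg _)

lemma greedy_step (hd : Good d) (hdf : ∀ V, Differentiable ℂ (fun x : ℂ => d V (fun _ => x)))
    {k : ℕ} (hk : Fintype.card K = k + 1) (X ε : ℝ)
    (hp : ∀ V (x : ℝ), X ≤ x → 0 < dr d V (fun _ => x)) (i : ι) (S : List ι)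
    (hS : (i :: S).Nodup) (V : K → Finset ι) (hV : ∀ m ∈ i :: S, ∀ j, m ∉ V j)
    (h : ∀ x : ℝ, ε ≤ x → 0 < (qx d (i :: S) V (x : ℂ)).re) :
    ∃ l, ∀ x : ℝ, ε ≤ x → 0 < (qx d S (Function.update V l (insert i (V l))) (x : ℂ)).re := by
  have : Nonempty K := by
    rw [← Fintype.card_pos_iff, hk]; omega
  have hF : ∀ x, qx d (i :: S) V x = ∑ l, qx d S (Function.update V l (insert i (V l))) x :=
    fun x => rfl
  have D : ∀ S (V : K → Finset ι) (x : ℂ), HasDerivAt (qx d S V) (deriv (qx d S V) x) x :=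
    fun S V x => (qx_diff hdf S V x).hasDerivAt
  have DR : ∀ S (V : K → Finset ι) (x : ℝ),
      HasDerivAt (fun t : ℝ => (qx d S V t).re) (deriv (qx d S V) (x : ℂ)).re x :=
    fun S V x => (D S V x).real_of_complex
  have hGpos : ∀ x : ℝ, ε ≤ x → 0 < (qx d S V (x : ℂ)).re := by
    have hm := ratio_mono (fun t : ℝ => -(qx d S V t).re) (fun t : ℝ => (qx d (i :: S) V t).re)
      (fun t => -(deriv (qx d S V) (t : ℂ)).re) (fun t => (deriv (qx d (i :: S) V) (t : ℂ)).re) ε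
      (fun x => (DR S V x).neg) (DR (i :: S) V) h (by
        intro x hx
        have := lemR (qx d (i :: S) V) (qx d S V) _ _ x (D _ _ _) (D _ _ _) (qx_im hd _ _ _)
          (qx_im hd _ _ _) (by
            intro y hy
            rw [hF, Finset.sum_mul, Complex.im_sum]
            exact Finset.sum_nonneg fun l _ => qx_herm hd hk i S hS V hV l y hy)
        linarith)
    intro x hx
    have h1 := hm (Set.mem_Ici.2 hx) (Set.mem_Ici.2 (hx.trans (le_max_left x X))) (le_max_left x X)
    simp only [neg_div, neg_le_neg_iff] at h1
    have h2 : 0 < (qx d S V ((max x X : ℝ) : ℂ)).re :=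
      qx_pos hd _ (fun V => hp V _ (le_max_right _ _)) S V
    have h3 := h _ (hx.trans (le_max_left x X))
    have h4 := (div_pos h2 h3).trans_le h1
    exact (div_pos_iff_of_pos_right (h x hx)).1 h4
  have h0 := h ε le_rfl
  rw [hF, Complex.re_sum] at h0
  obtain ⟨l, -, hl⟩ := Finset.exists_lt_of_sum_lt (s := Finset.univ) (f := fun _ : K => (0 : ℝ))
    (g := fun l => (qx d S (Function.update V l (insert i (V l))) (ε : ℂ)).re) (by simpa using h0)
  refine ⟨l, fun x hx => ?_⟩
  have hm := ratio_mono (fun t : ℝ => (qx d S (Function.update V l (insert i (V l))) t).re)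
    (fun t : ℝ => (qx d S V t).re) _ _ ε (DR S _) (DR S V) hGpos (by
      intro x hx
      exact lemR _ (qx d S V) _ _ x (D _ _ _) (D _ _ _) (qx_im hd _ _ _)
          (qx_im hd _ _ _) (fun y hy => qx_herm hd hk i S hS V hV l y hy))
  have h1 := hm (Set.mem_Ici.2 le_rfl) (Set.mem_Ici.2 hx) hx
  have h4 := (div_pos hl (hGpos ε le_rfl)).trans_le h1
  exact (div_pos_iff_of_pos_right (hGpos x hx)).1 h4

lemma greedy (hd : Good d) (hdf : ∀ V, Differentiable ℂ (fun x : ℂ => d V (fun _ => x)))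
    {k : ℕ} (hk : Fintype.card K = k + 1) (X ε : ℝ)
    (hp : ∀ V (x : ℝ), X ≤ x → 0 < dr d V (fun _ => x)) (S : List ι)
    (hS : S.Nodup) (V : K → Finset ι) (hV : ∀ m ∈ S, ∀ j, m ∉ V j)
    (h : ∀ x : ℝ, ε ≤ x → 0 < (qx d S V (x : ℂ)).re) :
    ∃ W : K → Finset ι, (∀ j, V j ⊆ W j) ∧ (∀ i ∈ S, ∃ j, i ∈ W j) ∧
      ∀ x : ℝ, ε ≤ x → 0 < (qx d [] W (x : ℂ)).re := by
  induction S generalizing V with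
  | nil => exact ⟨V, fun _ => subset_rfl, by simp, h⟩
  | cons i S ih =>
    obtain ⟨l, hl⟩ := greedy_step hd hdf hk X ε hp i S hS V hV h
    have hi := (List.nodup_cons.1 hS).1
    obtain ⟨W, W1, W2, W3⟩ := ih (List.nodup_cons.1 hS).2 _ (by
      intro m hm j
      have hmi : m ≠ i := fun h => hi (h ▸ hm)
      exact not_mem_upd hmi (hV m (List.mem_cons_of_mem _ hm)) l j) hl
    refine ⟨W, fun j => ?_, ?_, W3⟩
    · refine subset_trans ?_ (W1 j)
      by_cases hj : j = l
      · subst hj; simp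
      · simp [Function.update_of_ne hj]
    · intro m hm
      rcases List.mem_cons.1 hm with rfl | hm
      · exact ⟨l, W1 l (by simp)⟩
      · exact W2 m hm

lemma paving_abs [Fintype ι] (hd : Good d)
    (hdf : ∀ V, Differentiable ℂ (fun x : ℂ => d V (fun _ => x)))
    {k : ℕ} (hk : Fintype.card K = k + 1) (X ε : ℝ)
    (hp : ∀ V (x : ℝ), X ≤ x → 0 < dr d V (fun _ => x))
    (h : ∀ x : ℝ, ε ≤ x → 0 < Qr K d (Finset.univ : Finset ι).toList ∅ (fun _ => x)) :
    ∃ W : K → Finset ι, (∀ i, ∃ j, i ∈ W j) ∧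
      ∀ j, ∀ x : ℝ, ε ≤ x → d (W j) (fun _ => (x : ℂ)) ≠ 0 := by
  obtain ⟨W, -, W2, W3⟩ := greedy hd hdf hk X ε hp (Finset.univ : Finset ι).toList
    (Finset.nodup_toList _) (fun _ : K => ∅) (by simp) h
  refine ⟨W, fun i => W2 i (by simp), fun j x hx h0 => ?_⟩
  have := W3 x hx
  have h1 : qx d [] W (x : ℂ) = ∏ j, d (W j) (fun _ => (x : ℂ)) := rfl
  rw [h1, Finset.prod_eq_zero (Finset.mem_univ j) h0] at this
  simp at this
end KS
end

section
open Polynomial ComplexConjugate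

namespace KS
set_option linter.unusedSectionVars false
open scoped ComplexOrder
open Matrix
variable {ι : Type*} [DecidableEq ι] [Fintype ι]

def Am (A : Matrix ι ι ℂ) (V : Finset ι) : Matrix ι ι ℂ :=
  Matrix.of fun a b => if a ∈ V ∧ b ∈ V then A a b else 0

noncomputable def dg (V : Finset ι) (z : ι → ℂ) : ι → ℂ := fun a => if a ∈ V then z a else 1

noncomputable def mm (A : Matrix ι ι ℂ) (V : Finset ι) (z : ι → ℂ) : Matrix ι ι ℂ :=
  Matrix.diagonal (dg V z) - Am A V

noncomputable def dd (A : Matrix ι ι ℂ) (V : Finset ι) (z : ι → ℂ) : ℂ := (mm A V z).det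

lemma det_congr_row (N N' : Matrix ι ι ℂ) (i : ι) (h1 : N i = Pi.single i 1) (h2 : N' i = Pi.single i 1)
    (h : ∀ a b, b ≠ i → a ≠ i → N a b = N' a b) : N.det = N'.det := by
  rw [Matrix.det_apply, Matrix.det_apply]
  refine Finset.sum_congr rfl fun σ _ => ?_
  congr 1
  by_cases hσ : σ i = i
  · refine Finset.prod_congr rfl fun x _ => ?_
    by_cases hx : x = i
    · subst hx; rw [hσ, h1, h2]
    · refine h _ _ hx fun h3 => hx ?_
      rw [← hσ] at h3; exact σ.injective h3
  · have hne : σ.symm i ≠ i := fun h3 => hσ ((Equiv.symm_apply_eq σ).1 h3).symm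
    rw [Finset.prod_eq_zero (Finset.mem_univ (σ.symm i)), Finset.prod_eq_zero (Finset.mem_univ (σ.symm i))]
    · rw [Equiv.apply_symm_apply, h2, Pi.single_eq_of_ne hne]
    · rw [Equiv.apply_symm_apply, h1, Pi.single_eq_of_ne hne]

lemma dd_row (A : Matrix ι ι ℂ) (V : Finset ι) (i : ι) (z : ι → ℂ) (hi : i ∉ V) :
    ((mm A (insert i V) z).updateRow i (Pi.single i 1)).det = dd A V z := by
  refine det_congr_row _ _ i (by simp) ?_ ?_
  · funext b
    by_cases hb : b = i
    · subst hb; simp [mm, Am, dg, hi]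
    · simp [mm, Am, dg, hi, Pi.single_eq_of_ne hb, Matrix.diagonal_apply_ne' _ hb]
  · intro a b hb ha
    rw [Matrix.updateRow_ne ha]
    simp [mm, Am, dg, ha, hb, Matrix.diagonal_apply]

lemma dd_aff (A : Matrix ι ι ℂ) (V : Finset ι) (i : ι) (z : ι → ℂ) (τ : ℂ) (hi : i ∉ V) :
    dd A (insert i V) (z + Pi.single i τ) = dd A (insert i V) z + τ * dd A V z := by
  have h : mm A (insert i V) (z + Pi.single i τ) = (mm A (insert i V) z).updateRow i
      ((mm A (insert i V) z) i + τ • Pi.single i 1) := by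
    ext a b
    by_cases ha : a = i
    · subst ha
      rw [Matrix.updateRow_self]
      by_cases hb : a = b
      · subst hb; simp [mm, Am, dg]; ring
      · simp [mm, Am, dg, Matrix.diagonal_apply_ne _ hb, Pi.single_eq_of_ne (Ne.symm hb)]
    · rw [Matrix.updateRow_ne ha]
      simp [mm, Am, dg, Matrix.diagonal_apply, ha]
  rw [dd, h, Matrix.det_updateRow_add, Matrix.det_updateRow_smul, Matrix.updateRow_eq_self, dd_row A V i z hi]
  simp [dd]

lemma Am_herm {A : Matrix ι ι ℂ} (hA : A.IsHermitian) (V : Finset ι) : (Am A V).IsHermitian := by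
  ext a b
  simp only [Am, Matrix.conjTranspose_apply, Matrix.of_apply]
  have := hA.apply a b
  by_cases h : b ∈ V ∧ a ∈ V
  · simp [h.1, h.2, this]
  · rw [if_neg h, if_neg (fun h' => h h'.symm)]; simp

lemma Am_mulVec_out (A : Matrix ι ι ℂ) (V : Finset ι) (v : ι → ℂ) (a : ι) (ha : a ∉ V) :
    (Am A V *ᵥ v) a = 0 := by
  simp [Matrix.mulVec, dotProduct, Am, ha]

lemma mm_mulVec (A : Matrix ι ι ℂ) (V : Finset ι) (z v : ι → ℂ) (a : ι) :
    (mm A V z *ᵥ v) a = dg V z a * v a - (Am A V *ᵥ v) a := by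
  simp [mm, Matrix.sub_mulVec, Matrix.mulVec_diagonal]

lemma mm_out (A : Matrix ι ι ℂ) (V : Finset ι) (z v : ι → ℂ) (a : ι) (ha : a ∉ V) :
    (mm A V z *ᵥ v) a = v a := by
  rw [mm_mulVec, Am_mulVec_out A V v a ha]; simp [dg, ha]

lemma dd_stab {A : Matrix ι ι ℂ} (hA : A.IsHermitian) (V : Finset ι) (z : ι → ℂ)
    (hz : ∀ i, 0 < (z i).im) : dd A V z ≠ 0 := by
  intro h
  obtain ⟨v, hv, hMv⟩ := Matrix.exists_mulVec_eq_zero_iff.2 h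
  have hout : ∀ a, a ∉ V → v a = 0 := fun a ha => by
    rw [← mm_out A V z v a ha, hMv]; rfl
  have h1 : star v ⬝ᵥ (mm A V z *ᵥ v) = 0 := by rw [hMv]; simp
  have h2 := (Am_herm hA V).im_star_dotProduct_mulVec_self v
  rw [mm, Matrix.sub_mulVec, dotProduct_sub] at h1
  have h3 : (star v ⬝ᵥ (Matrix.diagonal (dg V z) *ᵥ v)).im = 0 := by
    rw [sub_eq_zero.1 h1]; exact h2
  have h4 : (star v ⬝ᵥ (Matrix.diagonal (dg V z) *ᵥ v)).im =
      ∑ a, (dg V z a).im * Complex.normSq (v a) := by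
    rw [dotProduct, Complex.im_sum]
    refine Finset.sum_congr rfl fun a _ => ?_
    rw [Matrix.mulVec_diagonal, Pi.star_apply]
    simp only [Complex.mul_im, Complex.mul_re, Complex.normSq_apply, RCLike.star_def, Complex.conj_re,
      Complex.conj_im]
    ring
  rw [h4] at h3
  have h5 := (Finset.sum_eq_zero_iff_of_nonneg (fun a _ => mul_nonneg (by
    by_cases ha : a ∈ V
    · simp [dg, ha, (hz a).le]
    · simp [dg, ha]) (Complex.normSq_nonneg _))).1 h3
  apply hv
  funext a
  by_cases ha : a ∈ V
  · have := h5 a (Finset.mem_univ a)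
    simp only [dg, ha, if_true] at this
    exact Complex.normSq_eq_zero.1 ((mul_eq_zero.1 this).resolve_left (hz a).ne')
  · exact hout a ha

lemma dd_good {A : Matrix ι ι ℂ} (hA : A.IsHermitian) : Good (dd A) where
  aff V i z τ hi := dd_aff A V i z τ hi
  indep V i z τ hi := by
    have : dg V (z + Pi.single i τ) = dg V z := by
      funext a
      by_cases ha : a ∈ V
      · have : a ≠ i := fun h => hi (h ▸ ha)
        simp [dg, Pi.single_eq_of_ne this]
      · simp [dg, ha]
    rw [dd, dd, mm, mm, this]
  stab V z hz := dd_stab hA V z hz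
  conjg V z := by
    have : mm A V (fun i => conj (z i)) = (mm A V z)ᴴ := by
      rw [mm, mm, Matrix.conjTranspose_sub, (Am_herm hA V).eq, Matrix.diagonal_conjTranspose]
      congr 2
      funext a
      by_cases ha : a ∈ V <;> simp [dg, ha]
    rw [dd, this, Matrix.det_conjTranspose]; rfl
  cont V := by
    unfold dd
    refine Continuous.matrix_det ?_
    unfold mm
    refine Continuous.sub (Continuous.matrix_diagonal ?_) continuous_const
    refine continuous_pi fun a => ?_
    by_cases ha : a ∈ V
    · simp only [dg, ha, if_true]; exact continuous_apply a
    · simp only [dg, ha, if_false]; exact continuous_const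

lemma dd_diff (A : Matrix ι ι ℂ) (V : Finset ι) : Differentiable ℂ (fun x : ℂ => dd A V (fun _ => x)) := by
  unfold dd
  simp only [Matrix.det_apply]
  refine Differentiable.fun_sum fun σ _ => ?_
  refine Differentiable.const_smul (Differentiable.fun_finsetProd fun a _ => ?_) _
  simp only [mm, Matrix.sub_apply, Matrix.diagonal_apply, dg]
  refine Differentiable.sub_const ?_ _
  split_ifs
  · exact differentiable_id
  · exact differentiable_const _
  · exact differentiable_const _

lemma Am_eq (A : Matrix ι ι ℂ) (V : Finset ι) :
    Am A V = Matrix.diagonal (dg V 1 - (fun a => if a ∈ V then 0 else 1)) * A *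
      Matrix.diagonal (dg V 1 - (fun a => if a ∈ V then 0 else 1)) := by
  ext a b
  rw [Matrix.mul_diagonal, Matrix.diagonal_mul]
  by_cases ha : a ∈ V <;> by_cases hb : b ∈ V <;> simp [Am, dg, ha, hb]

lemma Am_psd {B : Matrix ι ι ℂ} (hB : B.PosSemidef) (V : Finset ι) : (Am B V).PosSemidef := by
  rw [Am_eq]
  have := hB.mul_mul_conjTranspose_same (Matrix.diagonal (dg V 1 - (fun a => if a ∈ V then 0 else 1)))
  rw [Matrix.diagonal_conjTranspose] at this
  have hs : star (dg V 1 - (fun a => if a ∈ V then 0 else 1)) =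
      (dg V 1 - (fun a => if a ∈ V then 0 else 1)) := by
    funext a
    by_cases ha : a ∈ V <;> simp [dg, ha]
  rw [hs] at this
  exact this

lemma mm_posDef {A : Matrix ι ι ℂ} (hA : (1 - A).PosSemidef) (V : Finset ι) (y : ι → ℝ)
    (hy : ∀ a, 1 < y a) : (mm A V (fun a => (y a : ℂ))).PosDef := by
  have h1 : mm A V (fun a => (y a : ℂ)) =
      Matrix.diagonal (fun a => if a ∈ V then ((y a - 1 : ℝ) : ℂ) else 1) + Am (1 - A) V := by
    ext a b
    by_cases ha : a ∈ V <;> by_cases hb : b ∈ V <;> by_cases hab : a = b <;>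
      (try subst hab) <;> simp_all [mm, Am, dg, Matrix.diagonal_apply]
  rw [h1]
  refine Matrix.PosDef.add_posSemidef (Matrix.PosDef.diagonal fun a => ?_) (Am_psd hA V)
  by_cases ha : a ∈ V
  · simp only [ha, if_true]
    exact_mod_cast sub_pos.2 (hy a)
  · simp [ha]

lemma dr_pos {A : Matrix ι ι ℂ} (hA : (1 - A).PosSemidef) (V : Finset ι) (y : ι → ℝ)
    (hy : ∀ a, 1 < y a) : 0 < dr (dd A) V y :=
  (Complex.lt_def.1 (mm_posDef hA V y hy).det_pos).1

end KS
end

section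
open Polynomial ComplexConjugate

namespace KS
set_option linter.unusedSectionVars false
open scoped ComplexOrder
open Matrix
variable {ι : Type*} [DecidableEq ι] [Fintype ι]

lemma psd_W (T : Matrix ι ι ℂ) (h1 : (1 - T).PosSemidef) (h2 : (1 + T).PosSemidef) (b : ℝ) (hb : 1 ≤ b) :
    (((b : ℂ) • 1 - T) * (1 - T * T)).PosSemidef := by
  have e1 := h2.mul_mul_conjTranspose_same (1 - T)
  have e2 := h1.mul_mul_conjTranspose_same (1 + T)
  rw [h1.1.eq] at e1
  rw [h2.1.eq] at e2
  have e3 : ((((b - 1) / 2 : ℝ) : ℂ) • ((1 - T) * (1 + T) * (1 - T) + (1 + T) * (1 - T) * (1 + T))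
      + (1 - T) * (1 + T) * (1 - T)).PosSemidef := by
    refine Matrix.PosSemidef.add (Matrix.PosSemidef.smul (e1.add e2) ?_) e1
    exact_mod_cast (by linarith : (0 : ℝ) ≤ (b - 1) / 2)
  convert e3 using 1
  have e4 : (1 - T) * (1 + T) * (1 - T) + (1 + T) * (1 - T) * (1 + T) = (2 : ℂ) • (1 - T * T) := by
    rw [two_smul]; noncomm_ring
  have e5 : (1 - T) * (1 + T) * (1 - T) = (1 - T) * (1 - T * T) := by noncomm_ring
  rw [e4, e5, smul_smul]
  have e6 : (((b - 1) / 2 : ℝ) : ℂ) * 2 = (b : ℂ) - 1 := by push_cast; ring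
  rw [e6, sub_smul, one_smul]
  rw [sub_mul, sub_mul, smul_mul_assoc, one_mul]
  abel

lemma Am_one_sub {A : Matrix ι ι ℂ} (h : (1 - A).PosSemidef) (V : Finset ι) : (1 - Am A V).PosSemidef := by
  have h1 : 1 - Am A V = Matrix.diagonal (fun a => if a ∈ V then (0 : ℂ) else 1) + Am (1 - A) V := by
    ext a b
    by_cases ha : a ∈ V <;> by_cases hb : b ∈ V <;> by_cases hab : a = b <;>
      (try subst hab) <;> simp_all [Am]
  rw [h1]
  refine (Matrix.PosSemidef.diagonal fun a => ?_).add (Am_psd h V)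
  by_cases ha : a ∈ V <;> simp [ha]

lemma Am_neg (A : Matrix ι ι ℂ) (V : Finset ι) : Am (-A) V = - Am A V := by
  ext a b
  by_cases ha : a ∈ V <;> by_cases hb : b ∈ V <;> simp [Am, ha, hb]

lemma dr_ratio {A : Matrix ι ι ℂ} (hA : A.IsHermitian) (h0 : ∀ i, A i i = 0)
    (h1 : (1 - A).PosSemidef) (h2 : (1 + A).PosSemidef) (b : ℝ) (hb : 1 < b) (i : ι) (U : Finset ι)
    (hi : i ∉ U) :
    dr (dd A) U (fun _ => b) ≤ b / (b ^ 2 - 1) * dr (dd A) (insert i U) (fun _ => b) := by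
  set V := insert i U with hV
  set T := Am A V with hT
  set D := dr (dd A) V (fun _ => b) with hD
  have hDpos : 0 < D := dr_pos h1 V _ fun _ => hb
  have hDe : (mm A V (fun _ => (b : ℂ))).det = (D : ℂ) := dr_eq (dd_good hA) V (fun _ => b)
  set v := (mm A V (fun _ => (b : ℂ))).adjugate *ᵥ (Pi.single i 1) with hv
  have hMv : mm A V (fun _ => (b : ℂ)) *ᵥ v = (D : ℂ) • (Pi.single i 1) := by
    rw [hv, Matrix.mulVec_mulVec, Matrix.mul_adjugate, hDe, Matrix.smul_mulVec, Matrix.one_mulVec]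
  have hvi : v i = (dr (dd A) U (fun _ => b) : ℂ) := by
    rw [hv, Matrix.mulVec_single_one, Matrix.col_apply, Matrix.adjugate_apply, dd_row A U i _ hi]
    exact dr_eq (dd_good hA) U (fun _ => b)
  have hout : ∀ a, a ∉ V → v a = 0 := fun a ha => by
    rw [← mm_out A V (fun _ => (b : ℂ)) v a ha, hMv]
    have : a ≠ i := by rintro rfl; exact ha (by simp [hV])
    simp [Pi.single_eq_of_ne this]
  have hTv : ((b : ℂ) • 1 - T) *ᵥ v = (D : ℂ) • (Pi.single i 1) := by
    rw [← hMv]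
    funext a
    rw [mm_mulVec, Matrix.sub_mulVec, Matrix.smul_mulVec, Matrix.one_mulVec]
    by_cases ha : a ∈ V
    · simp [dg, ha, hT]
    · simp [dg, ha, hT, hout a ha]
  have hpsd := psd_W T (Am_one_sub h1 V) (by
    have : (1 - (-A)).PosSemidef := by rwa [sub_neg_eq_add]
    have := Am_one_sub this V
    rwa [Am_neg, sub_neg_eq_add] at this) b hb.le
  have hq := hpsd.re_dotProduct_nonneg v
  have hh : (((b : ℂ) • 1 - T))ᴴ = (b : ℂ) • 1 - T := by
    rw [Matrix.conjTranspose_sub, Matrix.conjTranspose_smul, Matrix.conjTranspose_one, (Am_herm hA V).eq]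
    simp [hT]
  have hW : ((b : ℂ) • 1 - T) * (1 - T * T) =
      ((b : ℂ) • 1 - T) * (((b : ℂ) • 1 + T) * ((b : ℂ) • 1 - T))
        - ((b : ℂ) ^ 2 - 1) • ((b : ℂ) • 1 - T) := by
    have : ((b : ℂ) • 1 + T) * ((b : ℂ) • 1 - T) = (b : ℂ) ^ 2 • 1 - T * T := by
      rw [add_mul, mul_sub, mul_sub]
      simp only [smul_mul_assoc, mul_smul_comm, one_mul, mul_one, smul_smul, sq]
      abel
    rw [this]
    have h3 : ((b : ℂ) ^ 2 - 1) • ((b : ℂ) • 1 - T) =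
      ((b : ℂ) • 1 - T) * (((b : ℂ) ^ 2 - 1) • 1) := by
      rw [mul_smul_comm, mul_one]
    rw [h3, ← mul_sub, sub_smul]
    congr 1
    rw [one_smul]; abel
  rw [hW, Matrix.sub_mulVec, dotProduct_sub, ← Matrix.mulVec_mulVec, Matrix.smul_mulVec,
    dotProduct_smul, ← Matrix.mulVec_mulVec, hTv] at hq
  rw [Matrix.dotProduct_mulVec (star v), ← hh, ← Matrix.star_mulVec, hTv] at hq
  have hTi : T i i = 0 := by simp [hT, Am, h0]
  have t1 : star ((D : ℂ) • (Pi.single i 1 : ι → ℂ)) ⬝ᵥ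
      (((b : ℂ) • 1 + T) *ᵥ ((D : ℂ) • (Pi.single i 1 : ι → ℂ))) = ((D ^ 2 * b : ℝ) : ℂ) := by
    rw [star_smul, smul_dotProduct, Matrix.mulVec_smul, dotProduct_smul, ← Pi.single_star,
      star_one, single_one_dotProduct, Matrix.mulVec_single_one, Matrix.col_apply]
    simp [hTi]; ring
  have t2 : star v ⬝ᵥ ((D : ℂ) • (Pi.single i 1 : ι → ℂ)) =
      ((D * dr (dd A) U (fun _ => b) : ℝ) : ℂ) := by
    rw [dotProduct_smul, dotProduct_single_one, Pi.star_apply, hvi]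
    simp
  rw [t1, t2] at hq
  have t3 : ((b : ℂ) ^ 2 - 1) • ((D * dr (dd A) U (fun _ => b) : ℝ) : ℂ) =
    (((b ^ 2 - 1) * (D * dr (dd A) U (fun _ => b)) : ℝ) : ℂ) := by
    rw [smul_eq_mul]; push_cast; ring
  rw [t3, ← Complex.ofReal_sub] at hq
  have hq' : 0 ≤ D ^ 2 * b - (b ^ 2 - 1) * (D * dr (dd A) U (fun _ => b)) := hq
  have hb2 : 0 < b ^ 2 - 1 := by nlinarith
  rw [div_mul_eq_mul_div, le_div_iff₀ hb2]
  refine le_of_mul_le_mul_left ?_ hDpos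
  nlinarith

lemma quad_le {A : Matrix ι ι ℂ} (hA : A.IsHermitian) (W : Finset ι) (ε : ℝ) (hε : 0 < ε)
    (h : ∀ x : ℝ, ε ≤ x → dd A W (fun _ => (x : ℂ)) ≠ 0) (v : ι → ℂ) (hv : ∀ a, a ∉ W → v a = 0) :
    (star v ⬝ᵥ (A *ᵥ v)).re ≤ ε * (star v ⬝ᵥ v).re := by
  have hT := Am_herm hA W
  have hH : ((ε : ℂ) • 1 - Am A W).IsHermitian := by
    refine Matrix.IsHermitian.sub ?_ hT
    rw [Matrix.IsHermitian, Matrix.conjTranspose_smul, Matrix.conjTranspose_one]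
    simp
  have hpsd : ((ε : ℂ) • 1 - Am A W).PosSemidef := by
    rw [hH.posSemidef_iff_eigenvalues_nonneg]
    intro j
    by_contra hcon
    have hneg : hH.eigenvalues j < 0 := by simpa using hcon
    have he := hH.mulVec_eigenvectorBasis j
    set u : ι → ℂ := ⇑(hH.eigenvectorBasis j) with hu
    set μ := hH.eigenvalues j with hμ
    have hu0 : u ≠ 0 := by
      intro h0
      have h3 := hH.eigenvectorBasis.orthonormal.ne_zero j
      apply h3
      ext a
      exact congrFun h0 a
    have hTu : ∀ a, (Am A W *ᵥ u) a = ((ε - μ : ℝ) : ℂ) * u a := by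
      intro a
      have := congrFun he a
      rw [Matrix.sub_mulVec, Matrix.smul_mulVec, Matrix.one_mulVec] at this
      simp only [Pi.sub_apply, Pi.smul_apply, smul_eq_mul, Complex.real_smul] at this
      push_cast
      linear_combination -this
    have hne : ((ε - μ : ℝ) : ℂ) ≠ 0 := by
      rw [Ne, Complex.ofReal_eq_zero]; linarith
    apply h (ε - μ) (by linarith)
    refine Matrix.exists_mulVec_eq_zero_iff.1 ⟨u, hu0, ?_⟩
    funext a
    by_cases ha : a ∈ W
    · rw [mm_mulVec, hTu]; simp [dg, ha]
    · rw [mm_out A W _ u a ha]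
      have := hTu a
      rw [Am_mulVec_out A W u a ha] at this
      exact (mul_eq_zero.1 this.symm).resolve_left hne
  have hq := hpsd.re_dotProduct_nonneg v
  rw [Matrix.sub_mulVec, Matrix.smul_mulVec, Matrix.one_mulVec, dotProduct_sub, dotProduct_smul] at hq
  have h3 : star v ⬝ᵥ (Am A W *ᵥ v) = star v ⬝ᵥ (A *ᵥ v) := by
    simp only [dotProduct, Matrix.mulVec, Finset.mul_sum]
    refine Finset.sum_congr rfl fun a _ => Finset.sum_congr rfl fun b _ => ?_
    by_cases ha : a ∈ W
    · by_cases hb : b ∈ W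
      · simp [Am, ha, hb]
      · simp [hv b hb]
    · simp [hv a ha]
  rw [h3] at hq
  have hq' : 0 ≤ ((ε : ℂ) • (star v ⬝ᵥ v) - star v ⬝ᵥ (A *ᵥ v)).re := hq
  rw [Complex.sub_re, smul_eq_mul, Complex.re_ofReal_mul] at hq'
  linarith

end KS
end

section
open Polynomial ComplexConjugate

namespace KS
set_option linter.unusedSectionVars false
open scoped ComplexOrder
open Matrix
variable {ι : Type*} [DecidableEq ι] [Fintype ι]

lemma onesided (ε : ℝ) (hε : 0 < ε) (hε1 : ε ≤ 1) (k : ℕ) (hk : 8 / ε ^ 2 ≤ k + 1)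
    (A : Matrix ι ι ℂ) (hA : A.IsHermitian) (h0 : ∀ i, A i i = 0)
    (h1 : (1 - A).PosSemidef) (h2 : (1 + A).PosSemidef) :
    ∃ P : ι → Fin (k + 1), ∀ j, ∀ v : ι → ℂ, (∀ a, P a ≠ j → v a = 0) →
      (star v ⬝ᵥ (A *ᵥ v)).re ≤ ε * (star v ⬝ᵥ v).re := by
  have hk8 : 8 ≤ ((k : ℝ) + 1) * ε ^ 2 := by
    rwa [div_le_iff₀ (by positivity)] at hk
  have hk1 : 1 ≤ k := by
    have : ε ^ 2 ≤ 1 := by nlinarith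
    have h3 : (8 : ℝ) ≤ k + 1 := by
      have : (0 : ℝ) ≤ k + 1 := by positivity
      nlinarith
    have : (1 : ℝ) ≤ k := by linarith
    exact_mod_cast this
  have hd := dd_good hA
  obtain ⟨W, W1, W2⟩ := paving_abs (K := Fin (k + 1)) hd (dd_diff A) (k := k) (by simp) 2 ε
    (fun V x hx => dr_pos h1 V _ fun _ => by linarith) (by
      intro x hx
      set s := 2 / ε + x - ε with hs
      have hse : 2 / ε ≤ s := by linarith
      have hse' : 2 ≤ s * ε := by rwa [div_le_iff₀ hε] at hse
      have hs1 : 1 < s := by nlinarith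
      have hs2 : 0 < s ^ 2 - 1 := by nlinarith
      refine barrier_end hd (by simp) hk1 (s / (s ^ 2 - 1)) s x (by positivity) ?_
        (fun U y hy => dr_pos h1 U y fun a => lt_of_lt_of_le hs1 (hy a))
        (fun j U hj => dr_ratio hA h0 h1 h2 s hs1 j U hj)
      have e1 : ((k : ℝ) + 1) * (s - x) * ((k + 1) * (s / (s ^ 2 - 1))) =
          ((k : ℝ) + 1) ^ 2 * ((2 / ε - ε) * s) / (s ^ 2 - 1) := by
        rw [hs]; ring
      rw [e1, div_le_iff₀ hs2]
      have e2 : (2 / ε - ε) * s ≤ (1 - ε ^ 2 / 4) * (s ^ 2 - 1) := by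
        have e3 : 2 / ε * s ≤ s ^ 2 := by
          rw [sq]; exact mul_le_mul_of_nonneg_right hse (by linarith)
        have e4 : (1 - ε ^ 2 / 4) * (2 / ε * s) ≤ (1 - ε ^ 2 / 4) * s ^ 2 :=
          mul_le_mul_of_nonneg_left e3 (by nlinarith)
        have e5 : (1 - ε ^ 2 / 4) * (2 / ε * s) = 2 / ε * s - ε / 2 * s := by
          field_simp; ring
        nlinarith
      have e6 : ((k : ℝ) + 1) ^ 2 * (1 - ε ^ 2 / 4) ≤ k ^ 2 := by
        nlinarith
      calc ((k : ℝ) + 1) ^ 2 * ((2 / ε - ε) * s)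
          ≤ ((k : ℝ) + 1) ^ 2 * ((1 - ε ^ 2 / 4) * (s ^ 2 - 1)) :=
            mul_le_mul_of_nonneg_left e2 (by positivity)
        _ = (((k : ℝ) + 1) ^ 2 * (1 - ε ^ 2 / 4)) * (s ^ 2 - 1) := by ring
        _ ≤ _ := mul_le_mul_of_nonneg_right e6 hs2.le)
  choose P hP using W1
  refine ⟨P, fun j v hv => quad_le hA (W j) ε hε (W2 j) v fun a ha => hv a ?_⟩
  rintro rfl
  exact ha (hP a)

lemma numrad {E : Type*} [NormedAddCommGroup E] [InnerProductSpace ℂ E] (T : E →L[ℂ] E) (w : ℝ)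
    (hw : 0 ≤ w) (h : ∀ x, ‖inner ℂ (T x) x‖ ≤ w * ‖x‖ ^ 2) : ‖T‖ ≤ 2 * w := by
  have key : ∀ x y, ‖inner ℂ (T y) x‖ ≤ w * (‖x‖ ^ 2 + ‖y‖ ^ 2) := by
    intro x y
    have hp := inner_map_polarization (T : E →ₗ[ℂ] E) x y
    simp only [ContinuousLinearMap.coe_coe] at hp
    rw [hp, norm_div]
    have p1 := parallelogram_law_with_norm ℂ x y
    have p2 := parallelogram_law_with_norm ℂ x (Complex.I • y)
    have hI : ‖Complex.I • y‖ = ‖y‖ := by rw [norm_smul]; simp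
    rw [hI] at p2
    have a1 := h (x + y)
    have a2 := h (x - y)
    have a3 := h (x + Complex.I • y)
    have a4 := h (x - Complex.I • y)
    have n4 : ‖(4 : ℂ)‖ = 4 := by simp
    rw [n4, div_le_iff₀ (by norm_num)]
    refine (norm_sub_le _ _).trans ?_
    have b1 := norm_add_le (inner ℂ (T (x + y)) (x + y) - inner ℂ (T (x - y)) (x - y))
      (Complex.I * inner ℂ (T (x + Complex.I • y)) (x + Complex.I • y))
    have b2 := norm_sub_le (inner ℂ (T (x + y)) (x + y)) (inner ℂ (T (x - y)) (x - y))
    rw [norm_mul, Complex.norm_I, one_mul] at b1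
    rw [norm_mul, Complex.norm_I, one_mul]
    nlinarith
  refine ContinuousLinearMap.opNorm_le_bound _ (by linarith) fun y => ?_
  by_cases hT : T y = 0
  · rw [hT, norm_zero]; positivity
  have hTp : 0 < ‖T y‖ := norm_pos_iff.2 hT
  by_cases hy : y = 0
  · subst hy; simp
  have hyp : 0 < ‖y‖ := norm_pos_iff.2 hy
  have := key (((‖y‖ / ‖T y‖ : ℝ) : ℂ) • T y) y
  rw [inner_smul_right, norm_mul, inner_self_eq_norm_sq_to_K, norm_smul, Complex.norm_real,
    Real.norm_of_nonneg (by positivity), div_mul_cancel₀ _ hTp.ne'] at this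
  have h3 : ‖((‖T y‖ : ℝ) : ℂ) ^ 2‖ = ‖T y‖ ^ 2 := by
    rw [norm_pow, Complex.norm_real, norm_norm]
  have h4 : ‖y‖ / ‖T y‖ * ‖T y‖ ^ 2 = ‖y‖ * ‖T y‖ := by field_simp
  have h5 : ‖y‖ * ‖T y‖ ≤ w * (‖y‖ ^ 2 + ‖y‖ ^ 2) := by
    rw [← h4, ← h3]; exact this
  nlinarith

lemma inner_mat (B : Matrix ι ι ℂ) (x : EuclideanSpace ℂ ι) :
    ‖inner ℂ (Matrix.toEuclideanCLM (𝕜 := ℂ) B x) x‖ =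
      ‖star (x.ofLp) ⬝ᵥ (B *ᵥ x.ofLp)‖ := by
  rw [← inner_conj_symm, RCLike.norm_conj, EuclideanSpace.inner_eq_star_dotProduct, dotProduct_comm]
  rfl

lemma norm_dot (x : EuclideanSpace ℂ ι) : (star (x.ofLp) ⬝ᵥ x.ofLp).re = ‖x‖ ^ 2 := by
  rw [dotProduct_comm, ← EuclideanSpace.inner_eq_star_dotProduct]
  exact inner_self_eq_norm_sq (𝕜 := ℂ) x

noncomputable def Hc (A : Matrix ι ι ℂ) (c : ℂ) : Matrix ι ι ℂ := (1 / 2 : ℂ) • (c • A + (c • A)ᴴ)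

lemma Hc_herm (A : Matrix ι ι ℂ) (c : ℂ) : (Hc A c).IsHermitian := by
  rw [Matrix.IsHermitian, Hc, Matrix.conjTranspose_smul, Matrix.conjTranspose_add,
    Matrix.conjTranspose_conjTranspose, add_comm]
  simp

lemma Hc_quad (A : Matrix ι ι ℂ) (c : ℂ) (v : ι → ℂ) :
    star v ⬝ᵥ (Hc A c *ᵥ v) = ((c * (star v ⬝ᵥ (A *ᵥ v))).re : ℂ) := by
  have h1 : star v ⬝ᵥ ((c • A)ᴴ *ᵥ v) = conj (c * (star v ⬝ᵥ (A *ᵥ v))) := by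
    rw [Matrix.dotProduct_mulVec, ← Matrix.star_mulVec, Matrix.star_dotProduct,
      Matrix.smul_mulVec, dotProduct_smul, smul_eq_mul]
    rfl
  rw [Hc, Matrix.smul_mulVec, Matrix.add_mulVec, dotProduct_smul, dotProduct_add, h1,
    Matrix.smul_mulVec, dotProduct_smul, smul_eq_mul, smul_eq_mul, Complex.add_conj]
  push_cast; ring

lemma Hc_psd (A : Matrix ι ι ℂ) (hA : specNorm A ≤ 1) (c : ℂ) (hc : ‖c‖ = 1) :
    (1 - Hc A c).PosSemidef := by
  refine Matrix.PosSemidef.of_dotProduct_mulVec_nonneg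
    (Matrix.IsHermitian.sub Matrix.isHermitian_one (Hc_herm A c)) fun v => ?_
  rw [Matrix.sub_mulVec, Matrix.one_mulVec, dotProduct_sub, Hc_quad]
  set x : EuclideanSpace ℂ ι := WithLp.toLp 2 v with hx
  have h1 : (c * (star v ⬝ᵥ (A *ᵥ v))).re ≤ (star v ⬝ᵥ v).re := by
    refine (Complex.re_le_norm _).trans ?_
    rw [norm_mul, hc, one_mul]
    have h2 := inner_mat A x
    have h3 := norm_dot x
    simp only [hx] at h2 h3
    rw [h3, ← h2]
    refine (norm_inner_le_norm _ _).trans ?_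
    have h4 := (Matrix.toEuclideanCLM (𝕜 := ℂ) A).le_opNorm x
    have h5 : ‖Matrix.toEuclideanCLM (𝕜 := ℂ) A‖ ≤ 1 := hA
    have h6 := mul_le_mul_of_nonneg_right h5 (norm_nonneg x)
    nlinarith [norm_nonneg x]
  have h2 : star v ⬝ᵥ v = ((star v ⬝ᵥ v).re : ℂ) := by
    have : (0 : ℂ) ≤ star v ⬝ᵥ v := dotProduct_star_self_nonneg v
    rw [Complex.le_def] at this
    apply Complex.ext
    · simp
    · simpa using this.2.symm
  rw [h2, ← Complex.ofReal_sub]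
  exact_mod_cast sub_nonneg.2 h1

lemma Hc_neg (A : Matrix ι ι ℂ) (c : ℂ) : Hc A (-c) = - Hc A c := by
  simp only [Hc, neg_smul, Matrix.conjTranspose_neg, smul_add, smul_neg]
  abel

lemma final (ε : ℝ) (hε : 0 < ε) (hε1 : ε ≤ 1) (k : ℕ) (hk : 8 / ε ^ 2 ≤ k + 1)
    (A : Matrix ι ι ℂ) (h0 : ∀ i, A i i = 0) (hA : specNorm A ≤ 1) :
    ∃ P : ι → (Fin 4 → Fin (k + 1)), ∀ j, ∀ v : ι → ℂ, (∀ a, P a ≠ j → v a = 0) →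
      ‖star v ⬝ᵥ (A *ᵥ v)‖ ≤ 2 * ε * (star v ⬝ᵥ v).re := by
  have key : ∀ c : ℂ, ‖c‖ = 1 → ∃ P : ι → Fin (k + 1), ∀ j, ∀ v : ι → ℂ, (∀ a, P a ≠ j → v a = 0) →
      (c * (star v ⬝ᵥ (A *ᵥ v))).re ≤ ε * (star v ⬝ᵥ v).re := by
    intro c hc
    obtain ⟨P, hP⟩ := onesided ε hε hε1 k hk (Hc A c) (Hc_herm A c) (by simp [Hc, h0])
      (Hc_psd A hA c hc) (by
        have := Hc_psd A hA (-c) (by rwa [norm_neg])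
        rwa [Hc_neg, sub_neg_eq_add] at this)
    refine ⟨P, fun j v hv => ?_⟩
    have := hP j v hv
    rwa [Hc_quad, Complex.ofReal_re] at this
  obtain ⟨P1, h1⟩ := key 1 (by simp)
  obtain ⟨P2, h2⟩ := key (-1) (by simp)
  obtain ⟨P3, h3⟩ := key Complex.I (by simp)
  obtain ⟨P4, h4⟩ := key (-Complex.I) (by simp)
  refine ⟨fun a => ![P1 a, P2 a, P3 a, P4 a], fun j v hv => ?_⟩
  have a1 := h1 (j 0) v fun a ha => hv a fun h => ha (by rw [← h]; rfl)
  have a2 := h2 (j 1) v fun a ha => hv a fun h => ha (by rw [← h]; rfl)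
  have a3 := h3 (j 2) v fun a ha => hv a fun h => ha (by rw [← h]; rfl)
  have a4 := h4 (j 3) v fun a ha => hv a fun h => ha (by rw [← h]; rfl)
  set w := star v ⬝ᵥ (A *ᵥ v)
  simp only [one_mul, neg_mul, Complex.neg_re, Complex.I_mul_re, neg_neg] at a1 a2 a3 a4
  have := Complex.norm_le_abs_re_add_abs_im w
  have r1 : |w.re| ≤ ε * (star v ⬝ᵥ v).re := abs_le.2 ⟨by linarith, a1⟩
  have r2 : |w.im| ≤ ε * (star v ⬝ᵥ v).re := abs_le.2 ⟨by linarith, a4⟩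
  linarith

lemma sub_norm (A : Matrix ι ι ℂ) (p : ι → Prop) [DecidablePred p] (w : ℝ) (hw : 0 ≤ w)
    (h : ∀ v : ι → ℂ, (∀ a, ¬ p a → v a = 0) → ‖star v ⬝ᵥ (A *ᵥ v)‖ ≤ w * (star v ⬝ᵥ v).re) :
    specNorm (A.submatrix (fun x : {j : ι // p j} => (x : ι)) (fun x : {j : ι // p j} => (x : ι)))
      ≤ 2 * w := by
  refine numrad _ w hw fun x => ?_
  rw [inner_mat, ← norm_dot]
  set v : ι → ℂ := fun a => if h : p a then x.ofLp ⟨a, h⟩ else 0 with hv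
  have hsum : ∀ f : ι → ℂ, (∀ a, ¬ p a → f a = 0) → ∑ a : {j : ι // p j}, f a = ∑ a, f a := by
    intro f hf
    refine Fintype.sum_of_injective (Subtype.val) Subtype.val_injective _ _ ?_ (fun _ => rfl)
    intro a ha
    exact hf a fun h => ha ⟨⟨a, h⟩, rfl⟩
  have hv0 : ∀ a, ¬ p a → v a = 0 := fun a ha => by simp [hv, ha]
  have hvs : ∀ a : {j : ι // p j}, x.ofLp a = v a := fun a => by simp [hv, a.2]
  have e1 : star x.ofLp ⬝ᵥ x.ofLp = star v ⬝ᵥ v := by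
    simp only [dotProduct, Pi.star_apply]
    rw [← hsum _ (fun a ha => by rw [hv0 a ha, mul_zero])]
    exact Finset.sum_congr rfl fun a _ => by rw [hvs]
  have e2 : star x.ofLp ⬝ᵥ ((A.submatrix (fun x : {j : ι // p j} => (x : ι))
      (fun x : {j : ι // p j} => (x : ι))) *ᵥ x.ofLp) = star v ⬝ᵥ (A *ᵥ v) := by
    simp only [dotProduct, Pi.star_apply, Matrix.mulVec]
    rw [← hsum _ (fun a ha => by rw [hv0 a ha, star_zero, zero_mul])]
    refine Finset.sum_congr rfl fun a _ => ?_
    rw [hvs, ← hsum _ (fun a ha => by rw [hv0 a ha, mul_zero])]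
    congr 1
    exact Finset.sum_congr rfl fun b _ => by rw [hvs]; rfl
  rw [e1, e2]
  exact h v hv0

end KS
end

/-- Marcus–Spielman–Srivastava (solution of the Kadison–Singer problem):
for every `ε > 0` there is `k` such that every zero-diagonal complex matrix of
spectral norm at most 1 admits a partition of its index set into `k` parts on each of
which the principal submatrix has spectral norm at most `ε`. -/
theorem kadison_singer_partition (ε : ℝ) (hε : 0 < ε) :
    ∃ k : ℕ, 0 < k ∧
      ∀ (n : ℕ) (A : Matrix (Fin n) (Fin n) ℂ),
        (∀ i, A i i = 0) → specNorm A ≤ 1 →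
        ∃ P : Fin n → Fin k,
          ∀ i : Fin k,
            specNorm (A.submatrix (fun x : {j : Fin n // P j = i} => (x : Fin n))
              (fun x : {j : Fin n // P j = i} => (x : Fin n))) ≤ ε := by
  obtain ⟨δ, hδ0, hδ1, hδε⟩ : ∃ δ : ℝ, 0 < δ ∧ δ ≤ 1 ∧ 2 * (2 * δ) ≤ ε :=
    ⟨min (ε / 4) 1, by positivity, min_le_right _ _, by linarith [min_le_left (ε / 4) 1]⟩
  obtain ⟨m, hm⟩ := exists_nat_ge (8 / δ ^ 2)
  refine ⟨Fintype.card (Fin 4 → Fin (m + 1)), Fintype.card_pos, fun n A h0 hA => ?_⟩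
  obtain ⟨P, hP⟩ := KS.final δ hδ0 hδ1 m (by linarith) A h0 hA
  refine ⟨fun a => Fintype.equivFin _ (P a), fun i => le_trans ?_ hδε⟩
  refine KS.sub_norm A _ (2 * δ) (by positivity) fun v hv => ?_
  refine hP ((Fintype.equivFin _).symm i) v fun a ha => hv a fun h => ha ?_
  rw [← h, Equiv.symm_apply_apply]
end

section
/- For every ε > 0 there exists a positive integer k = k(ε) such that the following holds: for every n ≥ 1 and every n×n complex matrix A with all diagonal entries equal to zero and spectral norm at most 1, there exists a subset S ⊆ {1, 2, …, n} with |S| ≥ n/k such that the principal submatrix of A with rows and columns indexed by S has spectral norm at most ε. -/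
section RI
open Matrix
open scoped ComplexOrder

lemma ri_schur {m : Type} [Fintype m] [DecidableEq m] (M : Matrix m m ℂ) (hM : M.PosDef)
    (b : Matrix m Unit ℂ) (d : ℝ) (hq : ((bᴴ * M⁻¹ * b) () ()).re < d) :
    (fromBlocks M b bᴴ ((d : ℂ) • (1 : Matrix Unit Unit ℂ))).PosDef ∧
    (trace (fromBlocks M b bᴴ ((d : ℂ) • (1 : Matrix Unit Unit ℂ)))⁻¹).re =
      (trace M⁻¹).re + (1 + ((bᴴ * (M⁻¹ * M⁻¹) * b) () ()).re) /
        (d - ((bᴴ * M⁻¹ * b) () ()).re) := by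
  have hR : M⁻¹.PosDef := hM.inv
  set R := M⁻¹ with hRdef
  have hMR : M * R = 1 := mul_nonsing_inv _ ((isUnit_iff_isUnit_det _).1 hM.isUnit)
  have hherm : (bᴴ * R * b).IsHermitian := (hR.posSemidef.conjTranspose_mul_mul_same b).1
  set q := ((bᴴ * R * b) () ()).re with hqdef
  have hqC : (bᴴ * R * b) = (q : ℂ) • (1 : Matrix Unit Unit ℂ) := by
    ext i j
    have h1 := hherm.apply () ()
    have : ((q : ℝ) : ℂ) = (bᴴ * R * b) () () := Complex.conj_eq_iff_re.1 h1
    simp [this]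
  set σ : ℝ := d - q with hσ
  have hσ0 : 0 < σ := by rw [hσ]; linarith
  have hσC : (σ : ℂ) ≠ 0 := by exact_mod_cast hσ0.ne'
  have hdσ : (d : ℂ) = σ + q := by rw [hσ]; push_cast; ring
  set N := fromBlocks M b bᴴ ((d : ℂ) • (1 : Matrix Unit Unit ℂ)) with hN
  set X := fromBlocks (R + (σ : ℂ)⁻¹ • (R * b * (bᴴ * R))) (-((σ : ℂ)⁻¹ • (R * b)))
    (-((σ : ℂ)⁻¹ • (bᴴ * R))) ((σ : ℂ)⁻¹ • (1 : Matrix Unit Unit ℂ)) with hX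
  have hNX : N * X = 1 := by
    rw [hN, hX, fromBlocks_multiply, ← fromBlocks_one]
    congr 1
    · rw [Matrix.mul_add, hMR, Matrix.mul_smul, ← Matrix.mul_assoc, ← Matrix.mul_assoc M, hMR,
        Matrix.one_mul, Matrix.mul_neg, Matrix.mul_smul]
      abel
    · rw [Matrix.mul_neg, Matrix.mul_smul, ← Matrix.mul_assoc, hMR, Matrix.mul_smul]
      simp
    · rw [Matrix.mul_add, Matrix.mul_smul, ← Matrix.mul_assoc bᴴ, ← Matrix.mul_assoc bᴴ, hqC,
        Matrix.smul_mul, Matrix.one_mul, Matrix.mul_neg, Matrix.smul_mul, Matrix.one_mul, hdσ,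
        smul_smul, smul_smul, ← sub_eq_add_neg]
      have : (1 : ℂ) + (σ : ℂ)⁻¹ * q - (σ + q) * (σ : ℂ)⁻¹ = 0 := by field_simp; ring
      calc _ = ((1 : ℂ) + (σ : ℂ)⁻¹ * q - (σ + q) * (σ : ℂ)⁻¹) • (bᴴ * R) := by module
        _ = 0 := by rw [this, zero_smul]
    · rw [Matrix.mul_neg, Matrix.mul_smul, ← Matrix.mul_assoc, hqC, Matrix.smul_mul,
        Matrix.one_mul, hdσ, smul_smul, smul_smul, ← neg_smul, ← add_smul]
      have : -((σ : ℂ)⁻¹ * q) + (σ + q) * (σ : ℂ)⁻¹ = 1 := by field_simp; ring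
      rw [this, one_smul]
  have hinv : N⁻¹ = X := inv_eq_right_inv hNX
  have hpsd : N.PosSemidef := by
    have : Invertible M := hM.isUnit.invertible
    rw [hN, PosDef.fromBlocks₁₁ _ _ hM, ← hRdef, hqC, ← sub_smul, hdσ, add_sub_cancel_right]
    exact PosSemidef.one.smul (by exact_mod_cast hσ0.le)
  refine ⟨hpsd.posDef_iff_isUnit.2 ?_, ?_⟩
  · exact IsUnit.of_mul_eq_one _ hNX
  · have htb : ∀ (a : Matrix m m ℂ) (b : Matrix m Unit ℂ) (c : Matrix Unit m ℂ) (d : Matrix Unit Unit ℂ),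
        trace (fromBlocks a b c d) = trace a + trace d := by
      intro a b c d; simp [trace]
    rw [hinv, hX, htb, trace_add, trace_smul, trace_smul]
    have h1 : trace (R * b * (bᴴ * R)) = (bᴴ * (R * R) * b) () () := by
      rw [Matrix.trace_mul_comm]
      simp [trace, Matrix.mul_assoc]
    rw [h1]
    simp only [trace_one, Fintype.card_unit, ← Complex.ofReal_inv, smul_eq_mul, Complex.add_re,
      Complex.re_ofReal_mul]
    simp
    ring

lemma ri_trace_le {m n : Type} [Fintype m] [DecidableEq m] [Fintype n] [DecidableEq n]
    (Q : Matrix m m ℂ)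
    (hQ : Q.PosSemidef) (B : Matrix m n ℂ) (hB : (1 - B * Bᴴ).PosSemidef) :
    ∑ j, ((Bᴴ * Q * B) j j).re ≤ (trace Q).re := by
  obtain ⟨C, rfl⟩ : ∃ C : Matrix m m ℂ, Q = star C * C := by
    open scoped MatrixOrder in
    exact CStarAlgebra.nonneg_iff_eq_star_mul_self.1 hQ.nonneg
  have h := (hB.mul_mul_conjTranspose_same C).trace_nonneg
  have h2 := (Complex.le_def.1 h).1
  have h3 : trace (C * (1 - B * Bᴴ) * Cᴴ) = trace (star C * C) - trace (Bᴴ * (star C * C) * B) := by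
    rw [Matrix.mul_sub, Matrix.sub_mul, trace_sub, Matrix.mul_one, star_eq_conjTranspose,
      trace_mul_comm C]
    congr 1
    rw [← Matrix.mul_assoc, Matrix.mul_assoc (C * B), trace_mul_comm]
    simp only [Matrix.mul_assoc]
  rw [h3] at h2
  have h4 : ∑ j, ((Bᴴ * (star C * C) * B) j j).re = (trace (Bᴴ * (star C * C) * B)).re := by
    simp [trace]
  rw [h4]
  simp at h2 ⊢
  linarith

lemma ri_shift {m : Type} [Fintype m] [DecidableEq m] (M : Matrix m m ℂ) (hM : M.PosDef)
    (δ : ℝ) (hδ : 0 ≤ δ) :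
    (M + (δ : ℂ) • (1 : Matrix m m ℂ)).PosDef ∧
    (trace (M + (δ : ℂ) • (1 : Matrix m m ℂ))⁻¹).re + δ *
     (trace ((M + (δ : ℂ) • (1 : Matrix m m ℂ))⁻¹ * (M + (δ : ℂ) • (1 : Matrix m m ℂ))⁻¹)).re
      ≤ (trace M⁻¹).re := by
  have hM' : (M + (δ : ℂ) • (1 : Matrix m m ℂ)).PosDef :=
    hM.add_posSemidef (PosSemidef.one.smul (by exact_mod_cast hδ))
  refine ⟨hM', ?_⟩
  set M' := M + (δ : ℂ) • (1 : Matrix m m ℂ) with hM'def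
  have h1 : M⁻¹ * M = 1 := nonsing_inv_mul _ ((isUnit_iff_isUnit_det _).1 hM.isUnit)
  have h2 : M' * M'⁻¹ = 1 := mul_nonsing_inv _ ((isUnit_iff_isUnit_det _).1 hM'.isUnit)
  have hR := hM.inv
  have hR' := hM'.inv
  set R := M⁻¹
  set R' := M'⁻¹
  have h3 : R = R' + (δ : ℂ) • (R * R') := by
    calc R = R * (M' * R') := by rw [h2, Matrix.mul_one]
      _ = _ := by rw [hM'def, Matrix.add_mul, Matrix.mul_add, ← Matrix.mul_assoc, h1]; simp
  have h4 : R * R' = R' * R' + (δ : ℂ) • (R * R' * R') := by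
    nth_rewrite 1 [h3]
    rw [Matrix.add_mul, Matrix.smul_mul]
  have h5 : 0 ≤ (trace (R * R' * R')).re := by
    rw [trace_mul_comm, ← Matrix.mul_assoc]
    have := (hR.posSemidef.mul_mul_conjTranspose_same R').trace_nonneg
    rw [hR'.1.eq] at this
    exact (Complex.le_def.1 this).1
  have h6 : (trace R).re = (trace R').re + δ * ((trace (R' * R')).re + δ * (trace (R * R' * R')).re) := by
    calc (trace R).re = (trace (R' + (δ : ℂ) • (R' * R' + (δ : ℂ) • (R * R' * R')))).re := by
          rw [← h4, ← h3]
      _ = _ := by simp [trace_add, trace_smul]; ring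
  rw [h6]
  nlinarith [mul_nonneg hδ (mul_nonneg hδ h5)]

lemma ri_mul_self {m : Type} [Fintype m] [DecidableEq m] (A : Matrix m m ℂ) (c : ℝ) (hc : 0 < c)
    (h1 : ((c : ℂ) • (1 : Matrix m m ℂ) - A).PosSemidef)
    (h2 : ((c : ℂ) • (1 : Matrix m m ℂ) + A).PosSemidef) :
    (((c ^ 2 : ℝ) : ℂ) • (1 : Matrix m m ℂ) - A * A).PosSemidef := by
  have h3 := h2.mul_mul_conjTranspose_same ((c : ℂ) • (1 : Matrix m m ℂ) - A)
  have h4 := h1.mul_mul_conjTranspose_same ((c : ℂ) • (1 : Matrix m m ℂ) + A)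
  rw [h1.1.eq] at h3
  rw [h2.1.eq] at h4
  have h5 := (h3.add h4).smul (show (0 : ℂ) ≤ ((1 / (2 * c) : ℝ) : ℂ) by
    exact_mod_cast (by positivity))
  convert h5 using 1
  have hcC : (c : ℂ) ≠ 0 := by exact_mod_cast hc.ne'
  have : ∀ x y : Matrix m m ℂ, x * y = y * x → x + y = (2 * c : ℂ) • (1 : Matrix m m ℂ) →
      x * y * x + y * x * y = (2 * c : ℂ) • (x * y) := by
    intro x y h h'
    rw [← h, Matrix.mul_assoc x y x, ← h, ← Matrix.mul_assoc, Matrix.mul_assoc x x y, ← Matrix.mul_assoc x x y]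
    calc x * x * y + x * y * y = (x * y) * (x + y) := by
          rw [Matrix.mul_add, Matrix.mul_assoc x y x, ← h, Matrix.mul_assoc x x y]
      _ = _ := by rw [h']; simp
  rw [this _ _ (by simp only [Matrix.mul_add, Matrix.add_mul, Matrix.mul_sub, Matrix.sub_mul, Matrix.smul_mul, Matrix.one_mul, Matrix.mul_smul, Matrix.mul_one]; module) (by module), smul_smul]
  have h6 : ((1 / (2 * c) : ℝ) : ℂ) * (2 * c) = 1 := by push_cast; field_simp
  rw [h6, one_smul]
  simp only [Matrix.mul_add, Matrix.sub_mul, Matrix.smul_mul, Matrix.one_mul, Matrix.mul_smul, Matrix.mul_one, smul_sub, smul_smul]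
  push_cast
  rw [sq]
  module

set_option maxHeartbeats 1000000 in
lemma ri_main_step {m : Type} [Fintype m] [DecidableEq m] (A : Matrix m m ℂ) (hA : A.IsHermitian)
    (hd : ∀ i, A i i = 0) (hAA : (1 - A * A).PosSemidef) (ε : ℝ) (hε : 0 < ε) (hε1 : ε ≤ 1)
    (hn : 0 < Fintype.card m) (t : ℕ) (ht : (t : ℝ) ≤ Fintype.card m * ε ^ 2 / 32) :
    ∃ (ι : Type) (_ : Fintype ι) (_ : DecidableEq ι) (f : ι → m), Function.Injective f ∧
      Fintype.card ι = t ∧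
      (((ε / 2 + t * (8 / (Fintype.card m * ε)) : ℝ) : ℂ) • (1 : Matrix ι ι ℂ) -
        A.submatrix f f).PosDef ∧
      (trace (((ε / 2 + t * (8 / (Fintype.card m * ε)) : ℝ) : ℂ) • (1 : Matrix ι ι ℂ) -
        A.submatrix f f)⁻¹).re ≤ 4 * t / ε := by
  induction t with
  | zero =>
    refine ⟨Empty, inferInstance, inferInstance, Empty.elim, fun x => x.elim, by simp, ?_, by simp [trace]⟩
    refine PosDef.of_dotProduct_mulVec_pos ?_ fun x hx => ?_
    · ext i; exact i.elim
    · exact absurd (Subsingleton.elim _ _) hx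
  | succ t ih =>
    push_cast at ht
    obtain ⟨ι, i1, i2, f, hf, hcard, hpd, htr⟩ := ih (by linarith)
    set n : ℝ := (Fintype.card m : ℝ) with hndef
    have hn0 : 0 < n := Nat.cast_pos.2 hn
    set δ : ℝ := 8 / (n * ε) with hδdef
    have hδ : 0 < δ := by positivity
    set u : ℝ := ε / 2 + t * δ with hu
    have hu' : ε / 2 + ((t + 1 : ℕ) : ℝ) * δ = u + δ := by rw [hu]; push_cast; ring
    rw [hu']
    obtain ⟨hpd', hshift⟩ := ri_shift _ hpd δ hδ.le
    have hM' : (u : ℂ) • (1 : Matrix ι ι ℂ) - A.submatrix f f + (δ : ℂ) • (1 : Matrix ι ι ℂ)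
        = ((u + δ : ℝ) : ℂ) • (1 : Matrix ι ι ℂ) - A.submatrix f f := by push_cast; module
    rw [hM'] at hpd' hshift
    set M := ((u + δ : ℝ) : ℂ) • (1 : Matrix ι ι ℂ) - A.submatrix f f with hMdef
    have hR := hpd'.inv
    set B : Matrix ι m ℂ := -(A.submatrix f id) with hB
    have hBB : (1 - B * Bᴴ).PosSemidef := by
      convert hAA.submatrix f using 1
      ext i j
      simp only [hB, Matrix.sub_apply, Matrix.mul_apply, Matrix.submatrix_apply,
        Matrix.conjTranspose_apply, Matrix.neg_apply, id, star_neg, neg_mul_neg, hA.apply]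
      simp [Matrix.one_apply, hf.eq_iff]
    have hRR : (M⁻¹ * M⁻¹).PosSemidef := by
      have := posSemidef_conjTranspose_mul_self M⁻¹
      rwa [hR.1.eq] at this
    have hq := ri_trace_le M⁻¹ hR.posSemidef B hBB
    have hp := ri_trace_le (M⁻¹ * M⁻¹) hRR B hBB
    have hq0 : ∀ j, 0 ≤ ((Bᴴ * M⁻¹ * B) j j).re := fun j =>
      (Complex.le_def.1 ((hR.posSemidef.conjTranspose_mul_mul_same B).diag_nonneg (i := j))).1
    have hp0 : ∀ j, 0 ≤ ((Bᴴ * (M⁻¹ * M⁻¹) * B) j j).re := fun j =>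
      (Complex.le_def.1 ((hRR.conjTranspose_mul_mul_same B).diag_nonneg (i := j))).1
    have hP0 : 0 ≤ (trace (M⁻¹ * M⁻¹)).re := (Complex.le_def.1 hRR.trace_nonneg).1
    set T := (trace M⁻¹).re with hT
    set P := (trace (M⁻¹ * M⁻¹)).re with hP
    set q : m → ℝ := fun j => ((Bᴴ * M⁻¹ * B) j j).re with hqd
    set p : m → ℝ := fun j => ((Bᴴ * (M⁻¹ * M⁻¹) * B) j j).re with hpdd
    have hεε : ε ^ 2 ≤ 1 := by nlinarith
    have htn : (t : ℝ) ≤ n / 2 := by nlinarith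
    have htlt : (t : ℝ) < n := by linarith
    have htlt' : t < Fintype.card m := Nat.cast_lt.1 htlt
    set D := 4 / ε + δ * P with hD
    have hD0 : 0 < D := by positivity
    set s : Finset m := (Finset.univ.image f)ᶜ with hs
    have hscard : (s.card : ℝ) = n - t := by
      rw [hs, Finset.card_compl, Finset.card_image_of_injective _ hf, Finset.card_univ, hcard,
        Nat.cast_sub htlt'.le]
    have hsne : s.Nonempty := by
      rw [← Finset.card_pos]
      have : (0 : ℝ) < s.card := by rw [hscard]; linarith
      exact_mod_cast this
    have hTb : T ≤ n * ε / 8 := by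
      have h1 : T ≤ 4 * t / ε := by nlinarith
      have h2 : 4 * t / ε ≤ n * ε / 8 := by
        rw [div_le_iff₀ hε]; nlinarith
      linarith
    have hsum : ∑ j ∈ s, (1 + p j + D * q j) ≤ ∑ j ∈ s, D * (u + δ) := by
      rw [Finset.sum_add_distrib, Finset.sum_add_distrib, ← Finset.mul_sum, Finset.sum_const,
        Finset.sum_const, nsmul_eq_mul, nsmul_eq_mul, hscard]
      have h1 : ∑ j ∈ s, p j ≤ P := le_trans
        (Finset.sum_le_sum_of_subset_of_nonneg (Finset.subset_univ _) fun j _ _ => hp0 j) hp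
      have h2 : ∑ j ∈ s, q j ≤ T := le_trans
        (Finset.sum_le_sum_of_subset_of_nonneg (Finset.subset_univ _) fun j _ _ => hq0 j) hq
      have h3 : ε / 2 ≤ u + δ := by
        have : 0 ≤ t * δ := by positivity
        rw [hu]; linarith
      have h4 : D * ∑ j ∈ s, q j ≤ D * T := mul_le_mul_of_nonneg_left h2 hD0.le
      have h5 : (n - t) * (D * (ε / 2)) ≤ (n - t) * (D * (u + δ)) := by
        have : 0 ≤ n - t := by linarith
        gcongr
      have h6 : D * T ≤ D * ((n - t) * ε / 4) := by
        apply mul_le_mul_of_nonneg_left _ hD0.le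
        nlinarith
      have h7 : (n - t) + P ≤ D * ((n - t) * ε / 4) := by
        have e1 : D * ((n - t) * ε / 4) = (n - t) + (2 * (n - t) / n) * P := by
          rw [hD, hδdef]; field_simp; ring
        have e2 : 1 ≤ 2 * (n - t) / n := by rw [le_div_iff₀ hn0]; linarith
        have e3 := mul_le_mul_of_nonneg_right e2 hP0
        rw [e1]
        linarith
      linarith
    obtain ⟨j, hjs, hj⟩ := Finset.exists_le_of_sum_le hsne hsum
    have hjr : ∀ i, f i ≠ j := by
      intro i hi
      rw [hs, Finset.mem_compl] at hjs
      exact hjs (Finset.mem_image.2 ⟨i, Finset.mem_univ _, hi⟩)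
    have hgap : 0 < u + δ - q j := by
      have h1 : 0 < D * (u + δ - q j) := by
        have := hp0 j
        change 0 ≤ p j at this
        nlinarith
      exact (mul_pos_iff_of_pos_left hD0).1 h1
    set b : Matrix ι Unit ℂ := B.submatrix id (fun _ => j) with hb
    have hbq : (bᴴ * M⁻¹ * b) () () = (Bᴴ * M⁻¹ * B) j j := rfl
    have hbp : (bᴴ * (M⁻¹ * M⁻¹) * b) () () = (Bᴴ * (M⁻¹ * M⁻¹) * B) j j := rfl
    obtain ⟨hN, htrN⟩ := ri_schur M hpd' b (u + δ) (by rw [hbq]; linarith)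
    rw [hbq, hbp] at htrN
    have hNeq : ((u + δ : ℝ) : ℂ) • (1 : Matrix (ι ⊕ Unit) (ι ⊕ Unit) ℂ) -
        A.submatrix (Sum.elim f fun _ => j) (Sum.elim f fun _ => j) =
        fromBlocks M b bᴴ (((u + δ : ℝ) : ℂ) • (1 : Matrix Unit Unit ℂ)) := by
      ext x y
      rcases x with x | x <;> rcases y with y | y
      · simp [hMdef, Matrix.one_apply]
      · simp [hb, hB]
      · simp [hb, hB, hA.apply]
      · simp [hd]
    refine ⟨ι ⊕ Unit, inferInstance, inferInstance, Sum.elim f (fun _ => j), ?_, by simp [hcard],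
      ?_, ?_⟩
    · exact hf.sumElim (fun _ _ _ => rfl) (fun a _ => hjr a)
    · rw [hNeq]; exact hN
    · rw [hNeq, htrN]
      have h1 : (1 + p j) / (u + δ - q j) ≤ D := by
        rw [div_le_iff₀ hgap]; linarith
      change T + (1 + p j) / (u + δ - q j) ≤ _
      have h2 : 4 * ((t + 1 : ℕ) : ℝ) / ε = 4 * t / ε + 4 / ε := by push_cast; ring
      rw [h2]
      linarith

lemma ri_sub {m ι : Type} [Fintype m] [DecidableEq m] [Fintype ι] [DecidableEq ι]
    (A : Matrix m m ℂ) (c : ℂ) (f : ι → m) (hf : Function.Injective f)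
    (h : (c • (1 : Matrix m m ℂ) - A).PosSemidef) :
    (c • (1 : Matrix ι ι ℂ) - A.submatrix f f).PosSemidef := by
  convert h.submatrix f using 1
  ext i j
  simp [Matrix.one_apply, hf.eq_iff]

lemma ri_onesided (ε : ℝ) (hε : 0 < ε) (hε1 : ε ≤ 1) : ∃ k : ℕ, 0 < k ∧
    ∀ (m : Type) [Fintype m] [DecidableEq m] (A : Matrix m m ℂ), A.IsHermitian →
      (∀ i, A i i = 0) → ((1 : ℂ) • (1 : Matrix m m ℂ) - A).PosSemidef →
      ((1 : ℂ) • (1 : Matrix m m ℂ) - -A).PosSemidef →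
    ∃ (ι : Type) (_ : Fintype ι) (_ : DecidableEq ι) (f : ι → m), Function.Injective f ∧
      Fintype.card m ≤ k * Fintype.card ι ∧
      ((ε : ℂ) • (1 : Matrix ι ι ℂ) - A.submatrix f f).PosSemidef := by
  have hk0 : 0 < 64 / ε ^ 2 := by positivity
  refine ⟨⌈64 / ε ^ 2⌉₊, Nat.ceil_pos.2 hk0, ?_⟩
  intro m _ _ A hA hd h1 h2
  have hkc := Nat.le_ceil (64 / ε ^ 2)
  set k := ⌈64 / ε ^ 2⌉₊
  have hAA : (1 - A * A).PosSemidef := by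
    have := ri_mul_self A 1 one_pos (by simpa using h1) (by simpa using h2)
    simpa using this
  rcases Nat.eq_zero_or_pos (Fintype.card m) with hn | hn
  · refine ⟨Empty, inferInstance, inferInstance, Empty.elim, fun x => x.elim, by simp [hn], ?_⟩
    convert PosSemidef.zero
    ext i
    exact i.elim
  have hn0 : (0 : ℝ) < Fintype.card m := Nat.cast_pos.2 hn
  set x : ℝ := Fintype.card m * ε ^ 2 / 32 with hx
  have hx0 : 0 ≤ x := by positivity
  have hnx : (Fintype.card m : ℝ) = 32 * x / ε ^ 2 := by rw [hx]; field_simp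
  rcases Nat.eq_zero_or_pos ⌊x⌋₊ with h0 | h0
  · obtain ⟨j⟩ := Fintype.card_pos_iff.1 hn
    refine ⟨Unit, inferInstance, inferInstance, fun _ => j, fun _ _ _ => rfl, ?_, ?_⟩
    · have hx1 : x < 1 := Nat.floor_eq_zero.1 h0
      have : (Fintype.card m : ℝ) ≤ k := by
        refine le_trans ?_ hkc
        rw [hnx]
        gcongr
        linarith
      simpa using (by exact_mod_cast this : Fintype.card m ≤ k)
    · have hh : ((ε : ℂ) • (1 : Matrix Unit Unit ℂ)).PosSemidef :=
        PosSemidef.one.smul (by exact_mod_cast hε.le)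
      convert hh using 1
      ext i j
      simp [hd]
  · have hfl := Nat.floor_le hx0
    have hfl2 := Nat.lt_floor_add_one x
    obtain ⟨ι, i1, i2, f, hf, hcard, hpd, -⟩ := ri_main_step A hA hd hAA ε hε hε1 hn ⌊x⌋₊ hfl
    refine ⟨ι, i1, i2, f, hf, ?_, ?_⟩
    · rw [hcard]
      set t := ⌊x⌋₊
      have ht1 : (1 : ℝ) ≤ t := by exact_mod_cast h0
      have : (Fintype.card m : ℝ) ≤ k * t := by
        calc (Fintype.card m : ℝ) = 32 * x / ε ^ 2 := hnx
          _ ≤ 64 * t / ε ^ 2 := by gcongr ?_ / _; linarith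
          _ = 64 / ε ^ 2 * t := by ring
          _ ≤ k * t := by gcongr
      exact_mod_cast this
    · set t := ⌊x⌋₊
      set u : ℝ := ε / 2 + t * (8 / (Fintype.card m * ε)) with hu
      have hue : u ≤ ε := by
        have h3 : (t : ℝ) * (8 / (Fintype.card m * ε)) ≤ x * (8 / (Fintype.card m * ε)) := by
          gcongr
        have h4 : x * (8 / (Fintype.card m * ε)) = ε / 4 := by
          rw [hx]; field_simp; norm_num
        rw [hu]; linarith
      have := hpd.posSemidef.add (PosSemidef.one.smul
        (show (0 : ℂ) ≤ ((ε - u : ℝ) : ℂ) by exact_mod_cast sub_nonneg.2 hue))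
      convert this using 1
      push_cast
      module

lemma ri_twosided (ε : ℝ) (hε : 0 < ε) (hε1 : ε ≤ 1) : ∃ k : ℕ, 0 < k ∧
    ∀ (m : Type) [Fintype m] [DecidableEq m] (A : Matrix m m ℂ), A.IsHermitian →
      (∀ i, A i i = 0) → ((1 : ℂ) • (1 : Matrix m m ℂ) - A).PosSemidef →
      ((1 : ℂ) • (1 : Matrix m m ℂ) - -A).PosSemidef →
    ∃ (ι : Type) (_ : Fintype ι) (_ : DecidableEq ι) (f : ι → m), Function.Injective f ∧
      Fintype.card m ≤ k * Fintype.card ι ∧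
      ((ε : ℂ) • (1 : Matrix ι ι ℂ) - A.submatrix f f).PosSemidef ∧
      ((ε : ℂ) • (1 : Matrix ι ι ℂ) - (-A).submatrix f f).PosSemidef := by
  obtain ⟨k, hk, H⟩ := ri_onesided ε hε hε1
  refine ⟨k * k, by positivity, ?_⟩
  intro m _ _ A hA hd h1 h2
  obtain ⟨ι, i1, i2, f, hf, hc, hpsd⟩ := H m A hA hd h1 h2
  obtain ⟨κ, j1, j2, g, hg, hc', hpsd'⟩ := H ι ((-A).submatrix f f) (hA.neg.submatrix f)
    (fun i => by simp [hd]) (ri_sub _ _ f hf h2) (by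
      have := ri_sub _ _ f hf h1
      simpa [Matrix.submatrix_neg] using this)
  refine ⟨κ, j1, j2, f ∘ g, hf.comp hg, ?_, ?_, hpsd'⟩
  · calc _ ≤ k * Fintype.card ι := hc
      _ ≤ k * (k * Fintype.card κ) := by gcongr
      _ = _ := by ring
  · exact ri_sub _ _ g hg hpsd

lemma ri_quad {m : Type} [Fintype m] [DecidableEq m] (A : Matrix m m ℂ) (c : ℝ) (x : m → ℂ) :
    star x ⬝ᵥ ((((c ^ 2 : ℝ) : ℂ) • (1 : Matrix m m ℂ) - Aᴴ * A) *ᵥ x) =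
      ((c ^ 2 * ‖WithLp.toLp 2 x‖ ^ 2 -
        ‖Matrix.toEuclideanCLM (𝕜 := ℂ) A (WithLp.toLp 2 x)‖ ^ 2 : ℝ) : ℂ) := by
  have key : ∀ y : m → ℂ, star y ⬝ᵥ y = ((‖WithLp.toLp 2 y‖ ^ 2 : ℝ) : ℂ) := by
    intro y
    rw [EuclideanSpace.norm_sq_eq]
    simp [dotProduct, Complex.conj_mul']
  rw [Matrix.toEuclideanCLM_toLp, Complex.ofReal_sub, Complex.ofReal_mul, ← key, ← key,
    Matrix.sub_mulVec, dotProduct_sub, Matrix.smul_mulVec, dotProduct_smul, Matrix.one_mulVec,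
    smul_eq_mul, ← Matrix.mulVec_mulVec, Matrix.dotProduct_mulVec (star x), ← Matrix.star_mulVec]

lemma ri_norm1 {m : Type} [Fintype m] [DecidableEq m] (A : Matrix m m ℂ) (h : specNorm A ≤ 1) :
    (1 - Aᴴ * A).PosSemidef := by
  refine PosSemidef.of_dotProduct_mulVec_nonneg ?_ fun x => ?_
  · exact isHermitian_one.sub (isHermitian_conjTranspose_mul_self A)
  · have := ri_quad A 1 x
    simp only [one_pow, Complex.ofReal_one, one_smul, one_mul] at this
    rw [this]
    have h2 := (Matrix.toEuclideanCLM (𝕜 := ℂ) A).le_of_opNorm_le h (WithLp.toLp 2 x)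
    have h3 : ‖Matrix.toEuclideanCLM (𝕜 := ℂ) A (WithLp.toLp 2 x)‖ ^ 2 ≤ ‖WithLp.toLp 2 x‖ ^ 2 := by
      rw [one_mul] at h2
      gcongr
    exact_mod_cast sub_nonneg.2 h3

lemma ri_norm2 {m : Type} [Fintype m] [DecidableEq m] (A : Matrix m m ℂ) (c : ℝ) (hc : 0 ≤ c)
    (h : (((c ^ 2 : ℝ) : ℂ) • (1 : Matrix m m ℂ) - Aᴴ * A).PosSemidef) : specNorm A ≤ c := by
  refine ContinuousLinearMap.opNorm_le_bound _ hc fun x => ?_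
  have h1 := h.dotProduct_mulVec_nonneg x.ofLp
  rw [ri_quad] at h1
  have h2 : 0 ≤ c ^ 2 * ‖x‖ ^ 2 - ‖Matrix.toEuclideanCLM (𝕜 := ℂ) A x‖ ^ 2 := by exact_mod_cast h1
  rw [← mul_pow] at h2
  exact (sq_le_sq₀ (norm_nonneg _) (by positivity)).1 (by linarith)

noncomputable def riPart {m : Type} (c : ℂ) (A : Matrix m m ℂ) : Matrix m m ℂ :=
  (1 / 2 : ℂ) • (c • A + star c • Aᴴ)

lemma riPart_herm {m : Type} (c : ℂ) (A : Matrix m m ℂ) : (riPart c A).IsHermitian := by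
  ext i j
  simp [riPart]
  ring

lemma riPart_psd {m : Type} [Fintype m] [DecidableEq m] (c : ℂ) (hc : star c * c = 1)
    (A : Matrix m m ℂ) (h : (1 - Aᴴ * A).PosSemidef) :
    ((1 : ℂ) • (1 : Matrix m m ℂ) - riPart c A).PosSemidef := by
  have h1 := (h.add (posSemidef_conjTranspose_mul_self (1 - c • A))).smul
    (show (0 : ℂ) ≤ ((1 / 2 : ℝ) : ℂ) by exact_mod_cast (by norm_num))
  convert h1 using 1
  have e : (1 - c • A)ᴴ * (1 - c • A) =
      1 - c • A - star c • Aᴴ + (star c * c) • (Aᴴ * A) := by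
    simp only [conjTranspose_sub, conjTranspose_one, conjTranspose_smul, Matrix.sub_mul,
      Matrix.mul_sub, Matrix.one_mul, Matrix.mul_one, Matrix.smul_mul, Matrix.mul_smul]
    module
  rw [e, hc, riPart]
  push_cast
  module

lemma ri_norm_add {m : Type} [Fintype m] [DecidableEq m] (X Y : Matrix m m ℂ) :
    specNorm (X + Complex.I • Y) ≤ specNorm X + specNorm Y := by
  unfold specNorm
  have h : Matrix.toEuclideanCLM (𝕜 := ℂ) (X + Complex.I • Y) =
      Matrix.toEuclideanCLM (𝕜 := ℂ) X + Complex.I • Matrix.toEuclideanCLM (𝕜 := ℂ) Y := by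
    ext x i
    simp
  rw [h]
  refine (norm_add_le _ _).trans ?_
  rw [norm_smul, Complex.norm_I, one_mul]

lemma riPart_neg {m : Type} (c : ℂ) (A : Matrix m m ℂ) : -riPart c A = riPart (-c) A := by
  simp only [riPart, star_neg]
  module

lemma ri_herm_norm {m : Type} [Fintype m] [DecidableEq m] (A : Matrix m m ℂ) (hA : A.IsHermitian)
    (c : ℝ) (hc : 0 < c) (h1 : ((c : ℂ) • (1 : Matrix m m ℂ) - A).PosSemidef)
    (h2 : ((c : ℂ) • (1 : Matrix m m ℂ) - -A).PosSemidef) : specNorm A ≤ c := by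
  apply ri_norm2 _ _ hc.le
  rw [hA.eq]
  exact ri_mul_self A c hc h1 (by simpa using h2)

lemma ri_final (ε : ℝ) (hε : 0 < ε) : ∃ k : ℕ, 0 < k ∧
    ∀ (m : Type) [Fintype m] [DecidableEq m] (A : Matrix m m ℂ),
      (∀ i, A i i = 0) → specNorm A ≤ 1 →
    ∃ S : Finset m, Fintype.card m ≤ k * S.card ∧
      specNorm (A.submatrix (fun x : {j : m // j ∈ S} => (x : m))
            (fun x : {j : m // j ∈ S} => (x : m))) ≤ ε := by
  set η := min (ε / 2) 1 with hη
  have hη0 : 0 < η := by positivity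
  obtain ⟨k, hk, H⟩ := ri_twosided η hη0 (min_le_right _ _)
  refine ⟨k * k, by positivity, ?_⟩
  intro m _ _ A hd hA
  have hpsd := ri_norm1 A hA
  have hI1 : star (1 : ℂ) * 1 = 1 := by simp
  have hI2 : star (-1 : ℂ) * (-1) = 1 := by simp
  have hI3 : star (-Complex.I) * (-Complex.I) = 1 := by simp
  have hI4 : star (-(-Complex.I)) * (-(-Complex.I)) = 1 := by simp
  obtain ⟨ι, i1, i2, f, hf, hc, hp1, hp2⟩ := H m (riPart 1 A) (riPart_herm _ _)
    (fun i => by simp [riPart, hd]) (riPart_psd _ hI1 A hpsd)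
    (by rw [riPart_neg]; exact riPart_psd _ hI2 A hpsd)
  obtain ⟨κ, j1, j2, g, hg, hc', hp3, hp4⟩ := H ι ((riPart (-Complex.I) A).submatrix f f)
    ((riPart_herm _ _).submatrix f)
    (fun i => by simp [riPart, hd]) (ri_sub _ _ f hf (riPart_psd _ hI3 A hpsd))
    (by
      have := ri_sub _ _ f hf (riPart_psd _ hI4 A hpsd)
      rw [← riPart_neg] at this
      exact this)
  have hfg := hf.comp hg
  refine ⟨Finset.univ.image (f ∘ g), ?_, ?_⟩
  · rw [Finset.card_image_of_injective _ hfg, Finset.card_univ]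
    calc _ ≤ k * Fintype.card ι := hc
      _ ≤ k * (k * Fintype.card κ) := by gcongr
      _ = _ := by ring
  · set S := Finset.univ.image (f ∘ g)
    have hex : ∀ x : {j : m // j ∈ S}, ∃ y : κ, f (g y) = x := by
      intro x
      obtain ⟨y, -, hy⟩ := Finset.mem_image.1 x.2
      exact ⟨y, hy⟩
    choose e he using hex
    have hei : Function.Injective e := by
      intro x y hxy
      apply Subtype.ext
      rw [← he x, ← he y, hxy]
    have hval : (fun x : {j : m // j ∈ S} => (x : m)) = f ∘ g ∘ e := by
      ext x; exact (he x).symm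
    rw [hval]
    have n1 := ri_herm_norm ((riPart 1 A).submatrix (f ∘ g ∘ e) (f ∘ g ∘ e))
      ((riPart_herm _ _).submatrix _) η hη0
      (ri_sub _ _ (g ∘ e) (hg.comp hei) hp1) (ri_sub _ _ (g ∘ e) (hg.comp hei) hp2)
    have n2 := ri_herm_norm ((riPart (-Complex.I) A).submatrix (f ∘ g ∘ e) (f ∘ g ∘ e))
      ((riPart_herm _ _).submatrix _) η hη0
      (ri_sub _ _ e hei hp3) (ri_sub _ _ e hei hp4)
    have hdec : A.submatrix (f ∘ g ∘ e) (f ∘ g ∘ e) =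
        (riPart 1 A).submatrix (f ∘ g ∘ e) (f ∘ g ∘ e) +
        Complex.I • (riPart (-Complex.I) A).submatrix (f ∘ g ∘ e) (f ∘ g ∘ e) := by
      ext i j
      simp [riPart]
      ring_nf
      simp
      ring
    rw [hdec]
    refine (ri_norm_add _ _).trans ?_
    have : η ≤ ε / 2 := min_le_left _ _
    linarith

end RI

theorem restricted_invertibility (ε : ℝ) (hε : 0 < ε) :
    ∃ k : ℕ, 0 < k ∧
      ∀ (n : ℕ), 1 ≤ n → ∀ (A : Matrix (Fin n) (Fin n) ℂ),
        (∀ i, A i i = 0) → specNorm A ≤ 1 →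
        ∃ S : Finset (Fin n),
          (n : ℝ) / (k : ℝ) ≤ (S.card : ℝ) ∧
          specNorm (A.submatrix (fun x : {j : Fin n // j ∈ S} => (x : Fin n))
            (fun x : {j : Fin n // j ∈ S} => (x : Fin n))) ≤ ε := by
  obtain ⟨k, hk, H⟩ := ri_final ε hε
  refine ⟨k, hk, fun n _ A hd hA => ?_⟩
  obtain ⟨S, hS, hS'⟩ := H (Fin n) A hd hA
  refine ⟨S, ?_, hS'⟩
  rw [Fintype.card_fin] at hS
  rw [div_le_iff₀ (by exact_mod_cast hk), mul_comm]
  exact_mod_cast hS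
end

section
/- There exists a constant c > 0 such that for infinitely many n (equivalently, for all sufficiently large n) there exists a finite metric space (X, d) with |X| = n such that every embedding f of X into a real Hilbert space (e.g. ℓ² of ℝ) has distortion at least c·log n; that is, there is no f : X → ℓ² satisfying d(x,y) ≤ ‖f(x) − f(y)‖ ≤ c'·d(x,y) for all x,y ∈ X with c' < c·log n. -/
namespace BO

abbrev V (k : ℕ) := Fin k → ZMod 2

noncomputable section

def sg (z : ZMod 2) : ℝ := if z = 0 then 1 else -1

lemma sg_add (x y : ZMod 2) : sg (x + y) = sg x * sg y := by
  have h01 : ∀ z : ZMod 2, z = 0 ∨ z = 1 := by decide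
  have h11 : (1 + 1 : ZMod 2) = 0 := by decide
  rcases h01 x with rfl | rfl <;> rcases h01 y with rfl | rfl <;> simp [sg, h11]

def chi {k : ℕ} (a x : V k) : ℝ := ∏ i, sg (a i * x i)

lemma chi_add {k : ℕ} (a x y : V k) : chi a (x + y) = chi a x * chi a y := by
  simp [chi, mul_add, sg_add, Finset.prod_mul_distrib]

lemma chi_comm {k : ℕ} (a x : V k) : chi a x = chi x a := by
  simp [chi, mul_comm]

lemma add_self {k : ℕ} (x : V k) : x + x = 0 := by
  funext i; exact CharTwo.add_self_eq_zero (x i)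

lemma chi_zero {k : ℕ} (a : V k) : chi a 0 = 1 := by
  simp [chi, sg]

lemma chi_pm {k : ℕ} (a x : V k) : chi a x = 1 ∨ chi a x = -1 := by
  have h := chi_add a x x
  rw [add_self, chi_zero] at h
  exact mul_self_eq_one_iff.mp h.symm

lemma sum_chi {k : ℕ} (x : V k) : ∑ a, chi a x = if x = 0 then (2:ℝ)^k else 0 := by
  have h : ∑ a, chi a x = ∏ i, ∑ b : ZMod 2, sg (b * x i) := by
    rw [Finset.prod_univ_sum]; simp [chi]
  have h2 : ∀ z : ZMod 2, ∑ b : ZMod 2, sg (b * z) = if z = 0 then 2 else 0 := by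
    intro z
    have : (Finset.univ : Finset (ZMod 2)) = {0, 1} := by decide
    rw [this, Finset.sum_pair (by decide)]
    have h01 : ∀ z : ZMod 2, z = 0 ∨ z = 1 := by decide
    rcases h01 z with rfl | rfl <;> simp [sg] <;> norm_num
  rw [h]
  simp only [h2]
  split_ifs with hx
  · subst hx; simp
  · obtain ⟨i, hi⟩ := Function.ne_iff.mp hx
    exact Finset.prod_eq_zero (Finset.mem_univ i) (by simpa using hi)

lemma sum_chi' {k : ℕ} (a : V k) (ha : a ≠ 0) : ∑ x, chi a x = 0 := by
  simp_rw [chi_comm a]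
  rw [sum_chi, if_neg ha]

lemma card_V (k : ℕ) : Fintype.card (V k) = 2 ^ k := by
  simp [ZMod.card]

section four
variable {H : Type*} [NormedAddCommGroup H] [InnerProductSpace ℝ H]

lemma four1 {k : ℕ} (f : V k → H) (u : V k) :
    ∑ a, chi a u * ‖∑ x, chi a x • f x‖ ^ 2 = 2 ^ k * ∑ x, inner ℝ (f x) (f (x + u)) := by
  have h1 : ∀ a, chi a u * ‖∑ x, chi a x • f x‖ ^ 2
      = ∑ x, ∑ y, chi a (u + x + y) * inner ℝ (f x) (f y) := by
    intro a
    rw [← real_inner_self_eq_norm_sq, sum_inner, Finset.mul_sum]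
    refine Finset.sum_congr rfl fun x _ => ?_
    rw [inner_sum, Finset.mul_sum]
    refine Finset.sum_congr rfl fun y _ => ?_
    rw [real_inner_smul_left, real_inner_smul_right, chi_add, chi_add]; ring
  simp_rw [h1]
  rw [Finset.sum_comm, Finset.mul_sum]
  refine Finset.sum_congr rfl fun x _ => ?_
  rw [Finset.sum_comm]
  simp_rw [← Finset.sum_mul, sum_chi]
  rw [Finset.sum_eq_single (x + u)]
  · rw [if_pos]
    rw [add_comm u x, add_self]
  · intro y _ hy
    rw [if_neg, zero_mul]
    intro h
    apply hy
    have := congrArg (fun z => x + u + z) h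
    simp only [add_zero] at this
    rw [← this, add_comm u x, ← add_assoc, add_self, zero_add]
  · simp

def FF {k : ℕ} (f : V k → H) (u : V k) : ℝ := ∑ x, ‖f (x + u) - f x‖ ^ 2

lemma four2 {k : ℕ} (f : V k → H) (u : V k) :
    ∑ a, (1 - chi a u) * ‖∑ x, chi a x • f x‖ ^ 2 = 2 ^ k / 2 * FF f u := by
  have h0 := four1 f 0
  have hu := four1 f u
  simp only [chi_zero, add_zero, one_mul] at h0
  simp only [sub_mul, one_mul, Finset.sum_sub_distrib]
  rw [h0, hu]
  have h3 : FF f u = 2 * ∑ x, inner ℝ (f x) (f x) - 2 * ∑ x, inner ℝ (f x) (f (x + u)) := by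
    have h4 : ∑ x, inner ℝ (f x) (f x) = ∑ x, ‖f (x + u)‖ ^ 2 := by
      simp_rw [real_inner_self_eq_norm_sq]
      exact (Equiv.sum_comp (Equiv.addRight u) (fun x => ‖f x‖ ^ 2)).symm
    rw [two_mul]
    nth_rewrite 1 [h4]
    rw [FF, Finset.mul_sum, ← Finset.sum_add_distrib, ← Finset.sum_sub_distrib]
    refine Finset.sum_congr rfl fun x _ => ?_
    rw [@norm_sub_sq_real, real_inner_self_eq_norm_sq, real_inner_comm]; ring
  rw [h3]; ring

lemma poincare {k m : ℕ} (f : V k → H) (s : Fin m → V k) (L : ℝ)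
    (hs : ∀ a, a ≠ 0 → L ≤ ∑ i, (1 - chi a (s i))) :
    L * ∑ u, FF f u ≤ 2 ^ k * ∑ i, FF f (s i) := by
  have hp : (0:ℝ) < 2 ^ k := by positivity
  set A : V k → ℝ := fun a => ‖∑ x, chi a x • f x‖ ^ 2 with hA
  have e1 : ∀ u, 2 ^ k * FF f u = 2 * ∑ a, (1 - chi a u) * A a := by
    intro u; rw [hA, four2]; ring
  have e2 : 2 ^ k * ∑ u, FF f u = 2 * ∑ a, (∑ u, (1 - chi a u)) * A a := by
    rw [Finset.mul_sum]; simp_rw [e1]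
    rw [← Finset.mul_sum, Finset.sum_comm]; simp_rw [Finset.sum_mul]
  have e3 : 2 ^ k * ∑ i, FF f (s i) = 2 * ∑ a, (∑ i, (1 - chi a (s i))) * A a := by
    rw [Finset.mul_sum]; simp_rw [e1]
    rw [← Finset.mul_sum, Finset.sum_comm]; simp_rw [Finset.sum_mul]
  have e4 : L * (2 ^ k * ∑ u, FF f u) ≤ 2 ^ k * (2 ^ k * ∑ i, FF f (s i)) := by
    rw [e2, e3, mul_left_comm L, mul_left_comm (2 ^ k : ℝ), Finset.mul_sum _ _ L,
      Finset.mul_sum _ _ (2 ^ k : ℝ)]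
    refine mul_le_mul_of_nonneg_left (Finset.sum_le_sum fun a _ => ?_) (zero_le_two (α := ℝ))
    rw [← mul_assoc, ← mul_assoc]
    refine mul_le_mul_of_nonneg_right ?_ (sq_nonneg _)
    by_cases ha : a = 0
    · subst ha
      have : ∀ u : V k, chi 0 u = 1 := fun u => by rw [chi_comm, chi_zero]
      simp [this]
    · rw [Finset.sum_sub_distrib, sum_chi' a ha]
      simp only [Finset.sum_const, Finset.card_univ, card_V, nsmul_eq_mul, mul_one, sub_zero]
      push_cast
      nlinarith [hs a ha]
  rw [mul_left_comm] at e4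
  exact le_of_mul_le_mul_left e4 hp

end four

lemma exists_code (k : ℕ) : ∃ s : Fin (5 * k) → V k,
    ∀ a, a ≠ 0 → 2 * (k:ℝ) ≤ ∑ i, (1 - chi a (s i)) := by
  classical
  set G : (Fin (5 * k) → V k) → ℝ :=
    fun s => ∑ a ∈ Finset.univ.filter (fun a : V k => a ≠ 0), ∏ i, (3 + chi a (s i)) / 4 with hG
  have hsum : ∑ s, G s ≤ ∑ s : Fin (5 * k) → V k, (2:ℝ) ^ k * (3 / 4) ^ (5 * k) := by
    rw [hG, Finset.sum_comm]
    have : ∀ a ∈ Finset.univ.filter (fun a : V k => a ≠ 0),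
        ∑ s : Fin (5 * k) → V k, ∏ i, (3 + chi a (s i)) / 4 = (2 ^ k * (3 / 4) : ℝ) ^ (5 * k) := by
      intro a ha
      rw [← Fintype.sum_pow (fun v => (3 + chi a v) / 4)]
      congr 1
      rw [← Finset.sum_div, Finset.sum_add_distrib, sum_chi' a (by simpa using ha)]
      simp only [Finset.sum_const, Finset.card_univ, card_V, nsmul_eq_mul]
      push_cast; ring
    rw [Finset.sum_congr rfl this]
    simp only [Finset.sum_const, Finset.card_univ, nsmul_eq_mul, Fintype.card_fun, ZMod.card,
      Fintype.card_fin]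
    have h2 : ((Finset.univ.filter (fun a : V k => a ≠ 0)).card : ℝ) ≤ 2 ^ k := by
      have := Finset.card_filter_le (Finset.univ : Finset (V k)) (fun a : V k => a ≠ 0)
      rw [Finset.card_univ, card_V] at this
      exact_mod_cast this
    push_cast
    rw [mul_pow]
    calc _ ≤ (2:ℝ) ^ k * ((2 ^ k) ^ (5 * k) * (3 / 4) ^ (5 * k)) :=
          mul_le_mul_of_nonneg_right h2 (by positivity)
      _ = _ := by ring
  obtain ⟨s, -, hs⟩ := Finset.exists_le_of_sum_le Finset.univ_nonempty hsum
  refine ⟨s, fun a ha => ?_⟩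
  set T := Finset.univ.filter (fun i => chi a (s i) = -1) with hT
  have hfac : ∀ i, (3 + chi a (s i)) / 4 = if chi a (s i) = -1 then 1 / 2 else 1 := by
    intro i
    rcases chi_pm a (s i) with h | h <;> rw [h] <;> norm_num
  have hprod : ∀ b : V k, 0 ≤ ∏ i, (3 + chi b (s i)) / 4 := by
    intro b
    refine Finset.prod_nonneg fun i _ => ?_
    rcases chi_pm b (s i) with h | h <;> rw [h] <;> norm_num
  have h1 : ∏ i, (3 + chi a (s i)) / 4 = (1 / 2 : ℝ) ^ T.card := by
    simp_rw [hfac]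
    rw [Finset.prod_ite]; simp [hT]
  have h2 : (1 / 2 : ℝ) ^ T.card ≤ 2 ^ k * (3 / 4) ^ (5 * k) := by
    rw [← h1]
    refine le_trans ?_ hs
    exact Finset.single_le_sum (f := fun a => ∏ i, (3 + chi a (s i)) / 4)
      (fun b _ => hprod b) (by simpa using ha)
  have h3 : (2:ℝ) ^ k * (3 / 4) ^ (5 * k) ≤ (1 / 2) ^ k := by
    rw [pow_mul, ← mul_pow]
    exact pow_le_pow_left₀ (by norm_num) (by norm_num) k
  have h4 : k ≤ T.card :=
    (pow_le_pow_iff_right_of_lt_one₀ (by norm_num) (by norm_num)).mp (h2.trans h3)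
  have h5 : ∑ i, (1 - chi a (s i)) = 2 * (T.card : ℝ) := by
    have : ∀ i, 1 - chi a (s i) = if chi a (s i) = -1 then 2 else 0 := by
      intro i
      rcases chi_pm a (s i) with h | h <;> rw [h] <;> norm_num
    simp_rw [this]
    rw [← Finset.sum_filter]; simp [hT, mul_comm]
  rw [h5]
  have : (k:ℝ) ≤ T.card := by exact_mod_cast h4
  linarith

section metric
variable {k m : ℕ} (s : Fin m → V k)

def lin (c : Fin m → ZMod 2) : V k := ∑ i, c i • s i

def PP (v : V k) (r : ℕ) : Prop := m ≤ r ∨ ∃ c, hammingNorm c ≤ r ∧ lin s c = v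

lemma PP_ex (v : V k) : ∃ r, PP s v r := ⟨m, Or.inl le_rfl⟩

open Classical in
def ww (v : V k) : ℕ := Nat.find (PP_ex s v)

lemma ww_spec (v : V k) : PP s v (ww s v) := by
  classical
  unfold ww; convert Nat.find_spec (PP_ex s v)

lemma ww_le {v : V k} {r : ℕ} (h : PP s v r) : ww s v ≤ r := by
  classical
  unfold ww; convert Nat.find_min' (PP_ex s v) h

lemma ww_zero : ww s 0 = 0 :=
  Nat.le_zero.mp (ww_le s (Or.inr ⟨0, by simp, by simp [lin]⟩))

lemma ww_pos (hm : 0 < m) {v : V k} (hv : v ≠ 0) : 0 < ww s v := by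
  by_contra h
  have h0 : ww s v = 0 := by omega
  have := ww_spec s v
  rw [h0] at this
  rcases this with h | ⟨c, hc, h⟩
  · omega
  · have : c = 0 := by simpa using hc
    subst this
    exact hv (by rw [← h]; simp [lin])

lemma ww_add (u v : V k) : ww s (u + v) ≤ ww s u + ww s v := by
  apply ww_le
  rcases ww_spec s u with h | ⟨c, hc, h⟩
  · left; omega
  rcases ww_spec s v with h' | ⟨c', hc', h'⟩
  · left; omega
  right
  refine ⟨c + c', ?_, ?_⟩
  · have := hammingDist_triangle (c + c') c' 0
    rw [hammingDist_zero_right, hammingDist_zero_right, hammingDist_comm,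
      hammingDist_eq_hammingNorm] at this
    have e : -c' + (c + c') = c := by abel
    rw [e] at this
    omega
  · rw [← h, ← h']; simp [lin, add_smul, Finset.sum_add_distrib]

lemma ww_gen (i : Fin m) : ww s (s i) ≤ 1 := by
  apply ww_le
  right
  refine ⟨Pi.single i 1, ?_, ?_⟩
  · unfold hammingNorm
    rw [Finset.card_le_one]
    intro a ha b hb
    simp [Pi.single_apply] at ha hb
    rw [ha, hb]
  · simp [lin, Pi.single_apply, ite_smul]

lemma ball (r : ℕ) (hr : r < m) :
    ((Finset.univ.filter (fun v => ww s v ≤ r)).card : ℝ) ≤ (17 / 16) ^ m * 16 ^ r := by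
  classical
  set B := Finset.univ.filter (fun c : Fin m → ZMod 2 => hammingNorm c ≤ r)
  have h1 : (Finset.univ.filter (fun v => ww s v ≤ r)).card ≤ B.card := by
    refine (Finset.card_le_card ?_).trans (Finset.card_image_le (s := B) (f := lin s))
    intro v hv
    have hv' : ww s v ≤ r := by simpa using hv
    rcases ww_spec s v with h | ⟨c, hc, h⟩
    · omega
    · exact Finset.mem_image.mpr ⟨c, by simp [B]; omega, h⟩
  have h2 : ∑ c : Fin m → ZMod 2, (1 / 16 : ℝ) ^ hammingNorm c = (17 / 16) ^ m := by
    have e : ∀ c : Fin m → ZMod 2, (1 / 16 : ℝ) ^ hammingNorm c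
        = ∏ i, if c i ≠ 0 then (1 / 16 : ℝ) else 1 := by
      intro c
      rw [Finset.prod_ite]; simp [hammingNorm]
    simp_rw [e]
    rw [← Fintype.sum_pow (fun z : ZMod 2 => if z ≠ 0 then (1 / 16 : ℝ) else 1)]
    congr 1
    have : (Finset.univ : Finset (ZMod 2)) = {0, 1} := by decide
    rw [this, Finset.sum_pair (by decide)]
    norm_num
  have h3 : (B.card : ℝ) * (1 / 16) ^ r ≤ (17 / 16) ^ m := by
    rw [← h2, ← nsmul_eq_mul, ← Finset.sum_const]
    refine (Finset.sum_le_sum fun c hc => ?_).trans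
      (Finset.sum_le_univ_sum_of_nonneg (s := B) fun c => by positivity)
    exact pow_le_pow_of_le_one (by norm_num) (by norm_num) (by simpa [B] using hc)
  have h4 : ((Finset.univ.filter (fun v => ww s v ≤ r)).card : ℝ) ≤ B.card := by exact_mod_cast h1
  refine h4.trans ?_
  have h5 : (1 / 16 : ℝ) ^ r * 16 ^ r = 1 := by rw [← mul_pow]; norm_num
  calc (B.card : ℝ) = B.card * (1 / 16) ^ r * 16 ^ r := by rw [mul_assoc, h5, mul_one]
    _ ≤ _ := mul_le_mul_of_nonneg_right h3 (by positivity)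

end metric

lemma neg_V {k : ℕ} (x : V k) : -x = x := by
  rw [neg_eq_iff_add_eq_zero, add_self]

lemma sub_V {k : ℕ} (x y : V k) : x - y = x + y := by
  rw [sub_eq_add_neg, neg_V]

lemma main {H : Type*} [NormedAddCommGroup H] [InnerProductSpace ℝ H] (j : ℕ) (hj : 3 ≤ j)
    (s : Fin (5 * (8 * j)) → V (8 * j))
    (hs : ∀ a, a ≠ 0 → 2 * ((8 * j : ℕ):ℝ) ≤ ∑ i, (1 - chi a (s i)))
    (f : V (8 * j) → H) (c' : ℝ)
    (hf : ∀ x y, (ww s (x - y) : ℝ) ≤ ‖f x - f y‖ ∧ ‖f x - f y‖ ≤ c' * ww s (x - y)) :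
    (j : ℝ) / 3 ≤ c' := by
  have hjr : (3:ℝ) ≤ j := by exact_mod_cast hj
  set N : ℝ := 2 ^ (8 * j) with hN
  have hNpos : 0 < N := by positivity
  have hc0 : 0 ≤ c' := by
    have hne : (fun _ => 1 : V (8 * j)) ≠ 0 := by
      intro h
      have := congrFun h ⟨0, by omega⟩
      simp at this
    have h1 := hf (fun _ => 1) 0
    rw [sub_zero] at h1
    have h2 : (0:ℝ) < ww s (fun _ => 1) := by exact_mod_cast ww_pos s (by omega) hne
    nlinarith [h1.1, h1.2]
  have hcard : ∑ _x : V (8 * j), (1:ℝ) = N := by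
    simp only [Finset.sum_const, Finset.card_univ, card_V, nsmul_eq_mul, hN]; push_cast; ring
  have hup : ∀ i, FF f (s i) ≤ N * c' ^ 2 := by
    intro i
    rw [← hcard, Finset.sum_mul]
    refine Finset.sum_le_sum fun x _ => ?_
    have h1 := (hf (x + s i) x).2
    rw [add_sub_cancel_left] at h1
    have h2 : (ww s (s i) : ℝ) ≤ 1 := by exact_mod_cast ww_gen s i
    rw [one_mul]
    exact pow_le_pow_left₀ (norm_nonneg _) (h1.trans (mul_le_of_le_one_right hc0 h2)) 2
  have hlow : ∀ u, N * (ww s u : ℝ) ^ 2 ≤ FF f u := by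
    intro u
    rw [← hcard, Finset.sum_mul]
    refine Finset.sum_le_sum fun x _ => ?_
    have h1 := (hf (x + u) x).1
    rw [add_sub_cancel_left] at h1
    rw [one_mul]
    exact pow_le_pow_left₀ (by positivity) h1 2
  have hball : ((Finset.univ.filter (fun v => ww s v ≤ j)).card : ℝ) ≤ N / 2 := by
    refine (ball s j (by omega)).trans ?_
    have e1 : ((17:ℝ) / 16) ^ (5 * (8 * j)) * 16 ^ j = ((17 / 16) ^ 40 * 16) ^ j := by
      rw [mul_pow, ← pow_mul]; congr 2; ring
    have e2 : ((17:ℝ) / 16) ^ 40 * 16 ≤ 256 * (182 / 256) := by norm_num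
    rw [e1]
    refine (pow_le_pow_left₀ (by positivity) e2 j).trans ?_
    rw [mul_pow, hN, pow_mul]
    have e3 : ((182:ℝ) / 256) ^ j ≤ (182 / 256) ^ 3 :=
      pow_le_pow_of_le_one (by norm_num) (by norm_num) hj
    have e4 : (0:ℝ) < 256 ^ j := by positivity
    norm_num at e3 ⊢
    nlinarith
  have hfar : N / 2 ≤ ((Finset.univ.filter (fun v => ¬ ww s v ≤ j)).card : ℝ) := by
    have := Finset.card_filter_add_card_filter_not (s := (Finset.univ : Finset (V (8 * j))))
      (fun v => ww s v ≤ j)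
    rw [Finset.card_univ, card_V] at this
    have h2 : ((Finset.univ.filter (fun v => ww s v ≤ j)).card : ℝ)
      + ((Finset.univ.filter (fun v => ¬ ww s v ≤ j)).card : ℝ) = N := by
      rw [hN]; exact_mod_cast this
    linarith
  have htot : N / 2 * (N * j ^ 2) ≤ ∑ u, FF f u := by
    refine (mul_le_mul_of_nonneg_right hfar (by positivity)).trans ?_
    rw [← nsmul_eq_mul, ← Finset.sum_const]
    refine (Finset.sum_le_sum fun u hu => ?_).trans
      (Finset.sum_le_univ_sum_of_nonneg fun u => ?_)
    · refine le_trans ?_ (hlow u)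
      have : j ≤ ww s u := by
        have : ¬ ww s u ≤ j := by simpa using hu
        omega
      gcongr
    · exact Finset.sum_nonneg fun x _ => by positivity
  have hP := poincare f s _ hs
  have hR : ∑ i, FF f (s i) ≤ (40 * j) * (N * c' ^ 2) := by
    refine (Finset.sum_le_sum fun i _ => hup i).trans ?_
    simp only [Finset.sum_const, Finset.card_univ, Fintype.card_fin, nsmul_eq_mul]
    push_cast
    apply le_of_eq; ring
  push_cast at hP
  have hfin : 2 * (8 * (j:ℝ)) * (N / 2 * (N * j ^ 2)) ≤ N * ((40 * j) * (N * c' ^ 2)) :=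
    (mul_le_mul_of_nonneg_left htot (by positivity)).trans
      (hP.trans (mul_le_mul_of_nonneg_left hR hNpos.le))
  have h5 : (N ^ 2 * j) * (j:ℝ) ^ 2 ≤ (N ^ 2 * j) * (5 * c' ^ 2) := by nlinarith
  have h6 : (j:ℝ) ^ 2 ≤ 5 * c' ^ 2 := le_of_mul_le_mul_left h5 (by positivity)
  nlinarith

end

end BO


/-- Optimality of Bourgain's embedding theorem (Linial–London–Rabinovich): there is a
constant `c > 0` such that for infinitely many `n` there is an `n`-point metric space
every embedding of which into the Hilbert space `ℓ²` has distortion at least `c · log n`. -/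
theorem bourgain_optimal :
    ∃ c : ℝ, 0 < c ∧
      ∀ N : ℕ, ∃ n : ℕ, N ≤ n ∧
        ∃ d : Fin n → Fin n → ℝ,
          (∀ x, d x x = 0) ∧
          (∀ x y, x ≠ y → 0 < d x y) ∧
          (∀ x y, d x y = d y x) ∧
          (∀ x y z, d x z ≤ d x y + d y z) ∧
          ∀ (f : Fin n → lp (fun _ : ℕ => ℝ) 2) (c' : ℝ),
            (∀ x y, d x y ≤ ‖f x - f y‖ ∧ ‖f x - f y‖ ≤ c' * d x y) →
            c * Real.log n ≤ c' := by
  refine ⟨1 / 24, by norm_num, fun N => ?_⟩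
  set j := N + 3 with hj
  obtain ⟨s, hs⟩ := BO.exists_code (8 * j)
  let e : BO.V (8 * j) ≃ Fin (2 ^ (8 * j)) := Fintype.equivFinOfCardEq (BO.card_V _)
  refine ⟨2 ^ (8 * j), ?_, fun x y => (BO.ww s (e.symm x - e.symm y) : ℝ), ?_, ?_, ?_, ?_, ?_⟩
  · have : 8 * j < 2 ^ (8 * j) := Nat.lt_two_pow_self
    omega
  · intro x; simp [BO.ww_zero]
  · intro x y hxy
    have : e.symm x - e.symm y ≠ 0 := by
      rw [sub_ne_zero]; exact fun h => hxy (e.symm.injective h)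
    beta_reduce
    exact_mod_cast BO.ww_pos s (by omega) this
  · intro x y
    beta_reduce
    rw [BO.sub_V, BO.sub_V, add_comm (e.symm x)]
  · intro x y z
    have := BO.ww_add s (e.symm x - e.symm y) (e.symm y - e.symm z)
    rw [sub_add_sub_cancel] at this
    beta_reduce
    exact_mod_cast this
  · intro f c' h
    have hm := BO.main j (by omega) s hs (fun v => f (e v)) c' (fun x y => by
      have := h (e x) (e y)
      simpa only [Equiv.symm_apply_apply] using this)
    have hlog : Real.log ((2 ^ (8 * j) : ℕ) : ℝ) ≤ 8 * j := by
      push_cast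
      rw [Real.log_pow]
      push_cast
      have h1 : Real.log 2 ≤ 1 := by linarith [Real.log_two_lt_d9]
      have h2 : (0:ℝ) ≤ 8 * j := by positivity
      nlinarith
    linarith
end
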